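/- Characters in a relation with the Carlitz period must be trivial: let w ∈ ℕ with (q−1) | w, and suppose a ∈ 𝔽̄_q(θ) and a_{(𝔰,𝛆)} ∈ 𝔽̄_q(θ) (for 𝔰 ∈ S_w, 𝛆 ∈ Γ_N^{depth(𝔰)}), not all zero, satisfy a·ϖ^{w/(q−1)} + Σ_{(𝔰,𝛆)} a_{(𝔰,𝛆)}·μ(𝛆)·Li(𝛆;𝔰) = 0 in 𝔽̄_q((1/θ)). Then a ≠ 0, and a_{(𝔰,𝛆)} = 0 for every 𝛆 ≠ (1,…,1). -/

import Mathlib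

noncomputable section

open scoped Classical

namespace ZHPC

variable (Fq : Type) [Field Fq] [Fintype Fq]

/-- `q`, the cardinality of the base finite field `𝔽_q`. -/
def qc : ℕ := Fintype.card Fq

/-- A fixed algebraic closure `𝔽̄_q` of `𝔽_q`. -/
abbrev Fb := AlgebraicClosure Fq

/-- The field `𝔽̄_q((1/θ))` of formal Laurent series in `1/θ` over `𝔽̄_q`, modeled as the
field of formal Laurent series in one variable, `θ` being the inverse of that variable. -/
abbrev Kinf := LaurentSeries (Fb Fq)

/-- The embedding of the constants `𝔽̄_q → 𝔽̄_q((1/θ))`. -/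
def cst : Fb Fq →+* Kinf Fq := HahnSeries.C

/-- The element `θ`. -/
def theta : Kinf Fq := HahnSeries.single (-1 : ℤ) 1

/-- `ℓ_d = ∏_{i=1}^{d} (θ - θ^{q^i})`, with `ℓ_0 = 1`. -/
def ell (d : ℕ) : Kinf Fq := ∏ i ∈ Finset.Icc 1 d, (theta Fq - theta Fq ^ qc Fq ^ i)

/-- Arrays `(𝛆;𝔰)` of some depth `n`. -/
structure PArr (F : Type) where
  depth : ℕ
  s : Fin depth → ℕ
  eps : Fin depth → F

namespace PArr

variable {F : Type}

/-- A *positive array* for level `N`: all entries `sᵢ` are positive integers and all the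
characters `εᵢ` are `N`-th roots of unity. -/
def Positive [Monoid F] (N : ℕ) (A : PArr F) : Prop := (∀ i, 0 < A.s i) ∧ ∀ i, A.eps i ^ N = 1

/-- The weight `w(𝔰) = s₁ + ⋯ + s_n`. -/
def wt (A : PArr F) : ℕ := ∑ i, A.s i

/-- The `i`-th entry of `𝔰` (`0`-indexed), with value `0` beyond the depth. -/
def sAt (A : PArr F) (i : ℕ) : ℕ := if h : i < A.depth then A.s ⟨i, h⟩ else 0

/-- The partial sums `s₁ + ⋯ + s_i` (entries beyond the depth being `0`). -/
def psum (A : PArr F) (i : ℕ) : ℕ := ∑ j ∈ Finset.range i, A.sAt j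

/-- The character `χ(𝛆) = ε₁ ⋯ ε_n`. -/
def chi [CommMonoid F] (A : PArr F) : F := ∏ i, A.eps i

end PArr

/-- The Carlitz multiple polylogarithm at roots of unity
`Li(𝛆;𝔰) = Σ_{d₁ > ⋯ > d_n ≥ 0} ε₁^{d₁}⋯ε_n^{d_n} / (ℓ_{d₁}^{s₁}⋯ℓ_{d_n}^{s_n})`. -/
def Li (A : PArr (Fb Fq)) : Kinf Fq :=
  ∑' d : {f : Fin A.depth → ℕ // StrictAnti f},
    ∏ i, cst Fq (A.eps i ^ d.1 i) / ell Fq (d.1 i) ^ A.s i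

/-- `Si_d(𝛆;𝔰)`: same summand as `Li`, over decreasing tuples with `d₁ = d`. -/
def Sid (d : ℤ) (A : PArr (Fb Fq)) : Kinf Fq :=
  ∑' f : {f : Fin A.depth → ℕ // StrictAnti f ∧ ∀ i : Fin A.depth, i.val = 0 → (f i : ℤ) = d},
    ∏ i, cst Fq (A.eps i ^ f.1 i) / ell Fq (f.1 i) ^ A.s i

/-- `Si_{<d}(𝛆;𝔰)`: same summand as `Li`, over decreasing tuples with `d > d₁`. -/
def SidLt (d : ℤ) (A : PArr (Fb Fq)) : Kinf Fq :=
  ∑' f : {f : Fin A.depth → ℕ // StrictAnti f ∧ ∀ i : Fin A.depth, (f i : ℤ) < d},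
    ∏ i, cst Fq (A.eps i ^ f.1 i) / ell Fq (f.1 i) ^ A.s i

/-- The value at `θ` of the monic polynomial `θ^e + Σ_{j<e} c_j θ^j ∈ A = 𝔽_q[θ]`. -/
def monicVal (e : ℕ) (c : Fin e → Fq) : Kinf Fq :=
  theta Fq ^ e + ∑ j, cst Fq (algebraMap Fq (Fb Fq) (c j)) * theta Fq ^ (j : ℕ)

/-- The power sum `S_d(𝛆;𝔰)`, a sum over tuples of monic polynomials `a₁, …, a_n ∈ A₊`
with `d = deg a₁ > ⋯ > deg a_n ≥ 0`; a monic polynomial of degree `e` is encoded by its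
tuple of lower coefficients `c : Fin e → Fq`. -/
def Sd (d : ℤ) (A : PArr (Fb Fq)) : Kinf Fq :=
  ∑' e : {f : Fin A.depth → ℕ // StrictAnti f ∧ ∀ i : Fin A.depth, i.val = 0 → (f i : ℤ) = d},
    ∑ c : (∀ i, Fin (e.1 i) → Fq),
      ∏ i, cst Fq (A.eps i ^ e.1 i) / monicVal Fq (e.1 i) (c i) ^ A.s i

/-- The `N`-th cyclotomic multiple zeta value `ζ_A(𝛆;𝔰) = Σ_{d ≥ 0} S_d(𝛆;𝔰)`. -/
def zetaA (A : PArr (Fb Fq)) : Kinf Fq := ∑' d : ℕ, Sd Fq (d : ℤ) A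

/-- The cyclotomic field `k_N = 𝔽_q(ζ_N) ⊆ 𝔽̄_q`. -/
def kN (N : ℕ) : Subfield (Fb Fq) :=
  Subfield.closure (Set.range (algebraMap Fq (Fb Fq)) ∪ {x | x ^ N = 1})

/-- The field `K_N = k_N(θ)`, as a subfield of `𝔽̄_q((1/θ))`. -/
def KNf (N : ℕ) : Subfield (Kinf Fq) :=
  Subfield.closure ((cst Fq '' (kN Fq N : Set (Fb Fq))) ∪ {theta Fq})

/-- The ring `A_N = k_N[θ]`, as a subring of `𝔽̄_q((1/θ))`. -/
def AN (N : ℕ) : Subring (Kinf Fq) :=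
  Subring.closure ((cst Fq '' (kN Fq N : Set (Fb Fq))) ∪ {theta Fq})

/-- `CZ_{N,w}`: the `K_N`-span of the `N`-th cyclotomic multiple zeta values of weight `w`. -/
def CZ (N w : ℕ) : Submodule (KNf Fq N) (Kinf Fq) :=
  Submodule.span (KNf Fq N) {x | ∃ A : PArr (Fb Fq), A.Positive N ∧ A.wt = w ∧ x = zetaA Fq A}

/-- `CL_{N,w}`: the `K_N`-span of the CMPL's at `N`-th roots of unity of weight `w`. -/
def CL (N w : ℕ) : Submodule (KNf Fq N) (Kinf Fq) :=
  Submodule.span (KNf Fq N) {x | ∃ A : PArr (Fb Fq), A.Positive N ∧ A.wt = w ∧ x = Li Fq A}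

/-- The index set of pairs `(𝔰,𝛆)` with `𝔰 ∈ S_w` and `𝛆 ∈ Γ_N^{depth 𝔰}`: positive arrays
of weight `w` with `q ∤ sᵢ` for all `i`. -/
def SwIdx (N w : ℕ) : Type :=
  {A : PArr (Fb Fq) // A.Positive N ∧ 0 < A.depth ∧ A.wt = w ∧ ∀ i, ¬ qc Fq ∣ A.s i}

/-- `R = [k_N : 𝔽_q]`: the least `r ≥ 1` such that all `N`-th roots of unity lie in
`𝔽_{q^r}` (the fixed field of the `r`-th iterate of the `q`-Frobenius). -/
def Rdeg (N : ℕ) : ℕ := sInf {r | 0 < r ∧ ∀ x : Fb Fq, x ^ N = 1 → x ^ qc Fq ^ r = x}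

/-- The field `𝔽̄_q(θ)`, as a subfield of `𝔽̄_q((1/θ))`. -/
def Fbtheta : Subfield (Kinf Fq) :=
  Subfield.closure ((Set.range fun x : Fb Fq => cst Fq x) ∪ {theta Fq})

/-- `ϖ = (-θ)^q · ∏_{i ≥ 1} (1 - θ^{1-q^i})^{-(q-1)}`, the `(q-1)`-st power of the Carlitz
period `π̃`, viewed in `𝔽̄_q((1/θ))`. -/
def piInf : Kinf Fq :=
  (-theta Fq) ^ qc Fq *
    ∏' i : ℕ, (1 - theta Fq ^ ((1 : ℤ) - (qc Fq : ℤ) ^ (i + 1))) ^ (-((qc Fq : ℤ) - 1))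

set_option synthInstance.maxHeartbeats 1000000

section
lemma finsum_sub_shift {F : Type*} [AddCommGroup F] (u v : ℤ → F) (hu : (Function.support u).Finite)
    (hv : (Function.support v).Finite) :
    ∑ᶠ a, (u a - v (a - 1)) = ∑ᶠ a, u a - ∑ᶠ a, v a := by
  have e : ∑ᶠ a, v (a - 1) = ∑ᶠ a, v a := finsum_comp_equiv (Equiv.subRight (1:ℤ)) (f := v)
  rw [← e]
  refine finsum_sub_distrib hu ?_
  exact hv.preimage (f := fun a : ℤ => a - 1) (fun a _ b _ h => by simpa using h)

lemma line_support {F : Type*} [AddCommGroup F] (E : ℤ → ℤ → F) (ρ B m c : ℤ) (hm : m < ρ)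
    (hE : ∀ a b, E a b ≠ 0 → 0 ≤ a ∧ ρ * a - B ≤ b) :
    Function.support (fun a => E a (c + m * a)) ⊆ Set.Icc 0 (c + B) := by
  intro a ha
  obtain ⟨h0, h1⟩ := hE _ _ ha
  refine ⟨h0, ?_⟩
  nlinarith

lemma schwarz {F : Type*} [AddCommGroup F] (ρ : ℤ) (hρ : 0 ≤ ρ) (S : Finset ℤ) :
    ∀ (E : ℤ → ℤ → F) (B : ℤ) (_ : ∀ m ∈ S, 0 ≤ m ∧ m < ρ)
    (_ : ∀ a b, E a b ≠ 0 → 0 ≤ a ∧ ρ * a - B ≤ b)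
    (_ : ∀ m ∈ S, ∀ c, ∑ᶠ a, E a (c + m * a) = 0) (a b : ℤ), E a b ≠ 0 →
      -B + ∑ m ∈ S, (ρ - m) ≤ b := by
  induction S using Finset.induction_on with
  | empty =>
    intro E B hS hE _ a b h
    obtain ⟨h0, h1⟩ := hE a b h
    simp; nlinarith
  | insert m S hmS ih =>
    intro E B hS hE hL a b hab
    have hm := hS m (Finset.mem_insert_self _ _)
    set G : ℤ → ℤ → F := fun a b => ∑ i ∈ Finset.Icc 0 a, E i (b - m * a + m * i) with hG
    have hEG : ∀ a b, E a b = G a b - G (a - 1) (b - m) := by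
      intro a b
      by_cases h0 : 0 ≤ a
      · have : Finset.Icc 0 a = insert a (Finset.Icc 0 (a - 1)) := by
          ext x; simp; omega
        simp only [hG]
        rw [this, Finset.sum_insert (by simp)]
        have e1 : b - m * a + m * a = b := by ring
        rw [e1, add_sub_assoc, left_eq_add, sub_eq_zero]
        refine Finset.sum_congr rfl fun i _ => ?_
        congr 1; ring
      · have h1 : E a b = 0 := by
          by_contra h; exact h0 (hE a b h).1
        simp only [hG]
        rw [Finset.Icc_eq_empty (by omega), Finset.Icc_eq_empty (by omega)]
        simp [h1]
    have hGs : ∀ a b, G a b ≠ 0 → 0 ≤ a ∧ ρ * a - (B - (ρ - m)) ≤ b := by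
      intro a b h
      have h0 : 0 ≤ a := by
        by_contra h0
        apply h; simp only [hG]; rw [Finset.Icc_eq_empty (by omega)]; simp
      refine ⟨h0, ?_⟩
      by_contra hb
      push Not at hb
      apply h
      have h2 := hL m (Finset.mem_insert_self _ _) (b - m * a)
      rw [finsum_eq_sum_of_support_subset (s := Finset.Icc 0 a)] at h2
      · exact h2
      · intro i hi
        obtain ⟨hi0, hi1⟩ := hE _ _ hi
        simp only [Finset.coe_Icc, Set.mem_Icc]
        refine ⟨hi0, ?_⟩
        by_contra hia
        nlinarith [mul_le_mul_of_nonneg_left (show a + 1 ≤ i by omega) (show 0 ≤ ρ - m by omega)]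
    have hGL : ∀ m' ∈ S, ∀ c, ∑ᶠ a, G a (c + m' * a) = 0 := by
      intro m' hm' c
      have hne : m' ≠ m := fun h => hmS (h ▸ hm')
      have hm'2 := hS m' (Finset.mem_insert_of_mem hm')
      have hfin : ∀ c, (Function.support (fun a => G a (c + m' * a))).Finite := fun c =>
        (Set.finite_Icc _ _).subset (line_support G ρ _ m' c hm'2.2 hGs)
      have hstep : ∀ c, ∑ᶠ a, G a (c + m' * a) = ∑ᶠ a, G a (c + (m' - m) + m' * a) := by
        intro c
        have h := hL m' (Finset.mem_insert_of_mem hm') c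
        rw [← sub_eq_zero, ← finsum_sub_shift _ _ (hfin _) (hfin _), ← h]
        refine finsum_congr fun a => ?_
        rw [hEG]
        congr 2; ring
      have hstep2 : ∀ (k : ℕ) c, ∑ᶠ a, G a (c + m' * a) = ∑ᶠ a, G a (c + k * (m' - m) + m' * a) := by
        intro k
        induction k with
        | zero => intro c; simp
        | succ k ihk =>
          intro c
          rw [ihk, hstep]
          refine finsum_congr fun a => ?_
          congr 1; push_cast; ring
      have hneg : ∀ c, c < -(B - (ρ - m)) → ∑ᶠ a, G a (c + m' * a) = 0 := by
        intro c hc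
        rw [← finsum_zero (α := ℤ)]
        refine finsum_congr fun a => ?_
        by_contra h
        have := line_support G ρ _ m' c hm'2.2 hGs (show a ∈ _ from h)
        simp at this; omega
      set k : ℕ := (c + (B - (ρ - m))).natAbs + 1
      have hk : c + (B - (ρ - m)) < k := by omega
      rcases lt_or_gt_of_ne hne with h | h
      · rw [hstep2 k c]
        apply hneg
        nlinarith [mul_le_mul_of_nonneg_left (show m' - m ≤ -1 by omega) (show (0:ℤ) ≤ k by omega)]
      · have := hstep2 k (c - k * (m' - m))
        simp only [sub_add_cancel] at this
        rw [← this]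
        apply hneg
        nlinarith [mul_le_mul_of_nonneg_left (show 1 ≤ m' - m by omega) (show (0:ℤ) ≤ k by omega)]
    have key := ih G (B - (ρ - m)) (fun m hm => hS m (Finset.mem_insert_of_mem hm)) hGs hGL
    rw [Finset.sum_insert hmS]
    by_cases h1 : G a b = 0
    · have : G (a - 1) (b - m) ≠ 0 := by
        intro h2; apply hab; rw [hEG, h1, h2]; simp
      have := key _ _ this
      omega
    · have := key _ _ h1
      omega
end

section
def sec {R : Type*} [CommRing R] (Q l : ℕ) (P : PowerSeries R) : PowerSeries R :=
  PowerSeries.mk fun n => PowerSeries.coeff (Q * n + l) P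

lemma sec_mul_expand {R : Type*} [CommRing R] (Q l : ℕ) (hQ : Q ≠ 0) (hl : l < Q)
    (P f : PowerSeries R) : sec Q l (P * PowerSeries.expand Q hQ f) = sec Q l P * f := by
  ext n
  simp only [sec, PowerSeries.coeff_mk, PowerSeries.coeff_mul]
  symm
  refine Finset.sum_of_injOn (fun x => (Q * x.1 + l, Q * x.2)) ?_ ?_ ?_ ?_
  · rintro ⟨a, b⟩ _ ⟨c, d⟩ _ h
    simp at h
    ext <;> simp <;> tauto
  · rintro ⟨a, b⟩ h
    have h' : a + b = n := by simpa using h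
    have : Q * a + l + Q * b = Q * n + l := by rw [← h']; ring
    simpa using this
  · rintro ⟨a, b⟩ h h'
    replace h : a + b = Q * n + l := by simpa using h
    rw [PowerSeries.coeff_expand]
    split_ifs with hb
    · exfalso
      apply h'
      obtain ⟨b, rfl⟩ := hb
      have hbn : b ≤ n := by
        by_contra hh
        have : Q * (n + 1) ≤ Q * b := Nat.mul_le_mul_left _ (by omega)
        rw [mul_add] at this; omega
      obtain ⟨k, rfl⟩ := Nat.exists_eq_add_of_le hbn
      refine ⟨(k, b), by simp [add_comm], ?_⟩
      simp only [Prod.mk.injEq, and_true]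
      rw [mul_add] at h; omega
    · simp
  · rintro ⟨a, b⟩ h
    simp [PowerSeries.coeff_expand_mul]

lemma finite_conditions {R : Type*} [CommRing R] [IsDomain R] {κ : Type*} [Fintype κ]
    (v : ℕ → κ → R) (h : ∀ x : κ → R, (∀ n, ∑ i, v n i * x i = 0) → x = 0) :
    ∃ T, ∀ x : κ → R, (∀ n < T, ∑ i, v n i * x i = 0) → x = 0 := by
  let K := FractionRing R
  let W : ℕ →o (Submodule K (κ → K))ᵒᵈ :=
    { toFun := fun T => OrderDual.toDual
        { carrier := {x | ∀ n < T, ∑ i, algebraMap R K (v n i) * x i = 0}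
          add_mem' := by
            intro a b ha hb n hn
            simp [mul_add, Finset.sum_add_distrib, ha n hn, hb n hn]
          zero_mem' := by intro n hn; simp
          smul_mem' := by
            intro c a ha n hn
            have := ha n hn
            simp only [Pi.smul_apply, smul_eq_mul]
            rw [show ∑ i, algebraMap R K (v n i) * (c * a i) = c * ∑ i, algebraMap R K (v n i) * a i by
              rw [Finset.mul_sum]; exact Finset.sum_congr rfl fun _ _ => by ring]
            rw [this, mul_zero] }
      monotone' := by
        intro a b hab x hx n hn
        exact hx n (lt_of_lt_of_le hn hab) }
  obtain ⟨T, hT⟩ := IsArtinian.monotone_stabilizes W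
  have key : ∀ x : κ → R, ∀ n, (∀ m < n, ∑ i, v m i * x i = 0) ↔
      (fun i => algebraMap R K (x i)) ∈ OrderDual.ofDual (W n) := by
    intro x n
    refine forall₂_congr fun m _ => ?_
    simp only [← map_mul, ← map_sum]
    exact (IsFractionRing.to_map_eq_zero_iff (K := K)).symm
  refine ⟨T, fun x hx => h x fun n => ?_⟩
  have h1 := (key x T).1 hx
  rw [hT (max T (n+1)) (le_max_left _ _)] at h1
  exact (key x _).2 h1 n (by simp)

lemma exists_ne_zero_of_card {F κ η : Type*} [Field F] [Fintype κ] [Fintype η] (A : η → κ → F)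
    (h : Fintype.card η < Fintype.card κ) : ∃ x : κ → F, x ≠ 0 ∧ ∀ e, ∑ i, x i * A e i = 0 := by
  let φ : (κ → F) →ₗ[F] (η → F) := Matrix.mulVecLin (Matrix.of A)
  have : LinearMap.ker φ ≠ ⊥ := LinearMap.ker_ne_bot_of_finrank_lt (by simpa using h)
  obtain ⟨x, hx, hx0⟩ := Submodule.exists_mem_ne_zero_of_ne_bot this
  refine ⟨x, hx0, fun e => ?_⟩
  have := congrFun (LinearMap.mem_ker.1 hx) e
  simpa [φ, Matrix.mulVec, dotProduct, mul_comm] using this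
end

section
def zc2 {F : Type*} [Field F] (f : PowerSeries (Polynomial F)) (a b : ℤ) : F :=
  if 0 ≤ a ∧ 0 ≤ b then (PowerSeries.coeff b.toNat f).coeff a.toNat else 0

def fQ {F : Type*} [Field F] (Q : ℕ) (f : PowerSeries (Polynomial F)) (a b : ℤ) : F :=
  if (Q : ℤ) ∣ b then zc2 f a (b / Q) else 0

def zc {F : Type*} [Field F] (g : PowerSeries F) (n : ℤ) : F :=
  if 0 ≤ n then PowerSeries.coeff n.toNat g else 0

lemma zc2_ne {F : Type*} [Field F] {f : PowerSeries (Polynomial F)}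
    (hf : ∀ b, (PowerSeries.coeff b f).natDegree ≤ b) {a b : ℤ} (h : zc2 f a b ≠ 0) :
    0 ≤ a ∧ a ≤ b := by
  unfold zc2 at h
  split_ifs at h with h1
  · refine ⟨h1.1, ?_⟩
    have := (Polynomial.le_natDegree_of_ne_zero h).trans (hf _)
    omega
  · simp at h

lemma fQ_ne {F : Type*} [Field F] {f : PowerSeries (Polynomial F)} {Q : ℕ}
    (hf : ∀ b, (PowerSeries.coeff b f).natDegree ≤ b) {a b : ℤ} (h : fQ Q f a b ≠ 0) :
    0 ≤ a ∧ Q * a ≤ b := by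
  unfold fQ at h
  split_ifs at h with h1
  · obtain ⟨c, rfl⟩ := h1
    by_cases hQ : (Q : ℤ) = 0
    · have := zc2_ne hf h
      simp [hQ] at this ⊢
      exact this.1
    · rw [Int.mul_ediv_cancel_left _ hQ] at h
      have := zc2_ne hf h
      exact ⟨this.1, mul_le_mul_of_nonneg_left this.2 (by positivity)⟩
  · simp at h

lemma line_sum {F : Type*} [Field F] (f : PowerSeries (Polynomial F)) (L : PowerSeries F)
    (u m : ℕ) (hu : 2 ≤ u) (hm : m ≠ 0)
    (hf : ∀ b, (PowerSeries.coeff b f).natDegree ≤ b)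
    (hL : ∀ n, PowerSeries.coeff n L = ∑ b ∈ Finset.range (n + 1),
      if n ≤ u * b then (PowerSeries.coeff b f).coeff (u * b - n) else 0) (c : ℤ) :
    ∑ᶠ a, fQ (m * u) f a (c + m * a) = zc (PowerSeries.expand m hm L) c := by
  by_cases hc : (m : ℤ) ∣ c
  swap
  · have : zc (PowerSeries.expand m hm L) c = 0 := by
      unfold zc
      split_ifs with h
      · apply PowerSeries.coeff_expand_of_not_dvd
        intro h'; apply hc
        have := Int.natCast_dvd_natCast.2 h'
        rwa [Int.toNat_of_nonneg h] at this
      · rfl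
    rw [this]
    refine finsum_eq_zero_of_forall_eq_zero fun a => ?_
    unfold fQ
    rw [if_neg]
    intro h'
    apply hc
    have : (m : ℤ) ∣ c + m * a := dvd_trans (by push_cast; exact dvd_mul_right _ _) h'
    exact (Int.dvd_add_left (dvd_mul_right _ _)).1 this
  obtain ⟨n, rfl⟩ := hc
  have hm' : (m : ℤ) ≠ 0 := by exact_mod_cast hm
  have hm0 : (0 : ℤ) < m := by positivity
  have hu0 : (u : ℤ) ≠ 0 := by omega
  have h1 : ∀ a, fQ (m * u) f a (m * n + m * a) =
      if (u : ℤ) ∣ n + a then zc2 f a ((n + a) / u) else 0 := by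
    intro a
    unfold fQ
    rw [← mul_add]
    push_cast
    simp only [mul_dvd_mul_iff_left hm', Int.mul_ediv_mul_of_pos _ _ hm0]
  simp only [h1]
  have h2 : ∀ a, (if (u : ℤ) ∣ n + a then zc2 f a ((n + a) / u) else 0) ≠ 0 →
      ∃ b : ℕ, (b : ℤ) ≤ n ∧ a = u * b - n := by
    intro a ha
    split_ifs at ha with hd
    · obtain ⟨b, hb⟩ := hd
      rw [hb, Int.mul_ediv_cancel_left _ hu0] at ha
      have := zc2_ne hf ha
      obtain ⟨b, rfl⟩ := Int.eq_ofNat_of_zero_le (this.1.trans this.2)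
      refine ⟨b, ?_, by omega⟩
      have : (2:ℤ) * b ≤ u * b := mul_le_mul_of_nonneg_right (by omega) (by positivity)
      omega
    · simp at ha
  rcases lt_or_ge n 0 with hn | hn
  · have : zc (PowerSeries.expand m hm L) (m * n) = 0 := by
      unfold zc
      rw [if_neg]
      intro h
      nlinarith
    rw [this]
    refine finsum_eq_zero_of_forall_eq_zero fun a => ?_
    by_contra h
    obtain ⟨b, hb, -⟩ := h2 a h
    omega
  obtain ⟨n, rfl⟩ := Int.eq_ofNat_of_zero_le hn
  have h3 : zc (PowerSeries.expand m hm L) (m * n) = PowerSeries.coeff n L := by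
    unfold zc
    rw [if_pos (by positivity), show ((m : ℤ) * n).toNat = m * n by
      rw [← Nat.cast_mul, Int.toNat_natCast], PowerSeries.coeff_expand_mul]
  rw [h3, hL, finsum_eq_sum_of_support_subset (s := (Finset.range (n+1)).image
    (fun b : ℕ => (u * b - n : ℤ))), Finset.sum_image]
  · refine Finset.sum_congr rfl fun b _ => ?_
    have : (n : ℤ) + (u * b - n) = u * b := by ring
    rw [this, if_pos (dvd_mul_right _ _), Int.mul_ediv_cancel_left _ hu0]
    unfold zc2
    by_cases h : n ≤ u * b
    · have h' : (n : ℤ) ≤ u * b := by exact_mod_cast h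
      rw [if_pos ⟨by omega, by omega⟩, if_pos h]
      congr 1
      rw [← Nat.cast_mul, ← Nat.cast_sub h, Int.toNat_natCast]
    · have h' : ¬ (n : ℤ) ≤ u * b := by exact_mod_cast h
      rw [if_neg (by omega), if_neg h]
  · intro a _ b _ h
    have : (u : ℤ) * a = u * b := by
      change (u * a - n : ℤ) = u * b - n at h
      omega
    exact_mod_cast mul_left_cancel₀ hu0 this
  · intro a ha
    obtain ⟨b, hb, rfl⟩ := h2 a ha
    simp only [Finset.coe_image, Set.mem_image, Finset.coe_range, Set.mem_Iio]
    exact ⟨b, by omega, rfl⟩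
end

section
lemma finite_order {R : Type*} [CommRing R] [IsDomain R] {ι : Type*} [Fintype ι]
    (f : ι → PowerSeries R)
    (hind : ∀ P : ι → Polynomial R, ∑ i, (P i : PowerSeries R) * f i = 0 → P = 0) (D : ℕ) :
    ∃ T : ℕ, ∀ x : ι × Fin D → R, (∀ n < T, ∑ y, (if (y.2 : ℕ) ≤ n then
      PowerSeries.coeff (n - y.2) (f y.1) else 0) * x y = 0) → x = 0 := by
  refine finite_conditions (fun n (y : ι × Fin D) => if (y.2 : ℕ) ≤ n then
      PowerSeries.coeff (n - y.2) (f y.1) else 0) ?_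
  intro x hx
  have := hind (fun i => ∑ j : Fin D, Polynomial.monomial (j : ℕ) (x (i, j))) ?_
  · funext ⟨i, j⟩
    have h := congrArg (fun P => Polynomial.coeff P (j : ℕ)) (congrFun this i)
    simpa [Polynomial.finsetSum_coeff, Polynomial.coeff_monomial, ← Fin.ext_iff] using h
  · ext n
    rw [map_zero, ← hx n, map_sum, Fintype.sum_prod_type]
    refine Finset.sum_congr rfl fun i _ => ?_
    simp only [← Polynomial.coeToPowerSeries.ringHom_apply, map_sum, Finset.sum_mul]
    refine Finset.sum_congr rfl fun j _ => ?_
    rw [← Polynomial.C_mul_X_pow_eq_monomial, Polynomial.coeToPowerSeries.ringHom_apply,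
      Polynomial.coe_mul, Polynomial.coe_pow, Polynomial.coe_C, Polynomial.coe_X, mul_assoc,
      PowerSeries.coeff_C_mul, PowerSeries.coeff_X_pow_mul', mul_comm]

lemma siegel_point {F ι κ : Type*} [Field F] [Fintype ι] [Fintype κ] (p : ℕ) [Fact p.Prime]
    [CharP F p] (m e : ℕ) (hme : m = p ^ e) (hm : m ≠ 0) (L : ι → PowerSeries F)
    (hL : ∀ i, L i ^ m = PowerSeries.expand m hm (L i)) (d : ι → Polynomial F)
    (hd : ∑ i, (d i : PowerSeries F) * L i = 0) (i0 : ι) (hi0 : d i0 ≠ 0)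
    (ix : κ → ι) (ex : κ → ℕ) (c : κ → F) (U B : ℕ) (hex : ∀ x, ex x < U)
    (hdeg : ∀ i, m * (d i).natDegree ≤ B)
    (hc : ∀ i, i ≠ i0 → ∀ n < U + B, ∑ x, c x *
      ((if ix x = i then Polynomial.X ^ ex x else 0) * d i0 ^ m -
        (if ix x = i0 then Polynomial.X ^ ex x else 0) * d i ^ m).coeff n = 0) (n : ℤ) :
    ∑ x, c x * zc (PowerSeries.expand m hm (L (ix x))) (n - ex x) = 0 := by
  by_cases hn : 0 ≤ n
  swap
  · refine Finset.sum_eq_zero fun x _ => ?_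
    unfold zc
    rw [if_neg (by omega), mul_zero]
  obtain ⟨n, rfl⟩ := Int.eq_ofNat_of_zero_le hn
  set P : ι → Polynomial F := fun i => ∑ x, Polynomial.C (c x) *
    (if ix x = i then Polynomial.X ^ ex x else 0) with hP
  have hPd : ∀ i, P i * d i0 ^ m = P i0 * d i ^ m := by
    intro i
    by_cases hi : i = i0
    · rw [hi]
    rw [← sub_eq_zero]
    ext n
    have e1 : P i * d i0 ^ m - P i0 * d i ^ m = ∑ x, Polynomial.C (c x) *
      ((if ix x = i then Polynomial.X ^ ex x else 0) * d i0 ^ m -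
        (if ix x = i0 then Polynomial.X ^ ex x else 0) * d i ^ m) := by
      simp only [hP, Finset.sum_mul, ← Finset.sum_sub_distrib]
      exact Finset.sum_congr rfl fun _ _ => by ring
    rw [e1]
    simp only [Polynomial.finsetSum_coeff, Polynomial.coeff_C_mul, Polynomial.coeff_zero]
    by_cases hnU : n < U + B
    · exact hc i hi n hnU
    · refine Finset.sum_eq_zero fun x _ => ?_
      have key : ∀ i i', ((if ix x = i then Polynomial.X ^ ex x else 0) * d i' ^ m).coeff n = 0 := by
        intro i i'
        apply Polynomial.coeff_eq_zero_of_natDegree_lt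
        have h1 : (if ix x = i then (Polynomial.X : Polynomial F) ^ ex x else 0).natDegree ≤ ex x := by
          split_ifs <;> simp
        have h2 := hdeg i'
        have h3 := hex x
        have h4 : (d i' ^ m).natDegree ≤ m * (d i').natDegree := Polynomial.natDegree_pow_le
        have := Polynomial.natDegree_mul_le (p := (if ix x = i then (Polynomial.X : Polynomial F) ^ ex x else 0)) (q := d i' ^ m)
        omega
      rw [Polynomial.coeff_sub, key, key]; simp
  have hsum : ∑ i, (d i : PowerSeries F) ^ m * L i ^ m = 0 := by
    simp only [← mul_pow]
    have : CharP (PowerSeries F) p := by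
      have : Function.Injective (PowerSeries.C (R := F)) := PowerSeries.C_injective
      exact charP_of_injective_ringHom this p
    subst hme
    rw [← sum_pow_char_pow, hd, zero_pow hm]
  have hPL : ∑ i, (P i : PowerSeries F) * PowerSeries.expand m hm (L i) = 0 := by
    have h0 : ((d i0 : PowerSeries F)) ^ m ≠ 0 := by
      apply pow_ne_zero
      simpa using hi0
    apply mul_left_cancel₀ h0
    rw [mul_zero, Finset.mul_sum]
    calc _ = ∑ i, (P i0 : PowerSeries F) * ((d i : PowerSeries F) ^ m * L i ^ m) := by
          refine Finset.sum_congr rfl fun i _ => ?_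
          have := congrArg (fun P : Polynomial F => (P : PowerSeries F)) (hPd i)
          simp only [Polynomial.coe_mul, Polynomial.coe_pow] at this
          rw [hL, ← mul_assoc, ← mul_assoc, ← this]; ring
      _ = _ := by rw [← Finset.mul_sum, hsum, mul_zero]
  have := congrArg (PowerSeries.coeff n) hPL
  rw [map_zero] at this
  rw [← this, map_sum]
  simp only [hP, ← Polynomial.coeToPowerSeries.ringHom_apply, map_sum, Finset.sum_mul, map_mul]
  rw [Finset.sum_comm]
  refine Finset.sum_congr rfl fun x _ => ?_
  rw [Finset.sum_eq_single (ix x)]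
  · simp only [if_true, map_pow, Polynomial.coeToPowerSeries.ringHom_apply, Polynomial.coe_C,
      Polynomial.coe_X]
    rw [mul_assoc, PowerSeries.coeff_C_mul, PowerSeries.coeff_X_pow_mul']
    congr 1
    unfold zc
    by_cases h : ex x ≤ n
    · rw [if_pos h, if_pos (by omega)]; congr 2; omega
    · rw [if_neg h, if_neg (by omega)]
  · intro i _ hi
    rw [if_neg (Ne.symm hi)]; simp
  · simp
end

section
lemma arith_count (r T C V Dt Dx Q : ℕ) (hr : 0 < r) (hQ : 0 < Q) (hDx : Dx = 2 * r * (C + 1))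
    (hDt : Dt = 2 * r ^ 2 * (T + 1)) (hV : V = Dt + T + 1) :
    V * ((r - 1) * (Q * Dx + Q + C * Q)) < r * (Dt * (Dx * Q)) := by
  obtain ⟨s, rfl⟩ : ∃ s, r = s + 1 := ⟨r - 1, by omega⟩
  subst hV hDt hDx
  simp only [Nat.add_sub_cancel]
  have h1 : 0 < Q * (C + 1) * (T + 1) := by positivity
  nlinarith [Nat.zero_le (Q * (C + 1) * (T + 1) * s), Nat.zero_le (Q * (C + 1) * (T + 1) * s^2),
    Nat.zero_le (Q * (C + 1) * (T + 1) * s^3)]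

/-- final step: `E` vanishing to high order forces `p = 0`. -/
lemma lift_final {F ι : Type*} [Field F] [Fintype ι] (f : ι → PowerSeries (Polynomial F))
    (Dx Dt Q T : ℕ) (hQ : 0 < Q)
    (hT : ∀ x : ι × Fin Dx → Polynomial F, (∀ n < T, ∑ y, (if (y.2 : ℕ) ≤ n then
      PowerSeries.coeff (n - y.2) (f y.1) else 0) * x y = 0) → x = 0)
    (p : ι × Fin Dt × Fin Dx × Fin Q → F)
    (hE : ∀ a b : ℤ, (b < Q * T) → ∑ x : ι × Fin Dt × Fin Dx × Fin Q, p x *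
      fQ Q (f x.1) (a - (x.2.1 : ℕ)) (b - (Q * (x.2.2.1 : ℕ) + (x.2.2.2 : ℕ))) = 0) : p = 0 := by
  have key : ∀ l : Fin Q, (fun y : ι × Fin Dx => ∑ α : Fin Dt, Polynomial.C (p (y.1, α, y.2, l)) *
      Polynomial.X ^ (α : ℕ)) = 0 := by
    intro l
    apply hT
    intro n hn
    ext a
    have h := hE a (Q * n + l) (by
      have : Q * (n + 1) ≤ Q * T := Nat.mul_le_mul_left _ hn
      have h2 := l.2
      have h3 : Q * n + l < Q * T := by rw [mul_add] at this; omega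
      exact_mod_cast h3)
    rw [Polynomial.coeff_zero, ← h, Polynomial.finsetSum_coeff]
    simp only [Fintype.sum_prod_type, Finset.mul_sum, Polynomial.finsetSum_coeff]
    refine Finset.sum_congr rfl fun i _ => ?_
    rw [Finset.sum_comm]
    refine Finset.sum_congr rfl fun α _ => ?_
    refine Finset.sum_congr rfl fun j _ => ?_
    rw [Finset.sum_eq_single l]
    · rw [show ∀ A B C : Polynomial F, A * (B * C) = B * (A * C) by intros; ring,
        Polynomial.coeff_C_mul, Polynomial.coeff_mul_X_pow']
      congr 1
      have e1 : (Q * n + (l : ℕ) - (Q * (j : ℕ) + (l : ℕ)) : ℤ) = Q * ((n : ℤ) - (j : ℕ)) := by ring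
      unfold fQ
      rw [e1, if_pos (dvd_mul_right _ _), Int.mul_ediv_cancel_left _ (by exact_mod_cast hQ.ne')]
      unfold zc2
      by_cases h1 : (α : ℕ) ≤ a
      · by_cases h2 : (j : ℕ) ≤ n
        · rw [if_pos h1, if_pos h2, if_pos (by constructor <;> omega)]
          congr 2
          · congr 1; omega
          · omega
        · rw [if_pos h1, if_neg h2, if_neg (by omega)]; simp
      · rw [if_neg h1, if_neg (by omega)]
    · intro l' _ hl
      have : fQ Q (f i) ((a : ℤ) - (α : ℕ)) (Q * n + (l : ℕ) - (Q * (j : ℕ) + (l' : ℕ))) = 0 := by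
        unfold fQ
        rw [if_neg]
        intro hd
        have h2 : (Q : ℤ) ∣ (l : ℕ) - (l' : ℕ) := by
          have := dvd_sub hd (dvd_mul_right (Q : ℤ) (n - (j : ℕ)))
          rwa [show (Q * n + (l : ℕ) - (Q * (j : ℕ) + (l' : ℕ)) - Q * (n - (j : ℕ)) : ℤ) =
            (l : ℕ) - (l' : ℕ) by ring] at this
        apply hl
        have := Int.eq_zero_of_abs_lt_dvd h2 (by rw [abs_lt]; omega)
        ext; omega
      rw [this, mul_zero]
    · simp
  funext ⟨i, α, j, l⟩
  have h := congrArg (fun P => Polynomial.coeff P (α : ℕ)) (congrFun (key l) (i, j))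
  simp only [Polynomial.finsetSum_coeff, Pi.zero_apply, Polynomial.coeff_zero,
    Polynomial.coeff_C_mul, Polynomial.coeff_X_pow] at h
  rw [Finset.sum_eq_single α] at h
  · simpa using h
  · intro β _ hβ
    rw [if_neg (fun h => hβ (Fin.ext h.symm)), mul_zero]
  · simp

theorem lifting {F ι : Type*} [Field F] [Fintype ι] [Nonempty ι] (p : ℕ) [Fact p.Prime]
    [CharP F p] (q e : ℕ) (hqe : q = p ^ e) (hq : 2 ≤ q)
    (f : ι → PowerSeries (Polynomial F)) (hf : ∀ i b, (PowerSeries.coeff b (f i)).natDegree ≤ b)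
    (L : ℕ → ι → PowerSeries F)
    (hL : ∀ k, 1 ≤ k → ∀ i n, PowerSeries.coeff n (L k i) = ∑ b ∈ Finset.range (n + 1),
      if n ≤ q ^ k * b then (PowerSeries.coeff b (f i)).coeff (q ^ k * b - n) else 0)
    (R : ℕ) (hR : 0 < R)
    (hLm : ∀ k j i (h : q ^ (R * j) ≠ 0), L k i ^ (q ^ (R * j)) =
      PowerSeries.expand (q ^ (R * j)) h (L k i)) (C : ℕ)
    (hd : ∀ k, ∃ d : ι → Polynomial F, d ≠ 0 ∧ (∀ i, (d i).natDegree ≤ C * q ^ k) ∧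
      ∑ i, (d i : PowerSeries F) * L k i = 0) :
    ∃ P : ι → Polynomial (Polynomial F), P ≠ 0 ∧
      ∑ i, (P i : PowerSeries (Polynomial F)) * f i = 0 := by
  by_contra hno
  have hind : ∀ P : ι → Polynomial (Polynomial F),
      ∑ i, (P i : PowerSeries (Polynomial F)) * f i = 0 → P = 0 := by
    intro P hP; by_contra h; exact hno ⟨P, h, hP⟩
  set r := Fintype.card ι with hr
  have hr0 : 0 < r := Fintype.card_pos
  obtain ⟨T, hT⟩ := finite_order f hind (2 * r * (C + 1))
  set Dx := 2 * r * (C + 1) with hDx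
  set Dt := 2 * r ^ 2 * (T + 1) with hDt
  set V := Dt + T + 1 with hV
  set M := R * V + Dt + V with hM
  set Q := q ^ M with hQ
  have hq0 : 0 < q := by omega
  have hQ0 : 0 < Q := by positivity
  let m : Fin V → ℕ := fun j => q ^ (R * (j + 1))
  let k : Fin V → ℕ := fun j => M - R * (j + 1)
  have hRj : ∀ j : Fin V, R * (j + 1) ≤ R * V := fun j => Nat.mul_le_mul_left _ j.2
  have hm0 : ∀ j, m j ≠ 0 := fun j => by positivity
  have hk1 : ∀ j, 1 ≤ k j := fun j => by have := hRj j; simp only [k]; omega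
  have hmk : ∀ j, m j * q ^ k j = Q := fun j => by
    have := hRj j
    simp only [m, k, hQ, ← pow_add]; congr 1; omega
  have hmb : ∀ j, ∀ c, c ≤ Dt + V → m j * c ≤ Q := fun j c hc => by
    have h1 : c ≤ q ^ k j := by
      have h2 : c ≤ k j := by have := hRj j; simp only [k]; omega
      exact h2.trans (Nat.lt_pow_self (by omega)).le
    rw [← hmk j]; exact Nat.mul_le_mul_left _ h1
  have hDt2 : 2 ≤ Dt := by
    have : 0 < r ^ 2 * (T + 1) := by positivity
    rw [hDt, mul_assoc]; omega
  have hmQ : ∀ j, m j < Q := fun j => by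
    have h1 := hmb j 2 (by omega)
    have := hm0 j
    omega
  choose d hd0 hddeg hdrel using hd
  have : ∀ j, ∃ i, d (k j) i ≠ 0 := fun j => Function.ne_iff.1 (hd0 (k j))
  choose i0 hi0 using this
  let ex : Fin V → ι × Fin Dt × Fin Dx × Fin Q → ℕ := fun j x =>
    Q * (x.2.2.1 : ℕ) + (x.2.2.2 : ℕ) + m j * (Dt - (x.2.1 : ℕ))
  have hex : ∀ j x, ex j x < Q * Dx + Q := by
    rintro j ⟨i, α, n, l⟩
    have h1 : Q * ((n : ℕ) + 1) ≤ Q * Dx := Nat.mul_le_mul_left _ n.2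
    have h2 := hmb j (Dt - α) (by omega)
    have h3 := l.2
    simp only [ex]
    rw [mul_add] at h1; omega
  let η := Σ j : Fin V, ({i : ι // i ≠ i0 j} × Fin (Q * Dx + Q + C * Q))
  let A : η → (ι × Fin Dt × Fin Dx × Fin Q) → F := fun e x =>
    ((if x.1 = (e.2.1 : ι) then Polynomial.X ^ ex e.1 x else 0) * d (k e.1) (i0 e.1) ^ m e.1 -
        (if x.1 = i0 e.1 then Polynomial.X ^ ex e.1 x else 0) * d (k e.1) e.2.1 ^ m e.1).coeff e.2.2
  have hcard : Fintype.card η < Fintype.card (ι × Fin Dt × Fin Dx × Fin Q) := by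
    have h1 : ∀ j, Fintype.card {i : ι // i ≠ i0 j} = r - 1 := by
      intro j; rw [Fintype.card_subtype_compl]; simp [hr]
    simp only [η, Fintype.card_sigma, Fintype.card_prod, Fintype.card_fin, h1, Finset.sum_const,
      Finset.card_univ, smul_eq_mul]
    exact arith_count r T C V Dt Dx Q hr0 hQ0 hDx hDt hV
  obtain ⟨c, hc0, hc⟩ := exists_ne_zero_of_card A hcard
  apply hc0
  refine lift_final f Dx Dt Q T hQ0 hT c ?_
  have hpt : ∀ j (n : ℤ), ∑ x : ι × Fin Dt × Fin Dx × Fin Q, c x *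
      zc (PowerSeries.expand (m j) (hm0 j) (L (k j) x.1)) (n - ex j x) = 0 := by
    intro j n
    refine siegel_point p (m j) (e * (R * (j + 1))) ?_ (hm0 j) (L (k j)) (fun i => hLm _ _ _ _)
      (d (k j)) (hdrel _) (i0 j) (hi0 j) (fun x => x.1) (ex j) c (Q * Dx + Q) (C * Q) (hex j) ?_ ?_ n
    · simp only [m, hqe]; rw [← pow_mul]
    · intro i
      have h1 := Nat.mul_le_mul_left (m j) (hddeg (k j) i)
      have h2 : m j * (C * q ^ k j) = C * Q := by rw [← hmk j]; ring
      omega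
    · intro i hi n hn
      exact hc ⟨j, ⟨i, hi⟩, ⟨n, hn⟩⟩
  set E : ℤ → ℤ → F := fun a b => ∑ x : ι × Fin Dt × Fin Dx × Fin Q, c x *
      fQ Q (f x.1) (a - (x.2.1 : ℕ)) (b - (Q * (x.2.2.1 : ℕ) + (x.2.2.2 : ℕ))) with hE
  have hsupp : ∀ a b, E a b ≠ 0 → 0 ≤ a ∧ (Q : ℤ) * a - Q * Dt ≤ b := by
    intro a b h
    obtain ⟨⟨i, α, n, l⟩, -, hx⟩ := Finset.exists_ne_zero_of_sum_ne_zero h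
    have h2 := fQ_ne (hf i) (right_ne_zero_of_mul hx)
    simp only at h2
    obtain ⟨h3, h4⟩ := h2
    refine ⟨by omega, ?_⟩
    have h5 : (Q : ℤ) * (α : ℕ) ≤ Q * Dt := mul_le_mul_of_nonneg_left (by have := α.2; omega) (by positivity)
    have h6 : (0 : ℤ) ≤ Q * (n : ℕ) := by positivity
    rw [mul_sub] at h4
    omega
  have hline : ∀ j c, ∑ᶠ a, E a (c + m j * a) = 0 := by
    intro j b
    rw [← hpt j (b + m j * Dt)]
    simp only [hE]
    rw [finsum_sum_comm]
    · refine Finset.sum_congr rfl fun x _ => ?_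
      rw [← mul_finsum]
      · congr 1
        rw [← finsum_comp_equiv (Equiv.addRight ((x.2.1 : ℕ) : ℤ))]
        simp only [Equiv.coe_addRight, add_sub_cancel_right]
        have h2 := line_sum (f x.1) (L (k j) x.1) (q ^ k j) (m j)
          (by calc 2 ≤ q := hq
                _ = q ^ 1 := (pow_one q).symm
                _ ≤ q ^ k j := Nat.pow_le_pow_right hq0 (hk1 j)) (hm0 j) (hf x.1)
          (fun n => hL _ (hk1 j) _ _) (b + m j * Dt - ex j x)
        rw [hmk] at h2
        rw [← h2]
        refine finsum_congr fun a => ?_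
        congr 1
        simp only [ex]
        rw [Nat.cast_add, Nat.cast_mul (m j), Nat.cast_sub x.2.1.2.le]
        push_cast
        ring
    · intro x _
      refine (Set.finite_Icc (0 : ℤ) (b + Q * (x.2.1 : ℕ))).subset ?_
      intro a ha
      have h2 := fQ_ne (hf x.1) (right_ne_zero_of_mul ha)
      have h3 : (m j : ℤ) + 1 ≤ Q := by have := hmQ j; omega
      have h6 : (0 : ℤ) ≤ Q * (x.2.2.1 : ℕ) := by positivity
      obtain ⟨h4, h5⟩ := h2
      have h7 : (0 : ℤ) ≤ a := by omega
      refine ⟨h7, ?_⟩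
      nlinarith [mul_le_mul_of_nonneg_right h3 h7]
  intro a b hb
  by_contra hne
  have h1 := schwarz (Q : ℤ) (by positivity) (Finset.univ.image fun j => (m j : ℤ)) E (Q * Dt)
    ?_ hsupp ?_ a b hne
  · rw [Finset.sum_image] at h1
    · rw [Finset.sum_sub_distrib] at h1
      simp only [Finset.sum_const, Finset.card_univ, Fintype.card_fin, nsmul_eq_mul] at h1
      have h2 : ∑ j, (m j : ℤ) ≤ Q := by
        have h3 : V * ∑ j, m j ≤ V * Q := by
          rw [Finset.mul_sum]
          calc _ ≤ ∑ _j : Fin V, Q := Finset.sum_le_sum fun j _ => by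
                rw [mul_comm]; exact hmb j V (by omega)
            _ = _ := by simp
        exact_mod_cast Nat.le_of_mul_le_mul_left h3 (by omega)
      have : (V : ℤ) * Q = Q * Dt + Q * T + Q := by rw [hV]; push_cast; ring
      omega
    · intro j _ j' _ h
      have h2 : q ^ (R * (j + 1 : ℕ)) = q ^ (R * (j' + 1 : ℕ)) := by
        change (m j : ℤ) = m j' at h
        exact_mod_cast h
      have h3 := Nat.pow_right_injective hq h2
      have h4 := Nat.eq_of_mul_eq_mul_left hR h3
      ext; omega
  · intro z hz
    obtain ⟨j, -, rfl⟩ := Finset.mem_image.1 hz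
    refine ⟨by positivity, ?_⟩
    exact_mod_cast hmQ j
  · intro z hz
    obtain ⟨j, -, rfl⟩ := Finset.mem_image.1 hz
    exact hline j
end

section
def psec {R : Type*} [CommRing R] (Q l : ℕ) (P : Polynomial R) : Polynomial R :=
  ∑ n ∈ Finset.range (P.natDegree + 1), Polynomial.monomial n (P.coeff (Q * n + l))

lemma coeff_psec {R : Type*} [CommRing R] (Q l : ℕ) (hQ : Q ≠ 0) (P : Polynomial R) (n : ℕ) :
    (psec Q l P).coeff n = P.coeff (Q * n + l) := by
  unfold psec
  simp only [Polynomial.finsetSum_coeff, Polynomial.coeff_monomial]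
  rw [Finset.sum_ite_eq']
  split_ifs with h
  · rfl
  · symm
    apply Polynomial.coeff_eq_zero_of_natDegree_lt
    have : 1 * n ≤ Q * n := Nat.mul_le_mul_right _ (by omega)
    simp at h; omega

lemma coe_psec {R : Type*} [CommRing R] (Q l : ℕ) (hQ : Q ≠ 0) (P : Polynomial R) :
    (psec Q l P : PowerSeries R) = sec Q l P := by
  ext n
  simp [sec, coeff_psec Q l hQ]

lemma coe_expand {R : Type*} [CommRing R] (Q : ℕ) (hQ : Q ≠ 0) (P : Polynomial R) :
    (Polynomial.expand R Q P : PowerSeries R) = PowerSeries.expand Q hQ P := by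
  ext n
  rw [Polynomial.coeff_coe, PowerSeries.coeff_expand, Polynomial.coeff_expand (by omega)]
  simp

lemma sec_sum {R ι : Type*} [CommRing R] (Q l : ℕ) (S : Finset ι) (h : ι → PowerSeries R) :
    sec Q l (∑ i ∈ S, h i) = ∑ i ∈ S, sec Q l (h i) := by
  ext n
  simp [sec]

lemma lemmaX {k ι : Type*} [Field k] (q : ℕ) (hq : q ≠ 0) (S : Finset ι) (i0 : ι) (hi0 : i0 ∈ S)
    (g : ι → PowerSeries k)
    (hind : ∀ a : ι → Polynomial k, (∀ i, i ∉ S → a i = 0) → a i0 = 0 →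
      ∑ i ∈ S, (a i : PowerSeries k) * g i = 0 → ∀ i, a i = 0)
    (T : (ι → Polynomial k) → (ι → Polynomial k)) (m : Polynomial k)
    (hTm : ∀ a, (∀ i, i ∉ S → a i = 0) → T a i0 = m * a i0)
    (hT : ∀ a, (∀ i, i ∉ S → a i = 0) → ∑ i ∈ S, (a i : PowerSeries k) * g i = 0 →
      ∑ i ∈ S, (T a i : PowerSeries k) * PowerSeries.expand q hq (g i) = 0)
    (a : ι → Polynomial k) (ha : ∀ i, i ∉ S → a i = 0) (hne : ∃ i, a i ≠ 0)
    (hrel : ∑ i ∈ S, (a i : PowerSeries k) * g i = 0) :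
    ∃ a' : ι → Polynomial k, (∀ i, i ∉ S → a' i = 0) ∧ a' i0 ≠ 0 ∧
      ∑ i ∈ S, (a' i : PowerSeries k) * g i = 0 ∧
      (∀ j ∈ S, T a' j * Polynomial.expand k q (a' i0) = m * a' i0 * Polynomial.expand k q (a' j)) ∧
      Polynomial.expand k q (a' i0) ∣ m * a' i0 := by
  -- divide by the gcd
  obtain ⟨d, hd⟩ : ∃ d, Ideal.span (Set.range fun i : S => a i) = Ideal.span {d} :=
    (IsPrincipalIdealRing.principal _).principal.imp fun d hd => by simpa using hd
  have hdvd : ∀ i, d ∣ a i := by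
    intro i
    by_cases hi : i ∈ S
    · rw [← Ideal.mem_span_singleton, ← hd]
      exact Ideal.subset_span ⟨⟨i, hi⟩, rfl⟩
    · rw [ha i hi]; exact dvd_zero _
  choose a' ha' using hdvd
  obtain ⟨i1, hi1⟩ := hne
  have hd0 : d ≠ 0 := by
    rintro rfl; apply hi1; rw [ha' i1, zero_mul]
  have ha'S : ∀ i, i ∉ S → a' i = 0 := by
    intro i hi
    have := ha i hi
    rw [ha' i] at this
    exact (mul_eq_zero.1 this).resolve_left hd0
  have hrel' : ∑ i ∈ S, (a' i : PowerSeries k) * g i = 0 := by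
    have h0 : (d : PowerSeries k) ≠ 0 := by simpa using hd0
    apply mul_left_cancel₀ h0
    rw [mul_zero, Finset.mul_sum, ← hrel]
    refine Finset.sum_congr rfl fun i _ => ?_
    rw [ha' i, Polynomial.coe_mul, mul_assoc]
  have hcop : ∃ c : S → Polynomial k, ∑ i, c i * a' i = 1 := by
    have : d ∈ Ideal.span (Set.range fun i : S => a i) := by
      rw [hd]; exact Ideal.mem_span_singleton_self d
    obtain ⟨c, hc⟩ := Ideal.mem_span_range_iff_exists_fun.1 this
    refine ⟨c, mul_left_cancel₀ hd0 ?_⟩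
    rw [mul_one, Finset.mul_sum]
    conv_rhs => rw [← hc]
    refine Finset.sum_congr rfl fun i _ => ?_
    rw [ha' i]; ring
  have hai0 : a' i0 ≠ 0 := by
    intro h
    apply hi1
    rw [ha' i1, hind a' ha'S h hrel' i1, mul_zero]
  -- the main identity
  have hmain : ∀ j ∈ S, T a' j * Polynomial.expand k q (a' i0) =
      m * a' i0 * Polynomial.expand k q (a' j) := by
    set b : ι → Polynomial k := fun j => if j ∈ S then T a' j * Polynomial.expand k q (a' i0) -
      m * a' i0 * Polynomial.expand k q (a' j) else 0 with hb
    have hbrel : ∑ i ∈ S, (b i : PowerSeries k) * PowerSeries.expand q hq (g i) = 0 := by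
      have h1 := hT a' ha'S hrel'
      have h2 : ∑ i ∈ S, PowerSeries.expand q hq (a' i : PowerSeries k) *
          PowerSeries.expand q hq (g i) = 0 := by
        simp only [← map_mul, ← map_sum, hrel', map_zero]
      have h3 : ∑ i ∈ S, (b i : PowerSeries k) * PowerSeries.expand q hq (g i) =
          (Polynomial.expand k q (a' i0) : PowerSeries k) *
            ∑ i ∈ S, (T a' i : PowerSeries k) * PowerSeries.expand q hq (g i) -
          (m * a' i0 : Polynomial k) * ∑ i ∈ S, PowerSeries.expand q hq (a' i : PowerSeries k) *
          PowerSeries.expand q hq (g i) := by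
        rw [Finset.mul_sum, Finset.mul_sum, ← Finset.sum_sub_distrib]
        refine Finset.sum_congr rfl fun i hi => ?_
        simp only [hb, if_pos hi]
        rw [← coe_expand, ← Polynomial.coeToPowerSeries.ringHom_apply, map_sub, map_mul, map_mul]
        simp only [Polynomial.coeToPowerSeries.ringHom_apply]
        ring
      rw [h3, h1, h2]; simp
    have hb0 : ∀ j, b j = 0 := by
      intro j
      ext n
      have hl : n % q < q := Nat.mod_lt _ (by omega)
      have h4 := congrArg (sec q (n % q)) hbrel
      rw [sec_sum] at h4
      simp only [sec_mul_expand q _ hq hl, ← coe_psec q _ hq] at h4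
      have h5 := hind (fun i => psec q (n % q) (b i)) ?_ ?_ ?_ j
      · have := congrArg (fun P => Polynomial.coeff P (n / q)) h5
        simp only [coeff_psec q _ hq, Polynomial.coeff_zero] at this
        rwa [Nat.div_add_mod] at this
      · intro i hi
        simp [hb, hi, psec]
      · simp [hb, hi0, psec, hTm a' ha'S]
      · rw [h4]; ext; simp [sec]
    intro j hj
    have := hb0 j
    simp only [hb, if_pos hj] at this
    exact sub_eq_zero.1 this
  refine ⟨a', ha'S, hai0, hrel', hmain, ?_⟩
  obtain ⟨c, hc⟩ := hcop
  have h1 := congrArg (Polynomial.expand k q) hc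
  rw [map_one, map_sum] at h1
  rw [← mul_one (m * a' i0), ← h1, Finset.mul_sum]
  refine Finset.dvd_sum fun i _ => ?_
  rw [map_mul, show ∀ A B C : Polynomial k, A * (B * C) = B * (A * C) by intros; ring,
    ← hmain i i.2]
  exact Dvd.intro_left _ (by rw [mul_assoc])

lemma expand_dvd_mono {k : Type*} [Field k] (q : ℕ) (hq : 2 ≤ q) (a : Polynomial k) (ha : a ≠ 0)
    (c : k) (hc : c ≠ 0) (n : ℕ)
    (h : Polynomial.expand k q a ∣ Polynomial.C c * Polynomial.X ^ n * a) :
    ∃ c' e, c' ≠ 0 ∧ a = Polynomial.C c' * Polynomial.X ^ e ∧ q * e ≤ n + e := by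
  obtain ⟨u, hu, hu0⟩ := Polynomial.exists_eq_pow_rootMultiplicity_mul_and_not_dvd a ha 0
  set e := Polynomial.rootMultiplicity 0 a
  simp only [map_zero, sub_zero] at hu hu0
  have hune : u ≠ 0 := by rintro rfl; simp at hu0
  have hX : ¬ (Polynomial.X : Polynomial k) ∣ Polynomial.expand k q u := by
    rw [Polynomial.X_dvd_iff] at hu0 ⊢
    rw [Polynomial.coeff_expand (by omega)]
    simpa using hu0
  have hcop : IsCoprime (Polynomial.expand k q u) (Polynomial.C c * Polynomial.X ^ n * Polynomial.X ^ e) := by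
    rw [mul_assoc, ← pow_add]
    refine IsCoprime.mul_right ?_ ?_
    · exact (isCoprime_one_right).of_isCoprime_of_dvd_right (Polynomial.isUnit_C.2 hc.isUnit).dvd
    · exact ((Polynomial.prime_X.coprime_iff_not_dvd).2 hX).symm.pow_right
  have hdu : Polynomial.expand k q u ∣ u := by
    apply hcop.dvd_of_dvd_mul_left
    rw [mul_assoc _ _ u, ← hu]
    refine dvd_trans ?_ h
    rw [hu, map_mul]; exact dvd_mul_left _ _
  have hdeg : u.natDegree = 0 := by
    have := Polynomial.natDegree_le_of_dvd hdu hune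
    rw [Polynomial.natDegree_expand] at this
    nlinarith
  obtain ⟨c', rfl⟩ : ∃ c', u = Polynomial.C c' := ⟨_, Polynomial.eq_C_of_natDegree_eq_zero hdeg⟩
  have hc' : c' ≠ 0 := by simpa using hune
  have hae : a.natDegree = e := by rw [hu, mul_comm, Polynomial.natDegree_C_mul_X_pow _ _ hc']
  refine ⟨c', e, hc', by rw [hu]; ring, ?_⟩
  have h2 := Polynomial.natDegree_le_of_dvd h (by
    refine mul_ne_zero (mul_ne_zero (by simpa using hc) (by simp)) ha)
  rw [Polynomial.natDegree_expand, hae, Polynomial.natDegree_mul (mul_ne_zero (by simpa using hc) (by simp)) ha,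
    Polynomial.natDegree_C_mul_X_pow _ _ hc, hae] at h2
  linarith
end

section
def pz {F : Type*} [Field F] (g : Polynomial F) (n : ℤ) : F := if 0 ≤ n then g.coeff n.toNat else 0

lemma pz_zero {F : Type*} [Field F] (n : ℤ) : pz (0 : Polynomial F) n = 0 := by simp [pz]

lemma eq_zero_of_pz {F : Type*} [Field F] (g : Polynomial F) (h : ∀ n, pz g n = 0) : g = 0 := by
  ext n
  simpa [pz] using h n

lemma pz_ne {F : Type*} [Field F] (g : Polynomial F) (n : ℤ) (h : pz g n ≠ 0) :
    0 ≤ n ∧ n ≤ g.natDegree := by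
  unfold pz at h
  split_ifs at h with h1
  · have := Polynomial.le_natDegree_of_ne_zero h
    omega
  · simp at h

lemma orbit_zero {F : Type*} [Field F] (q : ℤ) (hq : 2 ≤ q) (m : ℤ) (g : Polynomial F)
    (Pr : ℤ → Prop) (h1 : ∀ j, Pr j → pz g j ≠ 0) (h2 : ∀ j, Pr j → Pr (q * j + m)) (j : ℤ)
    (hj : Pr j) : (q - 1) * j + m = 0 := by
  have key : ∀ n : ℕ, ∃ j', Pr j' ∧ (q - 1) * j' + m = q ^ n * ((q - 1) * j + m) := by
    intro n
    induction n with
    | zero => exact ⟨j, hj, by simp⟩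
    | succ n ih =>
      obtain ⟨j', hj', e⟩ := ih
      exact ⟨_, h2 _ hj', by rw [pow_succ, mul_right_comm, ← e]; ring⟩
  by_contra hne
  set D := (q - 1) * j + m
  set B : ℤ := (q - 1) * g.natDegree + |m|
  have hB : 0 ≤ B := by have : 0 ≤ q - 1 := by omega
                        positivity
  obtain ⟨j', hj', e⟩ := key (B.toNat + 1)
  have hb := pz_ne g j' (h1 _ hj')
  have h3 : |(q - 1) * j' + m| ≤ B := by
    have h4 : (q - 1) * j' ≤ (q - 1) * g.natDegree := mul_le_mul_of_nonneg_left hb.2 (by omega)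
    have h5 : 0 ≤ (q - 1) * j' := mul_nonneg (by omega) hb.1
    have := abs_add_le ((q - 1) * j') m
    rw [abs_of_nonneg h5] at this
    omega
  rw [e, abs_mul, abs_of_nonneg (by positivity)] at h3
  have h6 : 1 ≤ |D| := Int.one_le_abs hne
  have h7 : ((B.toNat + 1 : ℕ) : ℤ) < q ^ (B.toNat + 1) := by
    obtain ⟨q', rfl⟩ := Int.eq_ofNat_of_zero_le (show 0 ≤ q by omega)
    exact_mod_cast Nat.lt_pow_self (n := B.toNat + 1) (by omega : 1 < q')
  have h8 : q ^ (B.toNat + 1) * 1 ≤ q ^ (B.toNat + 1) * |D| := mul_le_mul_of_nonneg_left h6 (by positivity)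
  omega

lemma pz_eq {F : Type*} [Field F] (q : ℕ) (hq : 2 ≤ q) (u u' : F) (A B : ℕ)
    (h g : Polynomial F) (e : Polynomial.C u * Polynomial.X ^ A * h =
      Polynomial.C u' * Polynomial.X ^ B * Polynomial.expand F q g) (j : ℤ) :
    u * pz h (j + (B - A)) = u' * (if (q : ℤ) ∣ j then pz g (j / q) else 0) := by
  have hq0 : (0 : ℤ) < q := by omega
  by_cases hN : 0 ≤ j + B
  · obtain ⟨N, hN⟩ := Int.eq_ofNat_of_zero_le hN
    have h1 := congrArg (fun P => Polynomial.coeff P N) e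
    simp only [mul_assoc, Polynomial.coeff_C_mul, Polynomial.coeff_X_pow_mul'] at h1
    have h2 : pz h (j + (B - A)) = if A ≤ N then h.coeff (N - A) else 0 := by
      unfold pz
      by_cases hA : A ≤ N
      · rw [if_pos hA, if_pos (by omega)]; congr 1; omega
      · rw [if_neg hA, if_neg (by omega)]
    have h3 : (if (q : ℤ) ∣ j then pz g (j / q) else 0) =
        if B ≤ N then (Polynomial.expand F q g).coeff (N - B) else 0 := by
      rw [Polynomial.coeff_expand (by omega)]
      by_cases hB : B ≤ N
      · rw [if_pos hB]
        have hj : j = ((N - B : ℕ) : ℤ) := by omega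
        rw [hj]
        simp only [Int.natCast_dvd_natCast]
        split_ifs with hd
        · unfold pz
          rw [if_pos (by positivity), ← Int.natCast_div, Int.toNat_natCast]
        · rfl
      · rw [if_neg hB]
        have : j / q < 0 := Int.ediv_neg_of_neg_of_pos (by omega) hq0
        have hz : pz g (j / q) = 0 := by unfold pz; rw [if_neg (by omega)]
        rw [hz]; simp
    rw [h2, h3, h1]
  · have : j / q < 0 := Int.ediv_neg_of_neg_of_pos (by omega) hq0
    have hz : pz g (j / q) = 0 := by unfold pz; rw [if_neg (by omega)]
    have hz' : pz h (j + (B - A)) = 0 := by unfold pz; rw [if_neg (by omega)]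
    rw [hz, hz']; simp

lemma residual {F α : Type*} [Field F] [Fintype α] (q : ℕ) (hq : 2 ≤ q) (s : α → ℕ) (e : α → F)
    (hs : ∀ c, 0 < s c) (hqs : ∀ c, ¬ q ∣ s c) (hinj : ∀ c c', s c = s c' → e c = e c' → c = c')
    (g : List α → Polynomial F) (n : ℕ) (wt : List α → ℕ) (hwt : ∀ c l, wt (c :: l) = s c + wt l)
    (hn : ∀ l, n < wt l → g l = 0) (u : List α → F) (u' : F) (hu : ∀ l, u l ≠ 0) (hu' : u' ≠ 0)
    (huc : ∀ c l, u (c :: l) = u l * e c) (A B : List α → ℕ) (m0 : ℤ)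
    (hAB : ∀ l, wt l ≤ n → (B l : ℤ) - A l = m0 - q * wt l)
    (hg : ∀ l, wt l ≤ n → Polynomial.C (u l) * Polynomial.X ^ A l * (g l + ∑ c, g (c :: l)) =
      Polynomial.C u' * Polynomial.X ^ B l * Polynomial.expand F q (g l)) :
    ∀ l, (∀ c, g (c :: l) = 0) ∧ (g l ≠ 0 → u l = u' ∧ ∃ i : ℕ, ((q : ℤ) - 1) * i = -(m0 - q * wt l)) := by
  suffices H : ∀ d l, n + 1 ≤ wt l + d → (∀ c, g (c :: l) = 0) ∧
      (∀ i, pz (g l) i ≠ 0 → u l = u' ∧ ((q : ℤ) - 1) * i = -(m0 - q * wt l)) by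
    intro l
    obtain ⟨h1, h2⟩ := H (n + 1) l (by omega)
    refine ⟨h1, fun hne => ?_⟩
    obtain ⟨i, hi⟩ : ∃ i, pz (g l) i ≠ 0 := by
      by_contra h; push Not at h; exact hne (eq_zero_of_pz _ h)
    obtain ⟨h3, h4⟩ := h2 i hi
    obtain ⟨i, rfl⟩ := Int.eq_ofNat_of_zero_le (pz_ne _ _ hi).1
    exact ⟨h3, i, h4⟩
  intro d
  induction d with
  | zero =>
    intro l hl
    refine ⟨fun c => hn _ (by rw [hwt]; omega), fun i hi => ?_⟩
    rw [hn l (by omega), pz_zero] at hi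
    exact absurd rfl hi
  | succ d ih =>
    intro l hl
    by_cases hln : n < wt l
    · refine ⟨fun c => hn _ (by rw [hwt]; omega), fun i hi => ?_⟩
      rw [hn l (by omega), pz_zero] at hi
      exact absurd rfl hi
    push Not at hln
    have hch := fun c => (ih (c :: l) (by rw [hwt]; have := hs c; omega)).2
    set m : ℤ := m0 - q * wt l with hm
    have hmc : ∀ c, m0 - q * wt (c :: l) = m - q * s c := by
      intro c; rw [hwt, hm]; push_cast; ring
    set cc : ℤ → F := fun j => ∑ c, pz (g (c :: l)) j with hcc
    have hccne : ∀ j, cc j ≠ 0 → ∃ c, u l * e c = u' ∧ ((q : ℤ) - 1) * j + m = q * s c := by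
      intro j hj
      obtain ⟨c, -, hc⟩ := Finset.exists_ne_zero_of_sum_ne_zero hj
      obtain ⟨h1, h2⟩ := hch c j hc
      rw [hmc] at h2
      exact ⟨c, by rw [← huc]; exact h1, by linarith⟩
    have heq : ∀ j, u l * (pz (g l) (j + m) + cc (j + m)) =
        u' * (if (q : ℤ) ∣ j then pz (g l) (j / q) else 0) := by
      intro j
      have := pz_eq q hq _ _ _ _ _ _ (hg l hln) j
      rw [hAB l hln, ← hm] at this
      rw [← this]
      congr 1
      simp only [hcc, pz]
      split_ifs <;> simp [Polynomial.finsetSum_coeff]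
    have hq0 : (q : ℤ) ≠ 0 := by omega
    have heq1 : ∀ i, u l * (pz (g l) (q * i + m) + cc (q * i + m)) = u' * pz (g l) i := by
      intro i
      rw [heq, if_pos (dvd_mul_right _ _), Int.mul_ediv_cancel_left _ hq0]
    have heq2 : ∀ j, ¬ (q : ℤ) ∣ j - m → pz (g l) j + cc j = 0 := by
      intro j hj
      have := heq (j - m)
      rw [if_neg hj, mul_zero, sub_add_cancel] at this
      exact (mul_eq_zero.1 this).resolve_left (hu l)
    have hcc0 : ∀ j, cc j = 0 := by
      intro j0
      by_contra hj0
      obtain ⟨c, hc1, hc2⟩ := hccne j0 hj0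
      have hE : pz (g l) (j0 - s c) = 0 := by
        have h1 : ¬ (q : ℤ) ∣ (j0 - s c) - m := by
          rintro ⟨t, ht⟩
          apply hqs c
          have : (s c : ℤ) = q * (j0 - s c - t) := by linarith
          exact_mod_cast Dvd.intro _ this.symm
        have h2 := heq2 _ h1
        have h3 : cc (j0 - s c) = 0 := by
          by_contra h3
          obtain ⟨c', -, hc'⟩ := hccne _ h3
          apply hqs c
          have : (s c : ℤ) = q * s c' := by linarith
          exact_mod_cast Dvd.intro _ this.symm
        rwa [h3, add_zero] at h2
      have h4 := heq1 (j0 - s c)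
      rw [hE, mul_zero, show (q : ℤ) * (j0 - s c) + m = j0 by linarith] at h4
      have h5 := (mul_eq_zero.1 h4).resolve_left (hu l)
      have h6 : pz (g l) j0 ≠ 0 := by
        intro h; rw [h, zero_add] at h5; exact hj0 h5
      have h7 := orbit_zero q (by omega) m (g l)
        (fun j => pz (g l) j ≠ 0 ∧ ∃ r : ℤ, 0 < r ∧ ((q : ℤ) - 1) * j + m = q * r)
        (fun j h => h.1) ?_ j0 ⟨h6, s c, by have := hs c; omega, hc2⟩
      · rw [hc2] at h7
        have := hs c
        rcases mul_eq_zero.1 h7 with h | h <;> omega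
      · rintro j ⟨hj, r, hr, hrj⟩
        have h8 : ((q : ℤ) - 1) * (q * j + m) + m = q * (q * r) := by rw [← hrj]; ring
        refine ⟨?_, q * r, by positivity, h8⟩
        have h9 : cc (q * j + m) = 0 := by
          by_contra h9
          obtain ⟨c', -, hc'⟩ := hccne _ h9
          apply hqs c'
          rw [h8] at hc'
          have := mul_left_cancel₀ hq0 hc'
          exact_mod_cast Dvd.intro _ this
        have h10 := heq1 j
        rw [h9, add_zero] at h10
        intro h11
        rw [h11, mul_zero] at h10
        exact (mul_ne_zero hu' hj) h10.symm
    constructor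
    · intro c
      apply eq_zero_of_pz
      intro j
      by_contra hj
      apply hj
      have h1 := hcc0 j
      simp only [hcc] at h1
      rwa [Finset.sum_eq_single c] at h1
      · intro c' _ hne
        by_contra hj'
        apply hne
        obtain ⟨a1, a2⟩ := hch c j hj
        obtain ⟨b1, b2⟩ := hch c' j hj'
        rw [hmc] at a2 b2
        rw [huc] at a1 b1
        apply hinj
        · have : (q : ℤ) * s c' = q * s c := by linarith
          exact_mod_cast mul_left_cancel₀ hq0 this
        · exact mul_left_cancel₀ (hu l) (b1.trans a1.symm)
      · simp
    · intro i hi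
      have hstep : ∀ j, u l * pz (g l) (q * j + m) = u' * pz (g l) j := by
        intro j
        have := heq1 j
        rwa [hcc0, add_zero] at this
      have h7 := orbit_zero q (by omega) m (g l) (fun j => pz (g l) j ≠ 0) (fun j h => h)
        (fun j hj h => (mul_ne_zero hu' hj) (by rw [← hstep, h, mul_zero])) i hi
      refine ⟨?_, by linarith⟩
      have h8 := hstep i
      rw [show (q : ℤ) * i + m = i by linarith] at h8
      exact mul_right_cancel₀ hi h8
end

section
open PowerSeries in
lemma ps_eq_of_forall_dvd {R : Type*} [CommRing R] (a b : PowerSeries R)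
    (h : ∀ D : ℕ, (X : PowerSeries R) ^ D ∣ a - b) : a = b := by
  ext n
  have := (X_pow_dvd_iff.1 (h (n + 1))) n (by omega)
  rwa [map_sub, sub_eq_zero] at this

def plim {R : Type*} [CommRing R] (u : ℕ → PowerSeries R) : PowerSeries R :=
  PowerSeries.mk fun n => PowerSeries.coeff n (u (n + 1))

open PowerSeries in
lemma plim_spec {R : Type*} [CommRing R] (u : ℕ → PowerSeries R)
    (h : ∀ D : ℕ, (X : PowerSeries R) ^ D ∣ u (D + 1) - u D) (D : ℕ) :
    (X : PowerSeries R) ^ D ∣ plim u - u D := by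
  have key : ∀ D E : ℕ, (X : PowerSeries R) ^ D ∣ u (D + E) - u D := by
    intro D E
    induction E with
    | zero => simp
    | succ E ih =>
      have h1 : (X : PowerSeries R) ^ D ∣ u (D + E + 1) - u (D + E) :=
        (pow_dvd_pow _ (by omega)).trans (h _)
      have := dvd_add h1 ih
      rw [sub_add_sub_cancel] at this
      exact this
  rw [X_pow_dvd_iff]
  intro n hn
  obtain ⟨E, rfl⟩ := Nat.exists_eq_add_of_le (show n + 1 ≤ D from hn)
  have := (X_pow_dvd_iff.1 (key (n + 1) E)) n (by omega)
  rw [map_sub, sub_eq_zero] at this ⊢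
  rw [this]; simp [plim]

/-- evaluation at `z = 1` of a bivariate series -/
def E1 {F : Type*} [Field F] (h : PowerSeries (PowerSeries F)) : PowerSeries F :=
  PowerSeries.mk fun n => ∑ b ∈ Finset.range (2 * n + 1), PowerSeries.coeff n (PowerSeries.coeff b h)

def OK1 {F : Type*} [Field F] (h : PowerSeries (PowerSeries F)) : Prop :=
  ∀ b n, 2 * n < b → PowerSeries.coeff n (PowerSeries.coeff b h) = 0

open PowerSeries in
lemma E1_trunc {F : Type*} [Field F] (h : PowerSeries (PowerSeries F)) (hh : OK1 h) (M n : ℕ)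
    (hn : 2 * n < M) : coeff n (E1 h) = coeff n (Polynomial.eval 1 (trunc M h)) := by
  rw [E1, coeff_mk, Polynomial.eval_eq_sum_range' (n := M) (by
    have : 0 < M := by omega
    obtain ⟨M, rfl⟩ : ∃ M', M = M' + 1 := ⟨M - 1, by omega⟩
    exact natDegree_trunc_lt h M)]
  simp only [one_pow, mul_one, map_sum]
  rw [← Finset.sum_subset (Finset.range_subset_range.2 (show 2 * n + 1 ≤ M by omega))]
  · refine Finset.sum_congr rfl fun b hb => ?_
    rw [coeff_trunc, if_pos]
    have := Finset.mem_range.1 hb; omega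
  · intro b hb hb'
    rw [coeff_trunc]
    split_ifs
    · exact hh b n (by simp at hb'; omega)
    · simp

open PowerSeries in
lemma E1_mul {F : Type*} [Field F] (h g : PowerSeries (PowerSeries F)) (hh : OK1 h) (hg : OK1 g)
    (hhg : OK1 (h * g)) : E1 (h * g) = E1 h * E1 g := by
  ext n
  set M := 2 * n + 1
  have h1 : coeff n (E1 h * E1 g) =
      coeff n (Polynomial.eval 1 (trunc M h) * Polynomial.eval 1 (trunc M g)) := by
    rw [coeff_mul, coeff_mul]
    refine Finset.sum_congr rfl fun x hx => ?_
    have : x.1 + x.2 = n := by simpa using hx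
    rw [E1_trunc h hh M _ (by omega), E1_trunc g hg M _ (by omega)]
  rw [h1, ← Polynomial.eval_mul, E1_trunc _ hhg M n (by omega)]
  rw [Polynomial.eval_eq_sum_range' (n := M) (p := trunc M (h * g))
    (natDegree_trunc_lt _ _), Polynomial.eval_eq_sum_range]
  simp only [one_pow, mul_one, map_sum]
  have htt : ∀ b, coeff n ((trunc M h * trunc M g).coeff b) = if b < M then
      coeff n (coeff b (h * g)) else 0 := by
    intro b
    split_ifs with hb
    · have e1 : (trunc M h * trunc M g).coeff b = coeff b (h * g) := by
        have := congrArg (fun P => Polynomial.coeff P b) (trunc_trunc_mul_trunc (n := M) h g)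
        simp only [coeff_trunc, if_pos hb] at this
        rw [← this, ← Polynomial.coe_mul, Polynomial.coeff_coe]
      rw [e1]
    · rw [Polynomial.coeff_mul, map_sum]
      refine Finset.sum_eq_zero fun x hx => ?_
      have hx' : x.1 + x.2 = b := by simpa using hx
      rw [coeff_mul]
      refine Finset.sum_eq_zero fun y hy => ?_
      have hy' : y.1 + y.2 = n := by simpa using hy
      rw [coeff_trunc, coeff_trunc]
      by_cases hlt : 2 * y.1 < x.1
      · split_ifs <;> simp [hh _ _ hlt]
      · have : 2 * y.2 < x.2 := by omega
        split_ifs <;> simp [hg _ _ this]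
  simp only [htt]
  rw [← Finset.sum_filter]
  symm
  refine Finset.sum_subset_zero_on_sdiff ?_ ?_ ?_
  · intro b; simp
  · intro b hb
    simp only [Finset.mem_sdiff, Finset.mem_range, Finset.mem_filter, not_and] at hb
    have hb2 : (trunc M h * trunc M g).natDegree < b := by
      by_contra hc; exact hb.2 (by omega) hb.1
    have := htt b
    rw [if_pos hb.1, Polynomial.coeff_eq_zero_of_natDegree_lt hb2, map_zero] at this
    rw [coeff_trunc, if_pos hb.1, ← this]
  · intro b hb
    simp only [Finset.mem_filter] at hb
    rw [coeff_trunc, if_pos hb.2]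
end

section
def goodSub (F : Type*) [Field F] (q : ℕ) : Subring (PowerSeries (Polynomial F)) where
  carrier := {f | ∀ b, q * (PowerSeries.coeff b f).natDegree ≤ b}
  mul_mem' := by
    intro f g hf hg b
    rw [PowerSeries.coeff_mul]
    rcases Nat.eq_zero_or_pos q with rfl | hq
    · simp
    refine (Nat.mul_le_mul_left _ (m := b / q) ?_).trans (Nat.mul_div_le b q)
    refine Polynomial.natDegree_sum_le_of_forall_le _ _ fun x hx => ?_
    have hx' : x.1 + x.2 = b := by simpa using hx
    refine Polynomial.natDegree_mul_le.trans ?_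
    rw [Nat.le_div_iff_mul_le hq]
    have h1 := hf x.1
    have h2 := hg x.2
    nlinarith
  one_mem' := by
    intro b
    rw [PowerSeries.coeff_one]; split_ifs <;> simp
  add_mem' := by
    intro f g hf hg b
    rw [map_add]
    have h1 := hf b
    have h2 := hg b
    have := Polynomial.natDegree_add_le (PowerSeries.coeff b f) (PowerSeries.coeff b g)
    rcases le_max_iff.1 this with h | h
    · exact (Nat.mul_le_mul_left _ h).trans h1
    · exact (Nat.mul_le_mul_left _ h).trans h2
  zero_mem' := by intro b; simp
  neg_mem' := by intro f hf b; simpa using hf b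

variable {F : Type*} [Field F] {q : ℕ}

def trk (q k : ℕ) (f : PowerSeries (Polynomial F)) : PowerSeries (PowerSeries F) :=
  PowerSeries.mk fun b => (Polynomial.reflect (q ^ k * b) (PowerSeries.coeff b f) : PowerSeries F)

def reflHom (n : ℕ) : Polynomial F →+ Polynomial F where
  toFun := Polynomial.reflect n
  map_zero' := Polynomial.reflect_zero
  map_add' f g := Polynomial.reflect_add f g n

lemma trk_one (k : ℕ) : trk q k (1 : PowerSeries (Polynomial F)) = 1 := by
  ext1 b
  rw [trk, PowerSeries.coeff_mk, PowerSeries.coeff_one, PowerSeries.coeff_one]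
  split_ifs with h <;> simp [h, Polynomial.reflect_one]

lemma trk_add (k : ℕ) (f g : PowerSeries (Polynomial F)) :
    trk q k (f + g) = trk q k f + trk q k g := by
  ext1 b
  simp [trk, Polynomial.reflect_add]

lemma good_le {f : PowerSeries (Polynomial F)} (hq : 2 ≤ q) (hf : f ∈ goodSub F q) (k b : ℕ) :
    (PowerSeries.coeff b f).natDegree ≤ q ^ k * b := by
  have h1 : q * (PowerSeries.coeff b f).natDegree ≤ b := hf b
  have h2 : b ≤ q ^ k * b := Nat.le_mul_of_pos_left _ (by positivity)
  nlinarith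

lemma trk_mul (hq : 2 ≤ q) (k : ℕ) (f g : PowerSeries (Polynomial F)) (hf : f ∈ goodSub F q)
    (hg : g ∈ goodSub F q) :
    trk q k (f * g) = trk q k f * trk q k g := by
  ext1 b
  rw [PowerSeries.coeff_mul]
  simp only [trk, PowerSeries.coeff_mk]
  rw [PowerSeries.coeff_mul, show ∀ P : Polynomial F, Polynomial.reflect (q ^ k * b) P =
    reflHom (q ^ k * b) P from fun _ => rfl, map_sum, ← Polynomial.coeToPowerSeries.ringHom_apply,
    map_sum]
  refine Finset.sum_congr rfl fun x hx => ?_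
  have hx' : x.1 + x.2 = b := by simpa using hx
  show Polynomial.coeToPowerSeries.ringHom (Polynomial.reflect (q ^ k * b)
    (PowerSeries.coeff x.1 f * PowerSeries.coeff x.2 g)) = _
  rw [← hx', Nat.mul_add, Polynomial.reflect_mul _ _ (good_le hq hf k _) (good_le hq hg k _), map_mul]
  rfl

lemma trk_ok (hq : 2 ≤ q) (k : ℕ) (f : PowerSeries (Polynomial F)) (hf : f ∈ goodSub F q) :
    OK1 (trk q k f) := by
  intro b n hn
  rw [trk, PowerSeries.coeff_mk, Polynomial.coeff_coe, Polynomial.coeff_reflect]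
  have h1 : q * (PowerSeries.coeff b f).natDegree ≤ b := hf b
  have h2 : b ≤ q ^ k * b := Nat.le_mul_of_pos_left _ (by positivity)
  rw [Polynomial.revAt_le (by omega)]
  apply Polynomial.coeff_eq_zero_of_natDegree_lt
  have : 2 * (PowerSeries.coeff b f).natDegree ≤ b := by nlinarith
  omega

lemma E1_add (h g : PowerSeries (PowerSeries F)) : E1 (h + g) = E1 h + E1 g := by
  ext n; simp [E1, Finset.sum_add_distrib]

lemma E1_one : E1 (1 : PowerSeries (PowerSeries F)) = 1 := by
  ext n
  rw [E1, PowerSeries.coeff_mk, Finset.sum_eq_single 0]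
  · simp
  · intro b _ hb; rw [PowerSeries.coeff_one, if_neg hb, map_zero]
  · intro h; simp at h

/-- evaluation `z = X^(q^k)`, `t = 1/X` -/
def ev (hq : 2 ≤ q) (k : ℕ) : goodSub F q →+* PowerSeries F :=
  RingHom.mk' { toFun := fun f => E1 (trk q k f.1)
                map_one' := by
                  show E1 (trk q k 1) = 1
                  rw [trk_one, E1_one]
                map_mul' := fun f g => by
                  show E1 (trk q k (f.1 * g.1)) = _
                  rw [trk_mul hq k _ _ f.2 g.2, E1_mul _ _ (trk_ok hq k _ f.2) (trk_ok hq k _ g.2)]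
                  rw [← trk_mul hq k _ _ f.2 g.2]
                  exact trk_ok hq k _ (f * g).2 }
    (fun f g => by
      show E1 (trk q k (f.1 + g.1)) = _
      rw [trk_add, E1_add]; rfl)

lemma coeff_ev (hq : 2 ≤ q) (k : ℕ) (f : goodSub F q) (n M : ℕ) (hM : 2 * n < M) :
    PowerSeries.coeff n (ev hq k f) = ∑ b ∈ Finset.range M, if n ≤ q ^ k * b then
      (PowerSeries.coeff b f.1).coeff (q ^ k * b - n) else 0 := by
  show PowerSeries.coeff n (E1 (trk q k f.1)) = _
  rw [E1, PowerSeries.coeff_mk]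
  have e : ∀ b, PowerSeries.coeff n (PowerSeries.coeff b (trk q k f.1)) = if n ≤ q ^ k * b then
      (PowerSeries.coeff b f.1).coeff (q ^ k * b - n) else 0 := by
    intro b
    rw [trk, PowerSeries.coeff_mk, Polynomial.coeff_coe, Polynomial.coeff_reflect]
    split_ifs with h
    · rw [Polynomial.revAt_le h]
    · rw [Polynomial.revAt_eq_self_of_lt (by omega)]
      apply Polynomial.coeff_eq_zero_of_natDegree_lt
      have := good_le hq f.2 k b
      omega
  rw [← Finset.sum_congr rfl fun b _ => e b]
  refine Finset.sum_subset (Finset.range_subset_range.2 (by omega)) fun b _ hb' => ?_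
  exact trk_ok hq k _ f.2 b n (by simp at hb'; omega)

lemma coeff_ev' (hq : 2 ≤ q) (k : ℕ) (hk : 1 ≤ k) (f : goodSub F q) (n : ℕ) :
    PowerSeries.coeff n (ev hq k f) = ∑ b ∈ Finset.range (n + 1), if n ≤ q ^ k * b then
      (PowerSeries.coeff b f.1).coeff (q ^ k * b - n) else 0 := by
  rw [coeff_ev hq k f n (2 * n + 1) (by omega)]
  symm
  refine Finset.sum_subset (Finset.range_subset_range.2 (by omega)) fun b _ hb' => ?_
  rw [if_pos]
  · apply Polynomial.coeff_eq_zero_of_natDegree_lt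
    have h1 : q * (PowerSeries.coeff b f.1).natDegree ≤ b := f.2 b
    have h3 : 2 ^ 1 ≤ q ^ k := (Nat.pow_le_pow_left hq 1).trans (Nat.pow_le_pow_right (by omega) hk)
    have hb : n + 1 ≤ b := by simpa using hb'
    have h4 : 2 * b ≤ q ^ k * b := Nat.mul_le_mul_right _ h3
    have : 2 * (PowerSeries.coeff b f.1).natDegree ≤ b := by nlinarith
    omega
  · have : b ≤ q ^ k * b := Nat.le_mul_of_pos_left _ (by positivity)
    simp at hb'; omega

lemma ev_dvd (hq : 2 ≤ q) (k : ℕ) (f : goodSub F q) (D : ℕ)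
    (h : (PowerSeries.X : PowerSeries (Polynomial F)) ^ (2 * D) ∣ f.1) :
    (PowerSeries.X : PowerSeries F) ^ D ∣ ev hq k f := by
  rw [PowerSeries.X_pow_dvd_iff] at h ⊢
  intro n hn
  rw [coeff_ev hq k f n (2 * n + 1) (by omega)]
  refine Finset.sum_eq_zero fun b hb => ?_
  rw [h b (by simp at hb; omega)]; simp

/-- `σ` on good series -/
def sg (hq : 2 ≤ q) (f : goodSub F q) : goodSub F q :=
  ⟨PowerSeries.expand q (by omega) f.1, fun b => by
    rw [PowerSeries.coeff_expand]
    split_ifs with h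
    · exact (f.2 _).trans (Nat.div_le_self b q)
    · simp⟩

lemma ev_sg (hq : 2 ≤ q) (k : ℕ) (f : goodSub F q) : ev hq k (sg hq f) = ev hq (k + 1) f := by
  ext n
  have hq0 : q ≠ 0 := by omega
  rw [coeff_ev hq k _ n (q * (2 * n + 1)) (by nlinarith), coeff_ev hq (k + 1) f n (2 * n + 1) (by omega)]
  symm
  refine Finset.sum_bij_ne_zero (fun b _ _ => q * b) ?_ ?_ ?_ ?_
  · intro b hb _
    simp only [Finset.mem_range] at hb ⊢
    exact Nat.mul_lt_mul_of_pos_left hb (by omega)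
  · intro b _ _ b' _ _ h
    exact Nat.eq_of_mul_eq_mul_left (by omega) h
  · intro b hb hne
    have hd : q ∣ b := by
      by_contra hc
      apply hne
      show (if _ then (PowerSeries.coeff b (PowerSeries.expand q _ f.1)).coeff _ else 0) = 0
      rw [PowerSeries.coeff_expand_of_not_dvd _ _ _ hc]; simp
    obtain ⟨c, rfl⟩ := hd
    refine ⟨c, ?_, ?_, rfl⟩
    · simp only [Finset.mem_range] at hb ⊢
      exact Nat.lt_of_mul_lt_mul_left hb
    · convert hne using 1
      show _ = (if _ then (PowerSeries.coeff (q * c) (PowerSeries.expand q _ f.1)).coeff _ else 0)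
      rw [PowerSeries.coeff_expand_mul, pow_succ, mul_assoc]
  · intro c hb hne
    show _ = (if _ then (PowerSeries.coeff (q * c) (PowerSeries.expand q _ f.1)).coeff _ else 0)
    rw [PowerSeries.coeff_expand_mul, pow_succ, mul_assoc]

lemma ev_poly (hq : 2 ≤ q) (P : Polynomial (Polynomial F))
    (hP : (P : PowerSeries (Polynomial F)) ∈ goodSub F q) :
    ∃ r : Polynomial F, ev hq 0 ⟨P, hP⟩ = (r : PowerSeries F) := by
  refine ⟨∑ b ∈ Finset.range (P.natDegree + 1), Polynomial.reflect b (P.coeff b), ?_⟩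
  ext n
  rw [coeff_ev hq 0 _ n (2 * n + 1 + (P.natDegree + 1)) (by omega), Polynomial.coeff_coe,
    Polynomial.finsetSum_coeff]
  symm
  refine Finset.sum_subset_zero_on_sdiff (Finset.range_subset_range.2 (by omega)) ?_ ?_
  · intro b hb
    have : P.natDegree < b := by simp at hb; omega
    simp [Polynomial.coeff_eq_zero_of_natDegree_lt this]
  · intro b hb
    rw [Polynomial.coeff_reflect]
    have h1 := good_le hq hP 0 b
    simp only [pow_zero, one_mul, Polynomial.coeff_coe] at h1 ⊢
    split_ifs with h
    · rw [Polynomial.revAt_le h]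
    · rw [Polynomial.revAt_eq_self_of_lt (by omega)]
      exact Polynomial.coeff_eq_zero_of_natDegree_lt (by omega)
end

section
def Urec {R α : Type*} [CommRing R] (X : List α → ℕ → R) : ℕ → ℕ → List α → R
  | _, _, [] => 1
  | 0, _, (_ :: _) => 0
  | D + 1, k, (c :: B) => X (c :: B) k * Urec X D (k + 1) (c :: B) + X B k * Urec X D (k + 1) B

lemma Urec_nil {R α : Type*} [CommRing R] (X : List α → ℕ → R) (D k : ℕ) : Urec X D k [] = 1 := by
  cases D <;> rfl

lemma map_Urec {R S α : Type*} [CommRing R] [CommRing S] (φ : R →+* S) (X : List α → ℕ → R)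
    (Y : List α → ℕ → S) (m : ℕ) (h : ∀ l k, φ (X l k) = Y l (k + m)) (D k : ℕ) (l : List α) :
    φ (Urec X D k l) = Urec Y D (k + m) l := by
  induction D generalizing k l with
  | zero => cases l <;> simp [Urec]
  | succ D ih =>
    cases l with
    | nil => simp [Urec]
    | cons c B =>
      rw [Urec, Urec, map_add, map_mul, map_mul, ih, ih, h, h, show k + 1 + m = k + m + 1 by omega]

section formal
variable {F α : Type*} [Field F] {q : ℕ}

def geo (F : Type*) [Field F] (n : ℕ) : PowerSeries (Polynomial F) :=
  PowerSeries.mk fun i => if n ∣ i then Polynomial.X ^ (i / n) else 0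

lemma geo_good (n : ℕ) (hn : q ≤ n) : geo F n ∈ goodSub F q := by
  intro b
  rw [geo, PowerSeries.coeff_mk]
  split_ifs with h
  · rw [Polynomial.natDegree_X_pow]
    exact (Nat.mul_le_mul_right _ hn).trans (Nat.mul_div_le b n)
  · simp

lemma geo_mul (n : ℕ) (hn : 0 < n) :
    geo F n * (1 - PowerSeries.C Polynomial.X * PowerSeries.X ^ n) = 1 := by
  ext1 b
  rw [mul_sub, mul_one, map_sub, mul_comm (PowerSeries.C _), ← mul_assoc, PowerSeries.coeff_mul_C,
    PowerSeries.coeff_mul_X_pow', PowerSeries.coeff_one]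
  simp only [geo, PowerSeries.coeff_mk]
  by_cases hb : b = 0
  · subst hb; simp [hn.ne']
  · rw [if_neg hb]
    by_cases hd : n ∣ b
    · obtain ⟨c, rfl⟩ := hd
      have hc : c ≠ 0 := by rintro rfl; simp at hb
      obtain ⟨c, rfl⟩ := Nat.exists_eq_succ_of_ne_zero hc
      rw [if_pos (Dvd.intro _ rfl), if_pos (Nat.le_mul_of_pos_right _ (by omega)),
        show n * c.succ - n = n * c by rw [Nat.mul_succ]; omega, if_pos (Dvd.intro _ rfl),
        Nat.mul_div_cancel_left _ hn, Nat.mul_div_cancel_left _ hn, pow_succ, sub_self]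
    · rw [if_neg hd]
      split_ifs with h1 h2
      · exact absurd ((Nat.dvd_sub_iff_left h1 dvd_rfl).1 h2) hd
      · simp
      · simp

lemma geo_unit (n : ℕ) (hn : 0 < n) : 1 - PowerSeries.C Polynomial.X * PowerSeries.X ^ n ≠
    (0 : PowerSeries (Polynomial F)) := by
  intro h
  have := geo_mul (F := F) n hn
  rw [h, mul_zero] at this
  exact zero_ne_one this

lemma expand_geo (hq : q ≠ 0) (n : ℕ) (hn : 0 < n) :
    PowerSeries.expand q hq (geo F n) = geo F (q * n) := by
  have h1 := congrArg (PowerSeries.expand q hq) (geo_mul (F := F) n hn)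
  have h2 := geo_mul (F := F) (q * n) (by positivity)
  rw [map_mul, map_sub, map_mul, map_one, map_pow, PowerSeries.expand_C, PowerSeries.expand_X,
    ← pow_mul] at h1
  exact mul_right_cancel₀ (geo_unit (q * n) (by positivity)) (h1.trans h2.symm)

def sgH (hq : 2 ≤ q) : goodSub F q →+* goodSub F q where
  toFun := sg hq
  map_one' := Subtype.ext (map_one (PowerSeries.expand q _))
  map_zero' := Subtype.ext (map_zero (PowerSeries.expand q _))
  map_mul' f g := Subtype.ext (map_mul (PowerSeries.expand q _) f.1 g.1)
  map_add' f g := Subtype.ext (map_add (PowerSeries.expand q _) f.1 g.1)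

lemma C_good (c : F) : PowerSeries.C (Polynomial.C c) ∈ goodSub F q := by
  intro b; rw [PowerSeries.coeff_C]; split_ifs <;> simp

lemma X_good : (PowerSeries.X : PowerSeries (Polynomial F)) ∈ goodSub F q := by
  intro b; rw [PowerSeries.coeff_X]; split_ifs <;> simp

def gC (q : ℕ) (c : F) : goodSub F q := ⟨_, C_good c⟩
def gX (F : Type*) [Field F] (q : ℕ) : goodSub F q := ⟨_, X_good⟩

lemma le_qpow (hq : 2 ≤ q) (k : ℕ) : q ≤ q ^ (k + 1) := by
  calc q = q ^ 1 := (pow_one q).symm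
    _ ≤ _ := Nat.pow_le_pow_right (by omega) (by omega)

def ggeo (F : Type*) [Field F] (hq : 2 ≤ q) (k : ℕ) : goodSub F q :=
  ⟨geo F (q ^ (k + 1)), geo_good _ (le_qpow hq k)⟩

def gv (F : Type*) [Field F] (hq : 2 ≤ q) (k : ℕ) : goodSub F q :=
  - (gX F q ^ (q ^ (k + 1)) * ggeo F hq k)

lemma sgH_C (hq : 2 ≤ q) (c : F) : sgH hq (gC q c) = gC q c :=
  Subtype.ext (PowerSeries.expand_C _ _ _)

lemma sgH_X (hq : 2 ≤ q) : sgH hq (gX F q) = gX F q ^ q :=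
  Subtype.ext (PowerSeries.expand_X _ _)

lemma sgH_geo (hq : 2 ≤ q) (k : ℕ) : sgH hq (ggeo F hq k) = ggeo F hq (k + 1) :=
  Subtype.ext (by
    show PowerSeries.expand q _ (geo F _) = geo F _
    rw [expand_geo _ _ (by positivity), ← pow_succ'])

lemma sgH_v (hq : 2 ≤ q) (k : ℕ) : sgH hq (gv F hq k) = gv F hq (k + 1) := by
  rw [gv, gv, map_neg, map_mul, map_pow, sgH_X, sgH_geo, ← pow_mul, ← pow_succ']

variable (s : α → ℕ) (e : α → F)

def wtl (l : List α) : ℕ := (l.map s).sum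
def chl (l : List α) : F := (l.map e).prod

def gXl (hq : 2 ≤ q) (l : List α) (k : ℕ) : goodSub F q := gC q (chl e l) * gv F hq k ^ wtl s l

lemma sgH_Xl (hq : 2 ≤ q) (l : List α) (k : ℕ) : sgH hq (gXl s e hq l k) = gXl s e hq l (k + 1) := by
  rw [gXl, gXl, map_mul, map_pow, sgH_C, sgH_v]

lemma X_dvd_gXl (hs : ∀ c, 0 < s c) (hq : 2 ≤ q) (c : α) (B : List α) (k : ℕ) :
    (PowerSeries.X : PowerSeries (Polynomial F)) ∣ (gXl s e hq (c :: B) k).1 := by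
  show _ ∣ (gC q _).1 * (gv F hq k).1 ^ _
  have h1 : (PowerSeries.X : PowerSeries (Polynomial F)) ∣ (gv F hq k).1 := by
    show _ ∣ -(PowerSeries.X ^ (q ^ (k + 1)) * _)
    rw [dvd_neg]
    exact Dvd.dvd.mul_right (dvd_pow_self _ (by positivity)) _
  refine Dvd.dvd.mul_left (h1.trans (dvd_pow_self _ ?_)) _
  have := hs c
  simp [wtl]; omega

lemma U_cauchy (hs : ∀ c, 0 < s c) (hq : 2 ≤ q) (D k : ℕ) (l : List α) :
    (PowerSeries.X : PowerSeries (Polynomial F)) ^ D ∣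
      (Urec (gXl s e hq) (D + 1) k l).1 - (Urec (gXl s e hq) D k l).1 := by
  induction D generalizing k l with
  | zero => simp
  | succ D ih =>
    cases l with
    | nil => simp [Urec]
    | cons c B =>
      rw [Urec, Urec]
      show _ ∣ (gXl s e hq (c :: B) k).1 * (Urec (gXl s e hq) (D + 1) (k + 1) (c :: B)).1 +
        (gXl s e hq B k).1 * (Urec (gXl s e hq) (D + 1) (k + 1) B).1 -
        ((gXl s e hq (c :: B) k).1 * (Urec (gXl s e hq) D (k + 1) (c :: B)).1 +
        (gXl s e hq B k).1 * (Urec (gXl s e hq) D (k + 1) B).1)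
      rw [add_sub_add_comm, ← mul_sub, ← mul_sub, pow_succ']
      refine dvd_add (mul_dvd_mul (X_dvd_gXl s e hs hq c B k) (ih _ _)) ?_
      cases B with
      | nil => simp [Urec_nil]
      | cons c' B => exact mul_dvd_mul (X_dvd_gXl s e hs hq c' B k) (ih _ _)

def fl (hq : 2 ≤ q) (l : List α) : goodSub F q :=
  ⟨plim fun D => (Urec (gXl s e hq) D 0 l).1, fun b => by
    rw [plim, PowerSeries.coeff_mk]; exact (Urec (gXl s e hq) (b + 1) 0 l).2 b⟩

lemma fl_spec (hs : ∀ c, 0 < s c) (hq : 2 ≤ q) (D : ℕ) (l : List α) :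
    (PowerSeries.X : PowerSeries (Polynomial F)) ^ D ∣
      (fl s e hq l - Urec (gXl s e hq) D 0 l).1 :=
  plim_spec _ (fun D => U_cauchy s e hs hq D 0 l) D

lemma fl_nil (hs : ∀ c, 0 < s c) (hq : 2 ≤ q) : fl s e hq ([] : List α) = 1 := by
  apply Subtype.ext
  apply ps_eq_of_forall_dvd
  intro D
  have := fl_spec s e hs hq D []
  rwa [Urec_nil] at this

lemma sgH_dvd (hq : 2 ≤ q) (f : goodSub F q) (D : ℕ)
    (h : (PowerSeries.X : PowerSeries (Polynomial F)) ^ D ∣ f.1) :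
    (PowerSeries.X : PowerSeries (Polynomial F)) ^ D ∣ (sgH hq f).1 := by
  have := map_dvd (PowerSeries.expand q (by omega : q ≠ 0)) h
  rw [map_pow, PowerSeries.expand_X, ← pow_mul] at this
  exact (pow_dvd_pow _ (Nat.le_mul_of_pos_left _ (by omega))).trans this

lemma fl_cons (hs : ∀ c, 0 < s c) (hq : 2 ≤ q) (c : α) (B : List α) :
    fl s e hq (c :: B) = gXl s e hq (c :: B) 0 * sgH hq (fl s e hq (c :: B)) +
      gXl s e hq B 0 * sgH hq (fl s e hq B) := by
  apply Subtype.ext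
  apply ps_eq_of_forall_dvd
  intro D
  have h1 := (pow_dvd_pow PowerSeries.X (Nat.le_succ D)).trans (fl_spec s e hs hq (D + 1) (c :: B))
  have h2 : ∀ l, (PowerSeries.X : PowerSeries (Polynomial F)) ^ D ∣
      (sgH hq (fl s e hq l) - Urec (gXl s e hq) D 1 l).1 := by
    intro l
    have := sgH_dvd hq _ D (fl_spec s e hs hq D l)
    rwa [map_sub, map_Urec (sgH hq) (gXl s e hq) (gXl s e hq) 1 (sgH_Xl s e hq)] at this
  rw [Urec] at h1
  have h3 := (h2 (c :: B)).mul_left (gXl s e hq (c :: B) 0).1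
  have h4 := (h2 B).mul_left (gXl s e hq B 0).1
  have := dvd_sub (dvd_sub h1 h3) h4
  convert this using 1
  simp only [AddSubgroupClass.coe_sub, Subring.coe_add, Subring.coe_mul, zero_add]
  ring

def gP (F : Type*) [Field F] (hq : 2 ≤ q) (D : ℕ) : goodSub F q := ∏ i ∈ Finset.range D, ggeo F hq i

lemma geo_sub_one (n : ℕ) (hn : 0 < n) : (PowerSeries.X : PowerSeries (Polynomial F)) ^ n ∣ geo F n - 1 := by
  refine ⟨geo F n * PowerSeries.C Polynomial.X, ?_⟩
  have := geo_mul (F := F) n hn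
  linear_combination this

lemma gP_cauchy (hq : 2 ≤ q) (D : ℕ) : (PowerSeries.X : PowerSeries (Polynomial F)) ^ D ∣
    (gP F hq (D + 1)).1 - (gP F hq D).1 := by
  have : (gP F hq (D + 1)).1 = (gP F hq D).1 * geo F (q ^ (D + 1)) := by
    rw [gP, Finset.prod_range_succ]; rfl
  rw [this, ← mul_sub_one]
  refine Dvd.dvd.mul_left ((pow_dvd_pow _ ?_).trans (geo_sub_one _ (by positivity))) _
  have := Nat.lt_pow_self (show 1 < q by omega) (n := D + 1)
  omega

def gG (F : Type*) [Field F] (hq : 2 ≤ q) : goodSub F q :=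
  ⟨plim fun D => (gP F hq D).1, fun b => by
    rw [plim, PowerSeries.coeff_mk]; exact (gP F hq (b + 1)).2 b⟩

lemma gG_spec (hq : 2 ≤ q) (D : ℕ) :
    (PowerSeries.X : PowerSeries (Polynomial F)) ^ D ∣ (gG F hq - gP F hq D).1 :=
  plim_spec _ (gP_cauchy hq) D

lemma gG_eq (hq : 2 ≤ q) : gG F hq = ggeo F hq 0 * sgH hq (gG F hq) := by
  apply Subtype.ext
  apply ps_eq_of_forall_dvd
  intro D
  have h1 := (pow_dvd_pow PowerSeries.X (Nat.le_succ D)).trans (gG_spec (F := F) hq (D + 1))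
  have h2 := (sgH_dvd hq _ D (gG_spec (F := F) hq D)).mul_left (ggeo F hq 0).1
  have e : gP F hq (D + 1) = ggeo F hq 0 * sgH hq (gP F hq D) := by
    rw [gP, gP, Finset.prod_range_succ', map_prod, mul_comm]
    simp only [sgH_geo]
  rw [e] at h1
  have := dvd_sub h1 h2
  convert this using 1
  simp only [AddSubgroupClass.coe_sub, Subring.coe_mul, map_sub]
  ring

def gd (F : Type*) [Field F] (hq : 2 ≤ q) : goodSub F q :=
  ⟨1 - PowerSeries.C Polynomial.X * PowerSeries.X ^ q, by
    refine sub_mem (one_mem _) fun b => ?_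
    rw [PowerSeries.coeff_C_mul_X_pow]
    split_ifs with h
    · simp [h]
    · simp⟩

lemma gd_mul (hq : 2 ≤ q) : gd F hq * ggeo F hq 0 = 1 := by
  apply Subtype.ext
  have := geo_mul (F := F) q (by omega)
  rw [mul_comm] at this
  simpa [gd, ggeo] using this

/-- the coefficients of the Frobenius equations -/
def gY (hq : 2 ≤ q) (w : ℕ) (l : List α) : goodSub F q :=
  gC q (chl e l) * (-gX F q ^ q) ^ wtl s l * gd F hq ^ (w - wtl s l)

lemma gd_Xl (hq : 2 ≤ q) (w : ℕ) (l : List α) (hl : wtl s l ≤ w) :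
    gd F hq ^ w * gXl s e hq l 0 = gY s e hq w l := by
  obtain ⟨m, rfl⟩ := Nat.exists_eq_add_of_le hl
  rw [gXl, gY, gv, pow_add, Nat.add_sub_cancel_left]
  have : gd F hq ^ wtl s l * (-(gX F q ^ q ^ (0 + 1) * ggeo F hq 0)) ^ wtl s l
      = (-gX F q ^ q) ^ wtl s l := by
    rw [← mul_pow]
    congr 1
    rw [zero_add, pow_one]
    linear_combination (-gX F q ^ q) * gd_mul (F := F) hq
  rw [← this]; ring

/-- all functions: `none` is `G^w` -/
def fam (hq : 2 ≤ q) (w : ℕ) : Option (List α) → goodSub F q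
  | none => gG F hq ^ w
  | some l => fl s e hq l

lemma fam_none (hq : 2 ≤ q) (w : ℕ) :
    gd F hq ^ w * fam s e hq w none = sgH hq (fam s e hq w none) := by
  show gd F hq ^ w * gG F hq ^ w = sgH hq (gG F hq ^ w)
  nth_rw 1 [gG_eq]
  rw [← mul_pow, ← mul_assoc, gd_mul, one_mul, map_pow]

lemma fam_nil (hs : ∀ c, 0 < s c) (hq : 2 ≤ q) (w : ℕ) :
    gd F hq ^ w * fam s e hq w (some []) = gY s e hq w [] * sgH hq (fam s e hq w (some [])) := by
  show gd F hq ^ w * fl s e hq [] = _ * sgH hq (fl s e hq [])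
  rw [fl_nil s e hs, ← gd_Xl s e hq w [] (by simp [wtl])]
  simp only [gXl, chl, wtl, List.map_nil, List.prod_nil, List.sum_nil, pow_zero, map_one, mul_one]
  rw [show gC q (1 : F) = 1 from Subtype.ext (by simp [gC]), mul_one]

lemma fam_cons (hs : ∀ c, 0 < s c) (hq : 2 ≤ q) (w : ℕ) (c : α) (B : List α) (hl : wtl s (c :: B) ≤ w) :
    gd F hq ^ w * fam s e hq w (some (c :: B)) =
      gY s e hq w (c :: B) * sgH hq (fam s e hq w (some (c :: B)))
      + gY s e hq w B * sgH hq (fam s e hq w (some B)) := by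
  show gd F hq ^ w * fl s e hq (c :: B) = _ * sgH hq (fl s e hq (c :: B)) + _ * sgH hq (fl s e hq B)
  rw [← gd_Xl s e hq w _ hl, ← gd_Xl s e hq w B (by simp [wtl] at hl ⊢; omega)]
  nth_rw 1 [fl_cons s e hs]
  ring
end formal
end

section
lemma transfer {R α : Type*} [CommRing R] [Fintype α] (S : Finset (List α))
    (hS : ∀ c l, c :: l ∈ S → l ∈ S) (δ : R) (Y g g' : List α → R)
    (hnil : [] ∈ S → δ * g [] = Y [] * g' [])
    (hcons : ∀ c l, c :: l ∈ S → δ * g (c :: l) = Y (c :: l) * g' (c :: l) + Y l * g' l)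
    (a : List α → R) (ha : ∀ l, l ∉ S → a l = 0) :
    δ * ∑ l ∈ S, a l * g l = ∑ l ∈ S, (Y l * (a l + ∑ c, a (c :: l))) * g' l := by
  set tt : List α → R := fun l => match l with
    | [] => 0
    | _ :: l => Y l * g' l with htt
  have h1 : ∀ l ∈ S, δ * (a l * g l) = a l * (Y l * g' l) + a l * tt l := by
    intro l hl
    rw [mul_left_comm, ← mul_add]
    congr 1
    cases l with
    | nil => rw [hnil hl]; simp [tt]
    | cons c l => rw [hcons c l hl]
  rw [Finset.mul_sum, Finset.sum_congr rfl h1, Finset.sum_add_distrib]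
  have h2 : ∑ l ∈ S, a l * tt l = ∑ x ∈ S ×ˢ (Finset.univ : Finset α), a (x.2 :: x.1) * (Y x.1 * g' x.1) := by
    symm
    refine Finset.sum_bij_ne_zero (fun x _ _ => x.2 :: x.1) ?_ ?_ ?_ ?_
    · intro x _ hx
      by_contra hc
      exact hx (by rw [ha _ hc, zero_mul])
    · intro x _ _ y _ _ h
      simp only [List.cons.injEq] at h
      exact Prod.ext h.2 h.1
    · intro l hl hne
      cases l with
      | nil => simp [tt] at hne
      | cons c l => exact ⟨(l, c), by simp [hS c l hl], hne, rfl⟩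
    · intro x _ _; rfl
  rw [h2, Finset.sum_product, ← Finset.sum_add_distrib]
  refine Finset.sum_congr rfl fun l _ => ?_
  simp only
  rw [← Finset.sum_mul]
  ring

def Tr {R α : Type*} [CommRing R] [Fintype α] (Y : List α → R) (a : Option (List α) → R) :
    Option (List α) → R
  | none => a none
  | some l => Y l * (a (some l) + ∑ c, a (some (c :: l)))

lemma transferO {R α : Type*} [CommRing R] [Fintype α] (S : Finset (List α))
    (hS : ∀ c l, c :: l ∈ S → l ∈ S) (δ : R) (Y : List α → R) (g g' : Option (List α) → R)
    (hnone : δ * g none = g' none)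
    (hnil : [] ∈ S → δ * g (some []) = Y [] * g' (some []))
    (hcons : ∀ c l, c :: l ∈ S → δ * g (some (c :: l)) = Y (c :: l) * g' (some (c :: l)) + Y l * g' (some l))
    (a : Option (List α) → R) (ha : ∀ l, l ∉ Finset.insertNone S → a l = 0) :
    δ * ∑ l ∈ Finset.insertNone S, a l * g l = ∑ l ∈ Finset.insertNone S, Tr Y a l * g' l := by
  rw [Finset.sum_insertNone, Finset.sum_insertNone, mul_add,
    transfer S hS δ Y (fun l => g (some l)) (fun l => g' (some l)) hnil hcons (fun l => a (some l))
      (fun l hl => ha _ (by simpa using hl)), mul_left_comm, hnone]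
  rfl

variable {α : Type*}

lemma wt_finite [Finite α] (s : α → ℕ) (hs : ∀ c, 0 < s c) (w : ℕ) : {l : List α | wtl s l ≤ w}.Finite := by
  refine (List.finite_length_le α w).subset fun l hl => ?_
  have : l.length ≤ wtl s l := by
    induction l with
    | nil => simp
    | cons c l ih =>
      have h1 := hs c
      simp only [wtl, List.map_cons, List.sum_cons, List.length_cons, Set.mem_setOf_eq] at *
      have := ih (by omega)
      omega
  exact this.trans hl

def TT [Finite α] (s : α → ℕ) (hs : ∀ c, 0 < s c) (w : ℕ) : Finset (List α) := (wt_finite s hs w).toFinset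

lemma mem_TT [Finite α] (s : α → ℕ) (hs : ∀ c, 0 < s c) (w : ℕ) (l : List α) :
    l ∈ TT s hs w ↔ wtl s l ≤ w := by simp [TT]

lemma wtl_cons (s : α → ℕ) (c : α) (l : List α) : wtl s (c :: l) = s c + wtl s l := by simp [wtl]

lemma TT_tail [Finite α] (s : α → ℕ) (hs : ∀ c, 0 < s c) (w : ℕ) (c : α) (l : List α)
    (h : c :: l ∈ TT s hs w) : l ∈ TT s hs w := by
  rw [mem_TT] at *; rw [wtl_cons] at h; omega

section
variable {F : Type*} [Field F] {q : ℕ}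

/-- if `Tr Y a` vanishes with `Y` nonzero then `a` vanishes -/
lemma Tr_ne {R : Type*} [CommRing R] [IsDomain R] [Fintype α] (s : α → ℕ) (hs : ∀ c, 0 < s c) (w : ℕ)
    (Y : List α → R) (hY : ∀ l, Y l ≠ 0) (a : Option (List α) → R)
    (ha : ∀ l, l ∉ Finset.insertNone (TT s hs w) → a l = 0)
    (h : ∀ l ∈ Finset.insertNone (TT s hs w), Tr Y a l = 0) : a = 0 := by
  have key : ∀ m, ∀ l, w < wtl s l + m → a (some l) = 0 := by
    intro m
    induction m with
    | zero =>
      intro l hl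
      exact ha _ (by rw [Finset.some_mem_insertNone, mem_TT]; omega)
    | succ m ih =>
      intro l hl
      by_cases hl' : wtl s l ≤ w
      · have h1 := h (some l) (by rw [Finset.some_mem_insertNone, mem_TT]; omega)
        have h2 : ∑ c, a (some (c :: l)) = 0 :=
          Finset.sum_eq_zero fun c _ => ih _ (by rw [wtl_cons]; have := hs c; omega)
        rw [Tr, h2, add_zero] at h1
        exact (mul_eq_zero.1 h1).resolve_left (hY l)
      · exact ha _ (by rw [Finset.some_mem_insertNone, mem_TT]; omega)
  funext l
  cases l with
  | none => exact h none (by simp)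
  | some l => exact key (w + 1) l (by omega)

end
end

section
section levels
variable {F α : Type*} [Field F] {q : ℕ}

lemma ev_mono (hq : 2 ≤ q) (k : ℕ) (f : goodSub F q) (p : Polynomial F) (b : ℕ)
    (h : f.1 = PowerSeries.C p * PowerSeries.X ^ b) :
    ev hq k f = (Polynomial.reflect (q ^ k * b) p : PowerSeries F) := by
  ext n
  rw [coeff_ev hq k f n (2 * n + 1 + (b + 1)) (by omega), Finset.sum_eq_single b]
  · have hb := good_le hq f.2 k b
    rw [h] at hb ⊢
    rw [PowerSeries.coeff_C_mul_X_pow, if_pos rfl] at *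
    rw [Polynomial.coeff_coe, Polynomial.coeff_reflect]
    split_ifs with h
    · rw [Polynomial.revAt_le h]
    · rw [Polynomial.revAt_eq_self_of_lt (by omega), Polynomial.coeff_eq_zero_of_natDegree_lt (by omega)]
  · intro b' _ hb'
    rw [h, PowerSeries.coeff_C_mul_X_pow, if_neg hb']; simp
  · intro hb; simp at hb; omega

lemma ev_C (hq : 2 ≤ q) (k : ℕ) (c : F) : ev hq k (gC q c) = PowerSeries.C c := by
  rw [ev_mono hq k (gC q c) (Polynomial.C c) 0 (by simp [gC])]
  simp [Polynomial.reflect_C]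

lemma ev_X (hq : 2 ≤ q) (k : ℕ) : ev hq k (gX F q) = PowerSeries.X ^ q ^ k := by
  rw [ev_mono hq k (gX F q) 1 1 (by simp [gX])]
  rw [Polynomial.reflect_one]; simp

lemma ev_d (hq : 2 ≤ q) (k : ℕ) : ev hq k (gd F hq) = 1 - PowerSeries.X ^ (q ^ (k + 1) - 1) := by
  have h1 : gd F hq = 1 - (1 - gd F hq) := by ring
  rw [h1, map_sub, map_one, ev_mono hq k (1 - gd F hq) Polynomial.X q (by simp [gd])]
  rw [← pow_succ]
  have := Polynomial.reflect_monomial (R := F) (q ^ (k + 1)) 1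
  rw [pow_one] at this
  rw [this, Polynomial.revAt_le (Nat.one_le_pow _ _ (by omega))]
  simp

variable (s : α → ℕ) (e : α → F)

def yp (q w k : ℕ) (l : List α) : Polynomial F :=
  Polynomial.C (chl e l) * (-Polynomial.X ^ q ^ (k + 1)) ^ wtl s l *
    (1 - Polynomial.X ^ (q ^ (k + 1) - 1)) ^ (w - wtl s l)

lemma ev_Y (hq : 2 ≤ q) (w k : ℕ) (l : List α) :
    ev hq k (gY s e hq w l) = (yp s e q w k l : PowerSeries F) := by
  rw [gY, map_mul, map_mul, map_pow, map_pow, map_neg, map_pow, ev_C, ev_X, ev_d, yp,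
    ← Polynomial.coeToPowerSeries.ringHom_apply]
  simp only [map_mul, map_pow, map_sub, map_one, map_neg, Polynomial.coeToPowerSeries.ringHom_apply,
    Polynomial.coe_C, Polynomial.coe_X]
  rw [← pow_mul PowerSeries.X, ← pow_succ]

lemma chl_ne (he : ∀ c, e c ≠ 0) (l : List α) : chl e l ≠ 0 := by
  rw [chl]
  apply List.prod_ne_zero
  simp only [List.mem_map, not_exists, not_and]
  exact fun c _ => he c

lemma yp_ne (he : ∀ c, e c ≠ 0) (hq : 2 ≤ q) (w k : ℕ) (l : List α) : yp s e q w k l ≠ 0 := by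
  have h0 : q ^ (k + 1) - 1 ≠ 0 := by have := le_qpow hq k; omega
  refine mul_ne_zero (mul_ne_zero (Polynomial.C_ne_zero.2 (chl_ne e he l)) (pow_ne_zero _
    (neg_ne_zero.2 (pow_ne_zero _ Polynomial.X_ne_zero)))) (pow_ne_zero _ ?_)
  intro h
  have := congrArg (Polynomial.eval 0) h
  simp [h0] at this

lemma yp_deg (hq : 2 ≤ q) (w k : ℕ) (l : List α) (hl : wtl s l ≤ w) :
    (yp s e q w k l).natDegree ≤ q ^ (k + 1) * w := by
  refine Polynomial.natDegree_mul_le.trans ?_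
  have h1 : (Polynomial.C (chl e l) * (-Polynomial.X ^ q ^ (k + 1)) ^ wtl s l).natDegree ≤
      wtl s l * q ^ (k + 1) := by
    refine (Polynomial.natDegree_C_mul_le _ _).trans (Polynomial.natDegree_pow_le.trans ?_)
    rw [Polynomial.natDegree_neg, Polynomial.natDegree_X_pow]
  have h2 : ((1 - Polynomial.X ^ (q ^ (k + 1) - 1) : Polynomial F) ^ (w - wtl s l)).natDegree ≤
      (w - wtl s l) * q ^ (k + 1) := by
    refine Polynomial.natDegree_pow_le.trans (Nat.mul_le_mul_left _ ?_)
    refine (Polynomial.natDegree_sub_le _ _).trans ?_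
    simp
  refine (Nat.add_le_add h1 h2).trans ?_
  rw [← Nat.add_mul, Nat.add_sub_cancel' hl, mul_comm]

lemma map_Tr {R S : Type*} [CommRing R] [CommRing S] [Fintype α] (φ : R →+* S) (Y : List α → R)
    (a : Option (List α) → R) (i : Option (List α)) :
    φ (Tr Y a i) = Tr (fun l => φ (Y l)) (fun i => φ (a i)) i := by
  cases i <;> simp [Tr]

lemma level_relations [Fintype α] (hs : ∀ c, 0 < s c) (he : ∀ c, e c ≠ 0) (hq : 2 ≤ q) (w : ℕ)
    (d0 : Option (List α) → Polynomial F)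
    (hd0 : ∀ i, i ∉ Finset.insertNone (TT s hs w) → d0 i = 0) (hne : d0 ≠ 0)
    (hrel : ∑ i ∈ Finset.insertNone (TT s hs w), (d0 i : PowerSeries F) * ev hq 0 (fam s e hq w i) = 0) :
    ∃ C : ℕ, ∀ k, ∃ d : Option (List α) → Polynomial F,
      (∀ i, i ∉ Finset.insertNone (TT s hs w) → d i = 0) ∧ d ≠ 0 ∧
      (∀ i, (d i).natDegree ≤ C * q ^ k) ∧ (d0 none = 0 → d none = 0) ∧
      ∑ i ∈ Finset.insertNone (TT s hs w), (d i : PowerSeries F) * ev hq k (fam s e hq w i) = 0 := by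
  set C := (Finset.insertNone (TT s hs w)).sup (fun i => (d0 i).natDegree) + q * w with hC
  refine ⟨C, fun k => ?_⟩
  induction k with
  | zero =>
    refine ⟨d0, hd0, hne, fun i => ?_, id, hrel⟩
    by_cases hi : i ∈ Finset.insertNone (TT s hs w)
    · have := Finset.le_sup (f := fun i => (d0 i).natDegree) hi
      rw [pow_zero, mul_one]; omega
    · rw [hd0 i hi]; simp
  | succ k ih =>
    obtain ⟨d, h1, h2, h3, h4, h5⟩ := ih
    have hz : ∀ i, i ∉ Finset.insertNone (TT s hs w) → Tr (yp s e q w k) d i = 0 := by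
      intro i hi
      cases i with
      | none => simp at hi
      | some l =>
        rw [Tr, h1 _ hi, Finset.sum_eq_zero, add_zero, mul_zero]
        intro c _
        refine h1 _ fun hc => hi ?_
        rw [Finset.some_mem_insertNone] at *
        exact TT_tail s hs w c l hc
    refine ⟨Tr (yp s e q w k) d, hz, ?_, ?_, ?_, ?_⟩
    · intro h0
      apply h2
      exact Tr_ne s hs w (yp s e q w k) (yp_ne s e he hq w k) d h1 (fun l _ => congrFun h0 l)
    · intro i
      have hqq : C * q ^ k + q ^ (k + 1) * w ≤ C * q ^ (k + 1) := by
        have : q * w ≤ C := by omega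
        rw [pow_succ]
        nlinarith [Nat.zero_le (q ^ k), Nat.mul_le_mul_right (q ^ k) this, Nat.mul_le_mul_left (C * q ^ k) hq]
      by_cases hi : i ∈ Finset.insertNone (TT s hs w)
      · cases i with
        | none => exact (h3 none).trans (by omega)
        | some l =>
          refine Polynomial.natDegree_mul_le.trans ?_
          have e1 := yp_deg s e hq w k l (by rwa [Finset.some_mem_insertNone, mem_TT] at hi)
          have e2 : (d (some l) + ∑ c, d (some (c :: l))).natDegree ≤ C * q ^ k := by
            refine Polynomial.natDegree_add_le_of_degree_le (h3 _) ?_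
            exact Polynomial.natDegree_sum_le_of_forall_le _ _ fun c _ => h3 _
          omega
      · rw [hz i hi]; simp
    · exact h4
    · have := transferO (TT s hs w) (TT_tail s hs w) (ev hq k (gd F hq ^ w))
        (fun l => ev hq k (gY s e hq w l)) (fun i => ev hq k (fam s e hq w i))
        (fun i => ev hq (k + 1) (fam s e hq w i))
        (by rw [← map_mul, fam_none, ← ev_sg]; rfl)
        (fun _ => by rw [← map_mul, fam_nil s e hs, map_mul, ← ev_sg]; rfl)
        (fun c l hl => by
          rw [← map_mul, fam_cons s e hs hq w c l ((mem_TT s hs w _).1 hl), map_add, map_mul, map_mul,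
            ← ev_sg, ← ev_sg]; rfl)
        (fun i => (d i : PowerSeries F)) (fun i hi => by rw [h1 i hi]; simp)
      rw [h5, mul_zero] at this
      rw [this]
      refine Finset.sum_congr rfl fun i _ => ?_
      congr 1
      rw [← Polynomial.coeToPowerSeries.ringHom_apply, map_Tr]
      simp only [Polynomial.coeToPowerSeries.ringHom_apply, ev_Y]
end levels
end

section
section frob
variable {F α : Type*} [Field F] {q : ℕ}

def gPhi (q : ℕ) (φ : F →+* F) : goodSub F q →+* goodSub F q :=
  ((PowerSeries.map (Polynomial.mapRingHom φ)).comp (goodSub F q).subtype).codRestrict (goodSub F q)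
    (fun f b => by
      show q * (PowerSeries.coeff b (PowerSeries.map (Polynomial.mapRingHom φ) f.1)).natDegree ≤ b
      rw [PowerSeries.coeff_map]
      exact (Nat.mul_le_mul_left _ (Polynomial.natDegree_map_le)).trans (f.2 b))

lemma gPhi_val (φ : F →+* F) (f : goodSub F q) :
    (gPhi q φ f).1 = PowerSeries.map (Polynomial.mapRingHom φ) f.1 := rfl

lemma coeff_ggeo (hq : 2 ≤ q) (k b : ℕ) : PowerSeries.coeff b (ggeo F hq k).1 =
    if q ^ (k + 1) ∣ b then Polynomial.X ^ (b / q ^ (k + 1)) else 0 := by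
  simp only [ggeo, geo, gG, fl, plim, PowerSeries.coeff_mk]

lemma coeff_gG (hq : 2 ≤ q) (b : ℕ) : PowerSeries.coeff b (gG F hq).1 =
    PowerSeries.coeff b (gP F hq (b + 1)).1 := by
  simp only [ggeo, geo, gG, fl, plim, PowerSeries.coeff_mk]

lemma coeff_fl (s : α → ℕ) (e : α → F) (hq : 2 ≤ q) (l : List α) (b : ℕ) :
    PowerSeries.coeff b (fl s e hq l).1 =
    PowerSeries.coeff b (Urec (gXl s e hq) (b + 1) 0 l).1 := by
  simp only [ggeo, geo, gG, fl, plim, PowerSeries.coeff_mk]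

lemma gPhi_geo (φ : F →+* F) (hq : 2 ≤ q) (k : ℕ) : gPhi q φ (ggeo F hq k) = ggeo F hq k := by
  apply Subtype.ext; rw [gPhi_val]
  ext1 b
  rw [PowerSeries.coeff_map, coeff_ggeo]
  split_ifs <;> simp

lemma gPhi_Xl (φ : F →+* F) (s : α → ℕ) (e : α → F) (he : ∀ c, φ (e c) = e c) (hq : 2 ≤ q)
    (l : List α) (k : ℕ) : gPhi q φ (gXl s e hq l k) = gXl s e hq l k := by
  have h1 : gPhi q φ (gC q (chl e l)) = gC q (chl e l) := by
    apply Subtype.ext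
    rw [gPhi_val]
    have : φ (chl e l) = chl e l := by
      rw [chl, map_list_prod, List.map_map]
      congr 1
      exact List.map_congr_left fun c _ => he c
    simp [gC, this]
  have h2 : gPhi q φ (gX F q) = gX F q := by
    apply Subtype.ext; rw [gPhi_val]; simp [gX]
  rw [gXl, gv, map_mul, map_pow, map_neg, map_mul, map_pow, h1, h2, gPhi_geo]

lemma gPhi_fam (φ : F →+* F) (s : α → ℕ) (e : α → F) (he : ∀ c, φ (e c) = e c) (hq : 2 ≤ q)
    (w : ℕ) (i : Option (List α)) : gPhi q φ (fam s e hq w i) = fam s e hq w i := by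
  cases i with
  | none =>
    have : gPhi q φ (gG F hq) = gG F hq := by
      apply Subtype.ext; rw [gPhi_val]
      ext1 b
      rw [PowerSeries.coeff_map, coeff_gG]
      have : gPhi q φ (gP F hq (b + 1)) = gP F hq (b + 1) := by
        rw [gP, map_prod]
        simp only [gPhi_geo]
      have := congrArg (fun f => PowerSeries.coeff b f.1) this
      simp only [gPhi_val, PowerSeries.coeff_map] at this
      exact this
    show gPhi q φ (gG F hq ^ w) = gG F hq ^ w
    rw [map_pow, this]
  | some l =>
    show gPhi q φ (fl s e hq l) = fl s e hq l
    apply Subtype.ext; rw [gPhi_val]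
    ext1 b
    rw [PowerSeries.coeff_map, coeff_fl]
    have := map_Urec (gPhi q φ) (gXl s e hq) (gXl s e hq) 0 (gPhi_Xl φ s e he hq) (b + 1) 0 l
    have := congrArg (fun f => PowerSeries.coeff b f.1) this
    simp only [gPhi_val, PowerSeries.coeff_map] at this
    exact this

lemma ev_gPhi (φ : F →+* F) (hq : 2 ≤ q) (k : ℕ) (f : goodSub F q) :
    ev hq k (gPhi q φ f) = PowerSeries.map φ (ev hq k f) := by
  ext n
  rw [PowerSeries.coeff_map, coeff_ev hq k _ n (2 * n + 1) (by omega),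
    coeff_ev hq k _ n (2 * n + 1) (by omega), map_sum]
  refine Finset.sum_congr rfl fun b _ => ?_
  rw [gPhi_val, PowerSeries.coeff_map]
  split_ifs <;> simp

lemma ev_frob (p : ℕ) [Fact p.Prime] [CharP F p] (m : ℕ) (s : α → ℕ) (e : α → F) (hq : 2 ≤ q)
    (he : ∀ c, e c ^ p ^ m = e c) (w k : ℕ) (i : Option (List α)) (h : p ^ m ≠ 0) :
    ev hq k (fam s e hq w i) ^ p ^ m = PowerSeries.expand (p ^ m) h (ev hq k (fam s e hq w i)) := by
  have : ExpChar F p := ExpChar.prime (Fact.out)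
  have h1 := ev_gPhi (iterateFrobenius F p m) hq k (fam s e hq w i)
  rw [gPhi_fam _ s e (fun c => by rw [iterateFrobenius_def, he]) hq] at h1
  have hp : p ≠ 0 := (Fact.out : p.Prime).ne_zero
  have h2 : PowerSeries.map (iterateFrobenius F p m) (PowerSeries.expand (p ^ m) h
      (ev hq k (fam s e hq w i))) = ev hq k (fam s e hq w i) ^ p ^ m :=
    MvPowerSeries.map_iterateFrobenius_expand p hp (ev hq k (fam s e hq w i)) m
  rw [← h2, PowerSeries.map_expand, ← h1]

lemma func_relation [Fintype α] (p : ℕ) [Fact p.Prime] [CharP F p] (m : ℕ) (hqm : q = p ^ m)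
    (s : α → ℕ) (hs : ∀ c, 0 < s c) (e : α → F) (he0 : ∀ c, e c ≠ 0) (hq : 2 ≤ q)
    (R : ℕ) (hR : 0 < R) (he : ∀ c, e c ^ q ^ R = e c) (w : ℕ)
    (d0 : Option (List α) → Polynomial F)
    (hd0 : ∀ i, i ∉ Finset.insertNone (TT s hs w) → d0 i = 0) (hne : d0 ≠ 0)
    (hrel : ∑ i ∈ Finset.insertNone (TT s hs w), (d0 i : PowerSeries F) * ev hq 0 (fam s e hq w i) = 0) :
    ∃ P : Option (List α) → Polynomial (Polynomial F), P ≠ 0 ∧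
      (∀ i, i ∉ Finset.insertNone (TT s hs w) → P i = 0) ∧ (d0 none = 0 → P none = 0) ∧
      ∑ i ∈ Finset.insertNone (TT s hs w),
        (P i : PowerSeries (Polynomial F)) * (fam s e hq w i).1 = 0 := by
  obtain ⟨C, hC⟩ := level_relations s e hs he0 hq w d0 hd0 hne hrel
  set S := (Finset.insertNone (TT s hs w)).filter (fun i => d0 none = 0 → i ≠ none) with hS
  have hSsub : S ⊆ Finset.insertNone (TT s hs w) := Finset.filter_subset _ _
  have hS0 : some [] ∈ S := by
    rw [hS, Finset.mem_filter, Finset.some_mem_insertNone, mem_TT]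
    simp [wtl]
  have : Nonempty S := ⟨⟨_, hS0⟩⟩
  have heR : ∀ j c, e c ^ q ^ (R * j) = e c := by
    intro j c
    induction j with
    | zero => simp
    | succ j ih => rw [Nat.mul_succ, pow_add, pow_mul, ih, he]
  obtain ⟨P, hP, hPr⟩ := lifting (ι := S) p q m hqm hq (fun i => (fam s e hq w i.1).1)
    (fun i b => by simpa using good_le hq (fam s e hq w i.1).2 0 b)
    (fun k i => ev hq k (fam s e hq w i.1))
    (fun k hk i n => coeff_ev' hq k hk _ n) R hR
    (fun k j i h => by
      have e1 : q ^ (R * j) = p ^ (m * (R * j)) := by rw [hqm, ← pow_mul]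
      have := ev_frob p (m * (R * j)) s e hq (fun c => by rw [← e1, heR]) w k i.1 (by rw [← e1]; exact h)
      simpa only [← e1] using this) C
    (fun k => by
      obtain ⟨d, h1, h2, h3, h4, h5⟩ := hC k
      have hz : ∀ i, i ∉ S → d i = 0 := by
        intro i hi
        rw [hS, Finset.mem_filter, not_and_or] at hi
        rcases hi with hi | hi
        · exact h1 i hi
        · push Not at hi
          rw [hi.2]; exact h4 hi.1
      refine ⟨fun i => d i.1, ?_, fun i => h3 i.1, ?_⟩
      · intro h0
        apply h2
        funext i
        by_cases hi : i ∈ S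
        · exact congrFun h0 ⟨i, hi⟩
        · exact hz i hi
      · rw [Finset.sum_coe_sort S (fun i => (d i : PowerSeries F) * ev hq k (fam s e hq w i)), ← h5]
        refine Finset.sum_subset hSsub fun i _ hi => ?_
        rw [hz i hi]; simp)
  have hval : ∀ i (hi : i ∈ S), (if h : i ∈ S then P ⟨i, h⟩ else 0) = P ⟨i, hi⟩ := fun i hi => dif_pos hi
  refine ⟨fun i => if h : i ∈ S then P ⟨i, h⟩ else 0, ?_, ?_, ?_, ?_⟩
  · intro h0
    apply hP
    funext i
    have := congrFun h0 i.1
    simp only [dif_pos i.2] at this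
    exact this
  · intro i hi
    exact dif_neg fun h => hi (hSsub h)
  · intro h
    refine dif_neg fun h' => ?_
    rw [hS, Finset.mem_filter] at h'
    exact h'.2 h rfl
  · rw [← hPr, ← Finset.sum_subset hSsub, ← Finset.sum_coe_sort S]
    · exact Finset.sum_congr rfl fun i _ => by simp only [dif_pos i.2]
    · intro i _ hi
      simp only [dif_neg hi]; simp
end frob
end

section
section indep
variable {F : Type*} [Field F]

abbrev red0 (F : Type*) [Field F] : Polynomial F →+* F := Polynomial.evalRingHom 0

lemma tdiv {ι : Type*} (a : ι → Polynomial (Polynomial F)) (ha : ∃ i, a i ≠ 0) :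
    ∃ (b : ι → Polynomial (Polynomial F)) (n : ℕ),
      (∀ i, a i = Polynomial.C (Polynomial.X ^ n) * b i) ∧ ∃ i, (b i).map (red0 F) ≠ 0 := by
  obtain ⟨i0, hi0⟩ := ha
  obtain ⟨j0, hj0⟩ : ∃ j, (a i0).coeff j ≠ 0 := by
    by_contra hc
    push Not at hc
    exact hi0 (Polynomial.ext (by simpa using hc))
  obtain ⟨m, hm⟩ : ∃ m, ((a i0).coeff j0).natDegree ≤ m := ⟨_, le_rfl⟩
  clear hi0
  induction m generalizing a with
  | zero =>
    refine ⟨a, 0, by simp, i0, fun h => ?_⟩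
    have := congrArg (fun P => Polynomial.coeff P j0) h
    simp only [Polynomial.coeff_map, Polynomial.coeff_zero] at this
    rw [Polynomial.eq_C_of_natDegree_le_zero hm] at this hj0
    simp at this
    exact hj0 (by rw [this, map_zero])
  | succ m ih =>
    by_cases h : ∃ i, (a i).map (red0 F) ≠ 0
    · exact ⟨a, 0, by simp, h⟩
    · push Not at h
      have h1 : ∀ i, ∃ b, a i = Polynomial.C Polynomial.X * b := by
        intro i
        have : Polynomial.C Polynomial.X ∣ a i := by
          rw [Polynomial.C_dvd_iff_dvd_coeff]
          intro j
          rw [Polynomial.X_dvd_iff]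
          have := congrArg (fun P => Polynomial.coeff P j) (h i)
          simpa [Polynomial.coeff_zero_eq_eval_zero] using this
        exact this
      choose b hb using h1
      have hc : (a i0).coeff j0 = Polynomial.X * (b i0).coeff j0 := by rw [hb, Polynomial.coeff_C_mul]
      have hne : (b i0).coeff j0 ≠ 0 := by
        intro h0; rw [h0, mul_zero] at hc; exact hj0 hc
      obtain ⟨b', n, h2, h3⟩ := ih b hne (by
        rw [hc, Polynomial.natDegree_X_mul hne] at hm; omega)
      refine ⟨b', n + 1, fun i => ?_, h3⟩
      rw [hb, h2, ← mul_assoc, ← Polynomial.C_mul, ← pow_succ']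

lemma clear_den {ι A K : Type*} [CommRing A] [IsDomain A] [Field K] [Algebra A K] [IsFractionRing A K]
    (S : Finset ι) (a : ι → Polynomial K) (ha : ∀ i, i ∉ S → a i = 0) :
    ∃ (D : A) (P : ι → Polynomial A), D ≠ 0 ∧ (∀ i, i ∉ S → P i = 0) ∧
      ∀ i, (P i).map (algebraMap A K) = Polynomial.C (algebraMap A K D) * a i := by
  have h1 : ∀ i, ∃ (d : A) (Q : Polynomial A), d ≠ 0 ∧ Q.map (algebraMap A K) =
      Polynomial.C (algebraMap A K d) * a i := by
    intro i
    obtain ⟨d, hd0, hd⟩ := IsLocalization.integerNormalization_spec (nonZeroDivisors A) (a i)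
    refine ⟨d, _, nonZeroDivisors.ne_zero hd0, hd.trans ?_⟩
    rw [← Polynomial.smul_eq_C_mul, algebraMap_smul]
  choose d Q hd hQ using h1
  refine ⟨∏ i ∈ S, d i, fun i => if i ∈ S then Polynomial.C (∏ j ∈ S.erase i, d j) * Q i else 0,
    Finset.prod_ne_zero_iff.2 fun i _ => hd i, fun i hi => if_neg hi, fun i => ?_⟩
  by_cases hi : i ∈ S
  · simp only [if_pos hi]
    rw [Polynomial.map_mul, Polynomial.map_C, hQ, ← mul_assoc, ← Polynomial.C_mul, ← map_mul,
      Finset.prod_erase_mul _ _ hi]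
  · simp only [if_neg hi]; rw [ha i hi]; simp

variable {α : Type*} {q : ℕ} (s : α → ℕ) (e : α → F)

def tw (c : α) : F := e c * (-1) ^ s c

lemma chl_tw (l : List α) : chl (tw s e) l = chl e l * (-1) ^ wtl s l := by
  induction l with
  | nil => simp [chl, wtl]
  | cons c l ih =>
    simp only [chl, wtl, List.map_cons, List.prod_cons, List.sum_cons, tw] at *
    rw [ih, pow_add]; ring

lemma tw_inj (hinj : ∀ c c', s c = s c' → e c = e c' → c = c') (c c' : α) (h1 : s c = s c')
    (h2 : tw s e c = tw s e c') : c = c' := by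
  refine hinj c c' h1 ?_
  rw [tw, tw, h1] at h2
  exact mul_right_cancel₀ (pow_ne_zero _ (neg_ne_zero.2 one_ne_zero)) h2

/-- the polynomials `Y_l` -/
def yb (q w : ℕ) (l : List α) : Polynomial (Polynomial F) :=
  Polynomial.C (Polynomial.C (chl e l)) * (-Polynomial.X ^ q) ^ wtl s l *
    (1 - Polynomial.C Polynomial.X * Polynomial.X ^ q) ^ (w - wtl s l)

lemma coe_yb (hq : 2 ≤ q) (w : ℕ) (l : List α) :
    (yb s e q w l : PowerSeries (Polynomial F)) = (gY s e hq w l).1 := by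
  show _ = PowerSeries.C (Polynomial.C (chl e l)) * (-PowerSeries.X ^ q) ^ wtl s l *
    (1 - PowerSeries.C Polynomial.X * PowerSeries.X ^ q) ^ (w - wtl s l)
  rw [← Polynomial.coeToPowerSeries.ringHom_apply, yb]
  simp only [map_mul, map_pow, map_sub, map_one, map_neg, Polynomial.coeToPowerSeries.ringHom_apply,
    Polynomial.coe_C, Polynomial.coe_X]

lemma map_yb (w : ℕ) (l : List α) : (yb s e q w l).map (red0 F) =
    Polynomial.C (chl (tw s e) l) * Polynomial.X ^ (q * wtl s l) := by
  rw [yb, chl_tw]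
  simp only [Polynomial.map_mul, Polynomial.map_pow, Polynomial.map_sub, Polynomial.map_neg,
    Polynomial.map_one, Polynomial.map_C, Polynomial.map_X]
  simp only [Polynomial.coe_evalRingHom, Polynomial.eval_X, Polynomial.eval_C, map_zero, zero_mul, sub_zero, one_pow, mul_one]
  rw [neg_pow, pow_mul, Polynomial.C_mul, Polynomial.C_pow, Polynomial.C_neg, Polynomial.C_1]
  ring

/-- equations after base change -/
lemma fam_map {R : Type*} [CommRing R] (ψ : Polynomial F →+* R) (hs : ∀ c, 0 < s c) (hq : 2 ≤ q) (hq0 : q ≠ 0) (w : ℕ) [Fintype α]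
    (S : Finset (List α)) (hS : ∀ c l, c :: l ∈ S → l ∈ S) (hSw : ∀ l ∈ S, wtl s l ≤ w)
    (a : Option (List α) → Polynomial R) (ha : ∀ i, i ∉ Finset.insertNone S → a i = 0) :
    PowerSeries.map ψ (gd F hq ^ w).1 *
      ∑ i ∈ Finset.insertNone S, (a i : PowerSeries R) * PowerSeries.map ψ (fam s e hq w i).1 =
      ∑ i ∈ Finset.insertNone S, ((Tr (fun l => (yb s e q w l).map ψ) a i : Polynomial R) : PowerSeries R) *
        PowerSeries.expand q hq0 (PowerSeries.map ψ (fam s e hq w i).1) := by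
  set Φ : goodSub F q →+* PowerSeries R := (PowerSeries.map ψ).comp (goodSub F q).subtype with hΦ
  have h1 : ∀ f, Φ (sgH hq f) = PowerSeries.expand q hq0 (PowerSeries.map ψ f.1) := by
    intro f
    rw [← PowerSeries.map_expand]; rfl
  have h2 : ∀ l, Φ (gY s e hq w l) = ((yb s e q w l).map ψ : Polynomial R) := by
    intro l
    show PowerSeries.map ψ (gY s e hq w l).1 = _
    rw [← coe_yb]
    ext n; simp
  have := transferO S hS (Φ (gd F hq ^ w))
        (fun l => Φ (gY s e hq w l)) (fun i => Φ (fam s e hq w i))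
        (fun i => PowerSeries.expand q hq0 (PowerSeries.map ψ (fam s e hq w i).1))
        (by rw [← map_mul, fam_none, h1])
        (fun _ => by rw [← map_mul, fam_nil s e hs, map_mul, h1])
        (fun c l hl => by
          rw [← map_mul, fam_cons s e hs hq w c l (hSw _ hl), map_add, map_mul, map_mul, h1, h1])
        (fun i => (a i : PowerSeries R)) (fun i hi => by rw [ha i hi]; simp)
  refine Eq.trans this (Finset.sum_congr rfl fun i _ => ?_)
  congr 1
  rw [← Polynomial.coeToPowerSeries.ringHom_apply, map_Tr]
  simp only [Polynomial.coeToPowerSeries.ringHom_apply, h2]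
end indep
end

section
section indep2
variable {F : Type*} [Field F] {α : Type*} [Fintype α] {q : ℕ} (s : α → ℕ) (e : α → F)

def optz {R : Type*} [Zero R] (a : List α → R) : Option (List α) → R
  | none => 0
  | some l => a l

lemma fl_map {R : Type*} [CommRing R] (ψ : Polynomial F →+* R) (hs : ∀ c, 0 < s c) (hq : 2 ≤ q)
    (hq0 : q ≠ 0) (w : ℕ)
    (S : Finset (List α)) (hS : ∀ c l, c :: l ∈ S → l ∈ S) (hSw : ∀ l ∈ S, wtl s l ≤ w)
    (a : List α → Polynomial R) (ha : ∀ i, i ∉ S → a i = 0) :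
    PowerSeries.map ψ (gd F hq ^ w).1 *
      ∑ l ∈ S, (a l : PowerSeries R) * PowerSeries.map ψ (fl s e hq l).1 =
      ∑ l ∈ S, (((yb s e q w l).map ψ * (a l + ∑ c, a (c :: l)) : Polynomial R) : PowerSeries R) *
        PowerSeries.expand q hq0 (PowerSeries.map ψ (fl s e hq l).1) := by
  have := fam_map s e ψ hs hq hq0 w S hS hSw (optz a) (fun i hi => by
    cases i with
    | none => rfl
    | some l => exact ha l (by simpa using hi))
  rw [Finset.sum_insertNone, Finset.sum_insertNone] at this
  simpa [optz, Tr, fam] using this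

lemma indep0 (hs : ∀ c, 0 < s c) (he : ∀ c, e c ≠ 0) (hq : 2 ≤ q) (hqs : ∀ c, ¬ q ∣ s c)
    (hinj : ∀ c c', s c = s c' → e c = e c' → c = c')
    (n : ℕ) (S : Finset (List α)) (hn : S.card = n) (hS : ∀ c l, c :: l ∈ S → l ∈ S)
    (a : List α → Polynomial F) (ha : ∀ l, l ∉ S → a l = 0)
    (hrel : ∑ l ∈ S, (a l : PowerSeries F) * PowerSeries.map (red0 F) (fl s e hq l).1 = 0) :
    ∀ l, a l = 0 := by
  induction n generalizing S a with
  | zero =>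
    intro l
    refine ha l ?_
    rw [Finset.card_eq_zero.1 hn]; simp
  | succ n ih =>
    have hne : S.Nonempty := Finset.card_pos.1 (by omega)
    obtain ⟨A, hA, hmax⟩ := Finset.exists_max_image S (wtl s) hne
    by_contra hcon
    push Not at hcon
    have hq0 : q ≠ 0 := by omega
    have hmaxc : ∀ c, c :: A ∉ S := by
      intro c hc
      have h1 := hmax _ hc
      have h2 := hs c
      rw [wtl_cons] at h1; omega
    have hind : ∀ a : List α → Polynomial F, (∀ l, l ∉ S → a l = 0) → a A = 0 →
        ∑ l ∈ S, (a l : PowerSeries F) * PowerSeries.map (red0 F) (fl s e hq l).1 = 0 → ∀ l, a l = 0 := by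
      intro a ha h0 hr
      refine ih (S.erase A) (by rw [Finset.card_erase_of_mem hA]; omega) ?_ a ?_ ?_
      · intro c l hl
        rw [Finset.mem_erase] at *
        refine ⟨?_, hS c l hl.2⟩
        rintro rfl
        exact hmaxc c hl.2
      · intro l hl
        rw [Finset.mem_erase, not_and_or, not_not] at hl
        rcases hl with rfl | hl
        · exact h0
        · exact ha l hl
      · rw [← hr, ← Finset.add_sum_erase S _ hA, h0]; simp
    obtain ⟨a', h1, h2, h3, h4, h5⟩ := lemmaX q hq0 S A hA _ hind
      (fun a l => (yb s e q (wtl s A) l).map (red0 F) * (a l + ∑ c, a (c :: l)))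
      ((yb s e q (wtl s A) A).map (red0 F))
      (fun a ha => by
        rw [Finset.sum_eq_zero (fun c _ => ha _ (hmaxc c)), add_zero])
      (fun a ha hr => by
        have := fl_map s e (red0 F) hs hq hq0 (wtl s A) S hS hmax a ha
        rw [hr, mul_zero] at this
        exact this.symm) a ha hcon hrel
    rw [map_yb] at h5
    have hch := chl_ne (tw s e) (fun c => mul_ne_zero (he c) (pow_ne_zero _ (neg_ne_zero.2 one_ne_zero)))
    obtain ⟨c', E, hc', hE, hle⟩ := expand_dvd_mono q hq (a' A) h2 _ (hch A) _ h5
    have hres := residual q hq s (tw s e) hs hqs (tw_inj s e hinj) a' (wtl s A) (wtl s) (wtl_cons s)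
      (fun l hl => h1 l fun hl' => by have := hmax l hl'; omega) (chl (tw s e)) (chl (tw s e) A) hch (hch A)
      (fun c l => by simp [chl, mul_comm]) (fun l => q * wtl s l + q * E) (fun l => q * wtl s A + E)
      (q * wtl s A + E - q * E) (fun l _ => by push_cast; ring)
      (fun l _ => by
        by_cases hl : l ∈ S
        · have := h4 l hl
          simp only [map_yb, hE] at this
          rw [map_mul, map_pow, Polynomial.expand_C, Polynomial.expand_X, ← pow_mul] at this
          apply mul_left_cancel₀ (Polynomial.C_ne_zero.2 hc')
          rw [pow_add, pow_add]
          linear_combination this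
        · rw [h1 l hl, Finset.sum_eq_zero (fun c _ => h1 _ (fun h => hl (hS c l h)))]; simp)
    have hAnil : A = [] := by
      cases A with
      | nil => rfl
      | cons c l => exact absurd ((hres l).1 c) h2
    have h0 : ∀ l, l ≠ [] → a' l = 0 := by
      intro l hl
      cases l with
      | nil => exact absurd rfl hl
      | cons c l => exact (hres l).1 c
    rw [Finset.sum_eq_single A] at h3
    · rw [hAnil, fl_nil s e hs] at h3
      simp at h3
      rw [hAnil] at h2
      exact h2 h3
    · intro l _ hl
      rw [h0 l (by rwa [← hAnil])]; simp
    · intro h; exact absurd hA h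

lemma indep1 (hs : ∀ c, 0 < s c) (he : ∀ c, e c ≠ 0) (hq : 2 ≤ q) (hqs : ∀ c, ¬ q ∣ s c)
    (hinj : ∀ c c', s c = s c' → e c = e c' → c = c')
    (S : Finset (List α)) (hS : ∀ c l, c :: l ∈ S → l ∈ S)
    (a : List α → Polynomial (Polynomial F)) (ha : ∀ l, l ∉ S → a l = 0)
    (hrel : ∑ l ∈ S, (a l : PowerSeries (Polynomial F)) * (fl s e hq l).1 = 0) :
    ∀ l, a l = 0 := by
  by_contra hcon
  push Not at hcon
  obtain ⟨b, n, hb, i, hi⟩ := tdiv a hcon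
  have hX : (Polynomial.X ^ n : Polynomial F) ≠ 0 := pow_ne_zero _ Polynomial.X_ne_zero
  have hbr : ∑ l ∈ S, (b l : PowerSeries (Polynomial F)) * (fl s e hq l).1 = 0 := by
    have : PowerSeries.C (Polynomial.X ^ n : Polynomial F) *
        ∑ l ∈ S, (b l : PowerSeries (Polynomial F)) * (fl s e hq l).1 = 0 := by
      rw [← hrel, Finset.mul_sum]
      refine Finset.sum_congr rfl fun l _ => ?_
      rw [hb l, Polynomial.coe_mul, Polynomial.coe_C, mul_assoc]
    refine (mul_eq_zero.1 this).resolve_left fun h => hX ?_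
    simpa using congrArg (PowerSeries.coeff 0) h
  have hmap := congrArg (PowerSeries.map (red0 F)) hbr
  rw [map_sum, map_zero] at hmap
  refine hi (indep0 s e hs he hq hqs hinj S.card S rfl hS (fun l => (b l).map (red0 F)) ?_ ?_ i)
  · intro l hl
    have := hb l
    rw [ha l hl] at this
    have h0 := (mul_eq_zero.1 this.symm).resolve_left (Polynomial.C_ne_zero.2 hX)
    rw [h0]; simp
  · rw [← hmap]
    refine Finset.sum_congr rfl fun l _ => ?_
    rw [map_mul]
    congr 1
    ext n; simp
end indep2
end

section
section indep3
variable {F : Type*} [Field F] {α : Type*} [Fintype α] {q : ℕ} (s : α → ℕ) (e : α → F)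

lemma suffix_char (p m : ℕ) [Fact p.Prime] [CharP F p] (hqm : q = p ^ m)
    (hs : ∀ c, 0 < s c) (he : ∀ c, e c ≠ 0) (hq : 2 ≤ q) (hqs : ∀ c, ¬ q ∣ s c)
    (hinj : ∀ c c', s c = s c' → e c = e c' → c = c') (w : ℕ)
    (P : List α → Polynomial (Polynomial F)) (hP : ∀ l, w < wtl s l → P l = 0)
    (heq : ∀ l, wtl s l ≤ w → yb s e q w l * (P l + ∑ c, P (c :: l)) = Polynomial.expand _ q (P l))
    (B l : List α) (hl : P (l ++ B) ≠ 0) : chl e B = 1 := by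
  obtain ⟨b, n, hb, i, hi⟩ := tdiv (fun l => P (l ++ B)) ⟨l, hl⟩
  have hX : (Polynomial.C (Polynomial.X ^ n : Polynomial F)) ≠ 0 :=
    Polynomial.C_ne_zero.2 (pow_ne_zero _ Polynomial.X_ne_zero)
  have hch := chl_ne (tw s e) (fun c => mul_ne_zero (he c) (pow_ne_zero _ (neg_ne_zero.2 one_ne_zero)))
  have hb0 : ∀ l, w < wtl s (l ++ B) → b l = 0 := by
    intro l h
    have := hb l
    simp only [hP _ h] at this
    exact (mul_eq_zero.1 this.symm).resolve_left hX
  have hbe : ∀ l, wtl s (l ++ B) ≤ w →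
      yb s e q w (l ++ B) * (b l + ∑ c, b (c :: l)) = Polynomial.expand _ q (b l) := by
    intro l h
    have h1 := heq _ h
    have h2 : ∀ c, P (c :: (l ++ B)) = Polynomial.C (Polynomial.X ^ n) * b (c :: l) := fun c => hb (c :: l)
    have h3 : P (l ++ B) = _ := hb l
    simp only [h2, h3] at h1
    rw [← Finset.mul_sum, ← mul_add, map_mul, Polynomial.expand_C] at h1
    apply mul_left_cancel₀ hX
    linear_combination h1
  have hres := residual q hq s (tw s e) hs hqs (tw_inj s e hinj) (fun l => (b l).map (red0 F)) w
    (fun l => wtl s (l ++ B)) (fun c l => wtl_cons s c (l ++ B)) (fun l h => by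
      show (b l).map (red0 F) = 0
      rw [hb0 l h]; simp)
    (fun l => chl (tw s e) (l ++ B)) 1 (fun l => hch _) one_ne_zero
    (fun c l => by simp [chl, mul_comm, mul_assoc]) (fun l => q * wtl s (l ++ B)) (fun _ => 0) 0
    (fun l _ => by push_cast; ring)
    (fun l h => by
      have := congrArg (Polynomial.map (red0 F)) (hbe l h)
      rw [Polynomial.map_mul, map_yb, Polynomial.map_add, Polynomial.map_sum, Polynomial.map_expand] at this
      simp only [this]; simp)
  have hi0 : i = [] := by
    cases i with
    | nil => rfl
    | cons c l => exact absurd ((hres l).1 c) hi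
  subst hi0
  obtain ⟨h1, j, hj⟩ := (hres []).2 hi
  simp only [List.nil_append] at h1 hj
  have hd : (q - 1) ∣ wtl s B := by
    have h2 : (q - 1) ∣ q * wtl s B := ⟨j, by zify [show 1 ≤ q by omega]; linarith⟩
    refine Nat.Coprime.dvd_of_dvd_mul_left ?_ h2
    have : Nat.Coprime (q - 1) (q - 1 + 1) := by simp
    rwa [Nat.sub_add_cancel (by omega)] at this
  have hm1 : (-1 : F) ^ (q - 1) = 1 := by
    have : (-1 : F) ^ q = -1 := by rw [hqm]; exact neg_one_pow_char_pow (R := F) p m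
    rw [show q = q - 1 + 1 by omega, pow_succ] at this
    linear_combination -this
  rw [chl_tw] at h1
  obtain ⟨r, hr⟩ := hd
  rwa [hr, pow_mul, hm1, one_pow, mul_one] at h1

lemma trivial_of_suffix (A : List α) (h : ∀ B l, A = l ++ B → chl e B = 1) : ∀ c ∈ A, e c = 1 := by
  induction A with
  | nil => simp
  | cons c A ih =>
    have h1 := h (c :: A) [] rfl
    have h2 := h A [c] rfl
    intro c' hc'
    rcases List.mem_cons.1 hc' with rfl | hc'
    · simp only [chl, List.map_cons, List.prod_cons] at h1 h2
      rwa [h2, mul_one] at h1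
    · exact ih (fun B l hl => h B (c :: l) (by rw [hl]; rfl)) c' hc'

lemma indep_opt (hs : ∀ c, 0 < s c) (he : ∀ c, e c ≠ 0) (hq : 2 ≤ q) (hqs : ∀ c, ¬ q ∣ s c)
    (hinj : ∀ c c', s c = s c' → e c = e c' → c = c') (w : ℕ)
    (P : Option (List α) → Polynomial (Polynomial F))
    (hP : ∀ i, i ∉ Finset.insertNone (TT s hs w) → P i = 0) (h0 : P none = 0)
    (hrel : ∑ i ∈ Finset.insertNone (TT s hs w), (P i : PowerSeries (Polynomial F)) * (fam s e hq w i).1 = 0) :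
    ∀ i, P i = 0 := by
  rw [Finset.sum_insertNone, h0] at hrel
  have := indep1 s e hs he hq hqs hinj (TT s hs w) (TT_tail s hs w) (fun l => P (some l))
    (fun l hl => hP _ (by simpa using hl)) (by simpa [fam] using hrel)
  intro i
  cases i with
  | none => exact h0
  | some l => exact this l

lemma nice_relation (p m : ℕ) [Fact p.Prime] [CharP F p] (hqm : q = p ^ m)
    (hs : ∀ c, 0 < s c) (he : ∀ c, e c ≠ 0) (hq : 2 ≤ q) (hqs : ∀ c, ¬ q ∣ s c)
    (hinj : ∀ c c', s c = s c' → e c = e c' → c = c') (w : ℕ)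
    (P : Option (List α) → Polynomial (Polynomial F)) (hne : P ≠ 0)
    (hP : ∀ i, i ∉ Finset.insertNone (TT s hs w) → P i = 0)
    (hrel : ∑ i ∈ Finset.insertNone (TT s hs w), (P i : PowerSeries (Polynomial F)) * (fam s e hq w i).1 = 0) :
    ∃ (P' : Option (List α) → Polynomial (Polynomial F)) (a0 : Polynomial F), a0 ≠ 0 ∧
      P' none = Polynomial.C a0 ∧ (∀ i, i ∉ Finset.insertNone (TT s hs w) → P' i = 0) ∧
      (∑ i ∈ Finset.insertNone (TT s hs w), (P' i : PowerSeries (Polynomial F)) * (fam s e hq w i).1 = 0) ∧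
      ∀ A, P' (some A) ≠ 0 → ∀ c ∈ A, e c = 1 := by
  have hq0 : q ≠ 0 := by omega
  let K := FractionRing (Polynomial F)
  let ψ : Polynomial F →+* K := algebraMap _ _
  have hψ : Function.Injective ψ := IsFractionRing.injective (Polynomial F) K
  have hψ2 : Function.Injective (PowerSeries.map ψ) := by
    intro f g h
    ext1 n
    have := congrArg (PowerSeries.coeff n) h
    rw [PowerSeries.coeff_map, PowerSeries.coeff_map] at this
    exact hψ this
  have hcoe : ∀ Q : Polynomial (Polynomial F), ((Q.map ψ : Polynomial K) : PowerSeries K) =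
      PowerSeries.map ψ (Q : PowerSeries (Polynomial F)) := by
    intro Q; ext n; simp
  set S := Finset.insertNone (TT s hs w) with hS
  -- clearing denominators of a relation
  have hclear : ∀ a : Option (List α) → Polynomial K, (∀ i, i ∉ S → a i = 0) →
      ∑ i ∈ S, (a i : PowerSeries K) * PowerSeries.map ψ (fam s e hq w i).1 = 0 →
      ∃ (D : Polynomial F) (Q : Option (List α) → Polynomial (Polynomial F)), D ≠ 0 ∧
        (∀ i, i ∉ S → Q i = 0) ∧ (∀ i, (Q i).map ψ = Polynomial.C (ψ D) * a i) ∧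
        ∑ i ∈ S, (Q i : PowerSeries (Polynomial F)) * (fam s e hq w i).1 = 0 := by
    intro a ha hr
    obtain ⟨D, Q, hD, hQ, hQa⟩ := clear_den (A := Polynomial F) (K := K) S a ha
    refine ⟨D, Q, hD, hQ, hQa, hψ2 ?_⟩
    rw [map_sum, map_zero]
    have : PowerSeries.C (ψ D) * ∑ i ∈ S, (a i : PowerSeries K) * PowerSeries.map ψ (fam s e hq w i).1 = 0 := by
      rw [hr, mul_zero]
    rw [← this, Finset.mul_sum]
    refine Finset.sum_congr rfl fun i _ => ?_
    rw [map_mul, ← hcoe, show (Q i).map ψ = _ from hQa i, Polynomial.coe_mul, Polynomial.coe_C, mul_assoc]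
  have hind : ∀ a : Option (List α) → Polynomial K, (∀ i, i ∉ S → a i = 0) → a none = 0 →
      ∑ i ∈ S, (a i : PowerSeries K) * PowerSeries.map ψ (fam s e hq w i).1 = 0 → ∀ i, a i = 0 := by
    intro a ha h0 hr i
    obtain ⟨D, Q, hD, hQ, hQa, hQr⟩ := hclear a ha hr
    have h0' : Q none = 0 := by
      apply Polynomial.map_injective ψ hψ
      rw [hQa, h0]; simp
    have := hQa i
    rw [indep_opt s e hs he hq hqs hinj w Q hQ h0' hQr i, Polynomial.map_zero] at this
    exact (mul_eq_zero.1 this.symm).resolve_left (Polynomial.C_ne_zero.2 ((map_ne_zero_iff ψ hψ).2 hD))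
  obtain ⟨i0, hi0⟩ : ∃ i, P i ≠ 0 := by
    by_contra hc; push Not at hc; exact hne (funext hc)
  have hTT : ∀ l, l ∈ TT s hs w → wtl s l ≤ w := fun l => (mem_TT s hs w l).1
  obtain ⟨a', h1, h2, h3, h4, h5⟩ := lemmaX q hq0 S none (by simp [hS]) _ hind
    (Tr (fun l => (yb s e q w l).map ψ)) 1 (fun a ha => by simp [Tr])
    (fun a ha hr => by
      have := fam_map s e ψ hs hq hq0 w (TT s hs w) (TT_tail s hs w) hTT a ha
      rw [← hS, hr, mul_zero] at this
      exact this.symm)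
    (fun i => (P i).map ψ) (fun i hi => by simp only [hP i hi, Polynomial.map_zero])
    ⟨i0, (Polynomial.map_ne_zero_iff hψ).2 hi0⟩ (by
      have := congrArg (PowerSeries.map ψ) hrel
      rw [map_sum, map_zero] at this
      rw [← this]
      refine Finset.sum_congr rfl fun i _ => ?_
      rw [map_mul, ← hcoe])
  obtain ⟨c', E, hc', hE, hle⟩ := expand_dvd_mono q hq (a' none) h2 1 one_ne_zero 0 (by simpa using h5)
  have hE0 : E = 0 := by
    have : 2 * E ≤ q * E := Nat.mul_le_mul_right _ hq
    omega
  rw [hE0, pow_zero, mul_one] at hE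
  have h6 : ∀ j ∈ S, Tr (fun l => (yb s e q w l).map ψ) a' j = Polynomial.expand K q (a' j) := by
    intro j hj
    have := h4 j hj
    rw [hE, Polynomial.expand_C, one_mul, mul_comm] at this
    exact mul_left_cancel₀ (Polynomial.C_ne_zero.2 hc') this
  obtain ⟨D, Q, hD, hQ, hQa, hQr⟩ := hclear a' h1 h3
  have hψD : ψ D ≠ 0 := (map_ne_zero_iff ψ hψ).2 hD
  have hQn := hQa none
  rw [hE, ← Polynomial.C_mul] at hQn
  refine ⟨Q, (Q none).coeff 0, ?_, ?_, hQ, hQr, ?_⟩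
  · intro h
    have := congrArg (fun f => f.coeff 0) hQn
    simp only [Polynomial.coeff_map, h, map_zero, Polynomial.coeff_C_zero] at this
    exact mul_ne_zero hψD hc' this.symm
  · apply Polynomial.map_injective ψ hψ
    rw [hQn, Polynomial.map_C]
    congr 1
    have := congrArg (fun f => f.coeff 0) hQn
    simp only [Polynomial.coeff_map, Polynomial.coeff_C_zero] at this
    exact this.symm
  · intro A hA
    refine trivial_of_suffix e A fun B l hl => ?_
    refine suffix_char s e p m hqm hs he hq hqs hinj w (fun l => Q (some l)) ?_ ?_ B l (by rwa [← hl])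
    · intro l hl
      refine hQ _ ?_
      rw [hS, Finset.some_mem_insertNone, mem_TT]; omega
    · intro l hl
      have h7 := h6 (some l) (by rw [hS, Finset.some_mem_insertNone, mem_TT]; exact hl)
      apply Polynomial.map_injective ψ hψ
      rw [Polynomial.map_mul, Polynomial.map_add, Polynomial.map_sum, Polynomial.map_expand]
      simp only [hQa]
      rw [map_mul, Polynomial.expand_C, ← h7, ← Finset.mul_sum, ← mul_add]
      simp only [Tr]
      ring
end indep3
end

section
section corethm
variable {F : Type*} [Field F] {α : Type*} [Fintype α] {q : ℕ} (s : α → ℕ) (e : α → F)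

lemma eval_relation (hs : ∀ c, 0 < s c) (hq : 2 ≤ q) (w : ℕ)
    (P : Option (List α) → Polynomial (Polynomial F)) (a0 : Polynomial F) (ha0 : a0 ≠ 0)
    (hn : P none = Polynomial.C a0)
    (hrel : ∑ i ∈ Finset.insertNone (TT s hs w), (P i : PowerSeries (Polynomial F)) * (fam s e hq w i).1 = 0) :
    ∃ r : Option (List α) → Polynomial F, r none ≠ 0 ∧ (∀ i, P i = 0 → r i = 0) ∧
      ∑ i ∈ Finset.insertNone (TT s hs w), (r i : PowerSeries F) * ev hq 0 (fam s e hq w i) = 0 := by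
  set S := Finset.insertNone (TT s hs w) with hS
  obtain ⟨M, hM⟩ : ∃ M : ℕ, ∀ i ∈ S, ∀ b, q * ((P i).coeff b).natDegree ≤ M := by
    refine ⟨∑ i ∈ S, ∑ b ∈ (P i).support, q * ((P i).coeff b).natDegree, fun i hi b => ?_⟩
    by_cases hb : b ∈ (P i).support
    · refine le_trans ?_ (Finset.single_le_sum (f := fun i => ∑ b ∈ (P i).support, q * ((P i).coeff b).natDegree)
        (fun _ _ => Nat.zero_le _) hi)
      exact Finset.single_le_sum (f := fun b => q * ((P i).coeff b).natDegree) (fun _ _ => Nat.zero_le _) hb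
    · rw [Polynomial.notMem_support_iff.1 hb]; simp
  have hgood : ∀ i ∈ S, ((Polynomial.X ^ M * P i : Polynomial (Polynomial F)) : PowerSeries (Polynomial F)) ∈ goodSub F q := by
    intro i hi b
    show q * Polynomial.natDegree (PowerSeries.coeff b _) ≤ b
    rw [Polynomial.coeff_coe, Polynomial.coeff_X_pow_mul']
    split_ifs with h
    · exact (hM i hi _).trans h
    · simp
  have hr : ∀ i, ∃ r : Polynomial F, ∀ hi : i ∈ S, ev hq 0 ⟨_, hgood i hi⟩ = (r : PowerSeries F) := by
    intro i
    by_cases hi : i ∈ S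
    · obtain ⟨r, hr⟩ := ev_poly hq _ (hgood i hi)
      exact ⟨r, fun _ => hr⟩
    · exact ⟨0, fun h => absurd h hi⟩
  choose r hr using hr
  have hnS : none ∈ S := by simp [hS]
  refine ⟨fun i => if P i = 0 then 0 else r i, ?_, fun i hi => by simp only [if_pos hi], ?_⟩
  · have h1 : P none ≠ 0 := by rw [hn]; exact Polynomial.C_ne_zero.2 ha0
    simp only [if_neg h1]
    intro h0
    have h2 := hr none hnS
    rw [ev_mono hq 0 _ a0 M (by
      show ((Polynomial.X ^ M * P none : Polynomial (Polynomial F)) : PowerSeries (Polynomial F)) = _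
      rw [hn, Polynomial.coe_mul, Polynomial.coe_pow, Polynomial.coe_X, Polynomial.coe_C, mul_comm]), h0] at h2
    have h3 := Polynomial.coe_injective F h2
    rw [Polynomial.reflect_eq_zero_iff] at h3
    exact ha0 h3
  · have h0 : ∀ i ∈ S, (((if P i = 0 then 0 else r i : Polynomial F)) : PowerSeries F) = if hi : i ∈ S then ev hq 0 ⟨_, hgood i hi⟩ else 0 := by
      intro i hi
      rw [dif_pos hi]
      split_ifs with h
      · have : (⟨_, hgood i hi⟩ : goodSub F q) = 0 := by
          apply Subtype.ext
          show ((Polynomial.X ^ M * P i : Polynomial (Polynomial F)) : PowerSeries (Polynomial F)) = 0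
          rw [h]; simp
        rw [this]; simp
      · exact (hr i hi).symm
    rw [Finset.sum_congr rfl (fun i hi => by rw [h0 i hi])]
    have : ∑ i ∈ S.attach, (⟨_, hgood i.1 i.2⟩ : goodSub F q) * fam s e hq w i.1 = 0 := by
      apply Subtype.ext
      rw [AddSubmonoidClass.coe_finsetSum]
      have : PowerSeries.X ^ M * ∑ i ∈ S, (P i : PowerSeries (Polynomial F)) * (fam s e hq w i).1 = 0 := by
        rw [hrel, mul_zero]
      rw [← Finset.sum_attach, Finset.mul_sum] at this
      refine Eq.trans ?_ this
      refine Finset.sum_congr rfl fun i _ => ?_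
      show ((Polynomial.X ^ M * P i.1 : Polynomial (Polynomial F)) : PowerSeries (Polynomial F)) * _ = _
      rw [Polynomial.coe_mul, Polynomial.coe_pow, Polynomial.coe_X, mul_assoc]
    have h2 := congrArg (ev hq 0) this
    rw [map_sum, map_zero] at h2
    rw [← h2, ← Finset.sum_attach]
    refine Finset.sum_congr rfl fun i _ => ?_
    rw [dif_pos i.2, map_mul]

lemma core (p m : ℕ) [Fact p.Prime] [CharP F p] (hqm : q = p ^ m)
    (hs : ∀ c, 0 < s c) (he : ∀ c, e c ≠ 0) (hq : 2 ≤ q) (hqs : ∀ c, ¬ q ∣ s c)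
    (hinj : ∀ c c', s c = s c' → e c = e c' → c = c')
    (R : ℕ) (hR : 0 < R) (heR : ∀ c, e c ^ q ^ R = e c) (w : ℕ)
    (d0 : Option (List α) → Polynomial F)
    (hd0 : ∀ i, i ∉ Finset.insertNone (TT s hs w) → d0 i = 0) (hne : d0 ≠ 0)
    (hrel : ∑ i ∈ Finset.insertNone (TT s hs w), (d0 i : PowerSeries F) * ev hq 0 (fam s e hq w i) = 0) :
    d0 none ≠ 0 ∧ ∀ A, (∃ c ∈ A, e c ≠ 1) → d0 (some A) = 0 := by
  obtain ⟨P, hP, hPs, -, hPr⟩ := func_relation p m hqm s hs e he hq R hR heR w d0 hd0 hne hrel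
  obtain ⟨P', a0, ha0, hP'n, hP's, hP'r, hP't⟩ :=
    nice_relation s e p m hqm hs he hq hqs hinj w P hP hPs hPr
  obtain ⟨r, hr0, hrP, hrr⟩ := eval_relation s e hs hq w P' a0 ha0 hP'n hP'r
  have key : (fun i => r none * d0 i - d0 none * r i) = 0 := by
    by_contra hne'
    obtain ⟨Q, hQ, hQs, hQn, hQr⟩ := func_relation p m hqm s hs e he hq R hR heR w
      (fun i => r none * d0 i - d0 none * r i) (fun i hi => by
        simp only [hd0 i hi, hrP i (hP's i hi)]; simp) hne' (by
        have : (r none : PowerSeries F) * ∑ i ∈ Finset.insertNone (TT s hs w), (d0 i : PowerSeries F) * ev hq 0 (fam s e hq w i)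
          - (d0 none : PowerSeries F) * ∑ i ∈ Finset.insertNone (TT s hs w), (r i : PowerSeries F) * ev hq 0 (fam s e hq w i) = 0 := by
          rw [hrel, hrr]; simp
        rw [← this, Finset.mul_sum, Finset.mul_sum, ← Finset.sum_sub_distrib]
        refine Finset.sum_congr rfl fun i _ => ?_
        rw [Polynomial.coe_sub, Polynomial.coe_mul, Polynomial.coe_mul]; ring)
    exact hQ (funext (indep_opt s e hs he hq hqs hinj w Q hQs (hQn (by ring)) hQr))
  have key' : ∀ i, r none * d0 i = d0 none * r i := fun i => sub_eq_zero.1 (congrFun key i)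
  constructor
  · intro h0
    apply hne
    funext i
    have := key' i
    rw [h0, zero_mul] at this
    exact (mul_eq_zero.1 this).resolve_left hr0
  · rintro A ⟨c, hc, hc1⟩
    have h1 : P' (some A) = 0 := by
      by_contra h
      exact hc1 (hP't A h c hc)
    have := key' (some A)
    rw [hrP _ h1, mul_zero] at this
    exact (mul_eq_zero.1 this).resolve_left hr0
end corethm
end

section
section limits
variable {F : Type*} [Field F]
open MonoidWithZeroHom.ValueGroup₀ WithZero Filter in
lemma tendsto_ps {ι : Type*} (l : Filter ι) (f : ι → PowerSeries F) (a : PowerSeries F)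
    (h : ∀ D : ℕ, ∀ᶠ i in l, PowerSeries.X ^ D ∣ f i - a) :
    Tendsto (fun i => HahnSeries.ofPowerSeries ℤ F (f i)) l (nhds (HahnSeries.ofPowerSeries ℤ F a)) := by
  intro U hU
  obtain ⟨γ, hU₁⟩ := Valued.mem_nhds.mp hU
  suffices ∀ᶠ i in l, Valued.v (HahnSeries.ofPowerSeries ℤ F (f i) - HahnSeries.ofPowerSeries ℤ F a) < embedding γ.1 by
    simp_rw [← Valued.v.restrict_lt_iff_lt_embedding] at this
    exact this.mono fun _ hf ↦ hU₁ hf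
  set D := -(log (embedding γ.1) - 1) with hD₀
  have hD : exp (-D) < embedding γ.1 := by
    rw [← lt_log_iff_exp_lt (by simp), hD₀]
    simp
  refine (h D.toNat).mono fun i hi => ?_
  refine lt_of_le_of_lt ?_ hD
  refine le_trans ?_ (exp_le_exp.2 (neg_le_neg (Int.self_le_toNat D)))
  rw [← map_sub, LaurentSeries.intValuation_le_iff_coeff_lt_eq_zero]
  exact PowerSeries.X_pow_dvd_iff.1 hi

lemma hasSum_ps {ι : Type*} (f : ι → PowerSeries F) (a : PowerSeries F) (T : ℕ → Finset ι)
    (h1 : ∀ D, PowerSeries.X ^ D ∣ ∑ i ∈ T D, f i - a) (h2 : ∀ D i, i ∉ T D → PowerSeries.X ^ D ∣ f i) :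
    HasSum (fun i => HahnSeries.ofPowerSeries ℤ F (f i)) (HahnSeries.ofPowerSeries ℤ F a) := by
  rw [HasSum]
  simp_rw [← map_sum]
  refine tendsto_ps _ (fun S : Finset ι => ∑ i ∈ S, f i) a fun D => ?_
  rw [SummationFilter.unconditional_filter, Filter.eventually_atTop]
  refine ⟨T D, fun S hS => ?_⟩
  rw [← Finset.sum_sdiff hS, add_sub_assoc]
  refine dvd_add (Finset.dvd_sum fun i hi => h2 D i ?_) (h1 D)
  exact (Finset.mem_sdiff.1 hi).2

lemma hasProd_ps {ι : Type*} (f : ι → PowerSeries F) (a : PowerSeries F) (T : ℕ → Finset ι)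
    (h1 : ∀ D, PowerSeries.X ^ D ∣ ∏ i ∈ T D, f i - a) (h2 : ∀ D i, i ∉ T D → PowerSeries.X ^ D ∣ f i - 1) :
    HasProd (fun i => HahnSeries.ofPowerSeries ℤ F (f i)) (HahnSeries.ofPowerSeries ℤ F a) := by
  rw [HasProd]
  simp_rw [← map_prod]
  refine tendsto_ps _ (fun S : Finset ι => ∏ i ∈ S, f i) a fun D => ?_
  rw [SummationFilter.unconditional_filter, Filter.eventually_atTop]
  refine ⟨T D, fun S hS => ?_⟩
  have : PowerSeries.X ^ D ∣ ∏ i ∈ S \ T D, f i - 1 := by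
    refine Finset.prod_induction f (fun g => PowerSeries.X ^ D ∣ g - 1) ?_ (by simp) ?_
    · intro a b ha hb
      rw [show a * b - 1 = (a - 1) * b + (b - 1) by ring]
      exact dvd_add (ha.mul_right _) hb
    · intro i hi
      exact h2 D i (Finset.mem_sdiff.1 hi).2
  rw [← Finset.prod_sdiff hS]
  have h3 := dvd_add (this.mul_right (∏ i ∈ T D, f i)) (h1 D)
  convert h3 using 1
  ring
end limits

section combi
variable {α : Type*} {R : Type*} [CommRing R]

def SAf (n D : ℕ) : Finset (Fin n → ℕ) := (Fintype.piFinset fun _ => Finset.range D).filter StrictAnti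

lemma mem_SAf (n D : ℕ) (f : Fin n → ℕ) : f ∈ SAf n D ↔ (∀ i, f i < D) ∧ StrictAnti f := by
  simp [SAf]

/-- one factor -/
def fac (s : α → ℕ) (e : α → R) (v : ℕ → R) (k : ℕ) (c : α) (d : ℕ) : R :=
  e c ^ d * (∏ j ∈ Finset.range d, v (k + j)) ^ s c

lemma fac_zero (s : α → ℕ) (e : α → R) (v : ℕ → R) (k : ℕ) (c : α) : fac s e v k c 0 = 1 := by simp [fac]

lemma fac_succ (s : α → ℕ) (e : α → R) (v : ℕ → R) (k : ℕ) (c : α) (d : ℕ) :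
    fac s e v k c (d + 1) = (e c * v k ^ s c) * fac s e v (k + 1) c d := by
  rw [fac, fac, Finset.prod_range_succ', pow_succ, mul_pow]
  rw [Finset.prod_congr rfl (fun j _ => congrArg v (show k + (j + 1) = k + 1 + j by omega)), add_zero]
  ring

def rl {n : ℕ} (a : Fin n → α) : List α := (List.ofFn a).reverse

lemma rl_succ {n : ℕ} (a : Fin (n + 1) → α) : rl a = a (Fin.last n) :: rl (fun i : Fin n => a i.castSucc) := by
  rw [rl, List.ofFn_succ']; simp [rl]

lemma prod_rl (s : α → ℕ) (e : α → R) (v : ℕ → R) (k : ℕ) {n : ℕ} (a : Fin n → α) :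
    ∏ i, (e (a i) * v k ^ s (a i)) = ((rl a).map e).prod * v k ^ ((rl a).map s).sum := by
  rw [rl, List.map_reverse, List.map_reverse, List.prod_reverse, List.sum_reverse, List.map_ofFn, List.map_ofFn,
    List.prod_ofFn, List.sum_ofFn, ← Finset.prod_pow_eq_pow_sum, ← Finset.prod_mul_distrib]
  rfl

lemma sum_SAf (s : α → ℕ) (e : α → R) (v : ℕ → R) (D : ℕ) : ∀ (k : ℕ) {n : ℕ} (a : Fin n → α),
    ∑ f ∈ SAf n D, ∏ i, fac s e v k (a i) (f i) =
      Urec (fun l k => (l.map e).prod * v k ^ (l.map s).sum) D k (rl a) := by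
  induction D with
  | zero =>
    intro k n a
    cases n with
    | zero =>
      rw [show rl a = [] by simp [rl], Urec_nil, Finset.sum_eq_single_of_mem ![] (by
        rw [mem_SAf]; exact ⟨fun i => i.elim0, fun i => i.elim0⟩)]
      · simp
      · intro b _ hb; exact absurd (Subsingleton.elim _ _) hb
    | succ n =>
      rw [rl_succ, Urec]
      refine Finset.sum_eq_zero fun f hf => ?_
      have := ((mem_SAf _ _ _).1 hf).1 0
      omega
  | succ D ih =>
    intro k n a
    cases n with
    | zero =>
      rw [show rl a = [] by simp [rl], Urec_nil, Finset.sum_eq_single_of_mem ![] (by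
        rw [mem_SAf]; exact ⟨fun i => i.elim0, fun i => i.elim0⟩)]
      · simp
      · intro b _ hb; exact absurd (Subsingleton.elim _ _) hb
    | succ n =>
      rw [rl_succ, Urec, ← rl_succ, ← ih (k + 1) a, ← ih (k + 1) (fun i : Fin n => a i.castSucc),
        ← prod_rl, ← prod_rl, Finset.mul_sum, Finset.mul_sum]
      rw [← Finset.sum_filter_not_add_sum_filter _ (fun f => f (Fin.last n) = 0)]
      congr 1
      · refine (Finset.sum_nbij' (fun g i => g i + 1) (fun f i => f i - 1) ?_ ?_ ?_ ?_ ?_).symm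
        · intro g hg
          rw [mem_SAf] at hg
          rw [Finset.mem_filter, mem_SAf]
          exact ⟨⟨fun i => by have := hg.1 i; omega, fun i j h => Nat.succ_lt_succ (hg.2 h)⟩, Nat.succ_ne_zero _⟩
        · intro f hf
          rw [Finset.mem_filter, mem_SAf] at hf
          have h0 : ∀ i, 0 < f i := fun i =>
            lt_of_lt_of_le (Nat.pos_of_ne_zero hf.2) (hf.1.2.antitone (Fin.le_last i))
          rw [mem_SAf]
          refine ⟨fun i => by have := hf.1.1 i; have := h0 i; omega, fun i j h => ?_⟩
          have := hf.1.2 h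
          have := h0 j
          show f j - 1 < f i - 1
          omega
        · intro g _; simp
        · intro f hf
          rw [Finset.mem_filter, mem_SAf] at hf
          have h0 : ∀ i, 0 < f i := fun i =>
            lt_of_lt_of_le (Nat.pos_of_ne_zero hf.2) (hf.1.2.antitone (Fin.le_last i))
          funext i
          have := h0 i
          show f i - 1 + 1 = f i
          omega
        · intro g _
          rw [← Finset.prod_mul_distrib]
          simp only [fac_succ]
      · refine (Finset.sum_nbij' (fun g => Fin.snoc (α := fun _ => ℕ) (fun i => g i + 1) 0) (fun f i => f i.castSucc - 1) ?_ ?_ ?_ ?_ ?_).symm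
        · intro g hg
          rw [mem_SAf] at hg
          rw [Finset.mem_filter, mem_SAf]
          refine ⟨⟨fun i => ?_, fun i j h => ?_⟩, by simp⟩
          · refine Fin.lastCases ?_ (fun i => ?_) i
            · simp
            · have := hg.1 i; simp; omega
          · revert h
            refine Fin.lastCases ?_ (fun i => ?_) i
            · intro h; exact absurd h (not_lt.2 (Fin.le_last j))
            · refine Fin.lastCases ?_ (fun j => ?_) j
              · intro _; simp
              · intro h
                have := hg.2 (Fin.castSucc_lt_castSucc_iff.1 h)
                simpa using this
        · intro f hf
          rw [Finset.mem_filter, mem_SAf] at hf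
          have h0 : ∀ i : Fin n, 0 < f i.castSucc := fun i => by
            have := hf.1.2 (Fin.castSucc_lt_last i); omega
          rw [mem_SAf]
          refine ⟨fun i => by have := hf.1.1 i.castSucc; have := h0 i; omega, fun i j h => ?_⟩
          have := hf.1.2 (Fin.castSucc_lt_castSucc_iff.2 h)
          have := h0 j
          show f j.castSucc - 1 < f i.castSucc - 1
          omega
        · intro g _; funext i; simp
        · intro f hf
          rw [Finset.mem_filter, mem_SAf] at hf
          have h0 : ∀ i : Fin n, 0 < f i.castSucc := fun i => by
            have := hf.1.2 (Fin.castSucc_lt_last i); omega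
          funext i
          refine Fin.lastCases ?_ (fun i => ?_) i
          · simp [hf.2]
          · have := h0 i
            simp; omega
        · intro g _
          rw [← Finset.prod_mul_distrib, Fin.prod_univ_castSucc]
          simp only [Fin.snoc_castSucc, Fin.snoc_last, fac_succ, fac_zero, mul_one]
end combi
end

section
section numeric
variable {F : Type*} [Field F] {q : ℕ}

abbrev OO (F : Type*) [Field F] : PowerSeries F →+* LaurentSeries F := HahnSeries.ofPowerSeries ℤ F

abbrev thg (F : Type*) [Field F] : LaurentSeries F := HahnSeries.single (-1 : ℤ) 1

lemma thg_mul : thg F * OO F PowerSeries.X = 1 := by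
  rw [HahnSeries.ofPowerSeries_X, HahnSeries.single_mul_single]; simp

lemma thg_ne : thg F ≠ 0 := left_ne_zero_of_mul_eq_one (thg_mul (F := F))

lemma thg_inv : thg F = (OO F PowerSeries.X)⁻¹ := eq_inv_of_mul_eq_one_left thg_mul

lemma ev_ggeo (hq : 2 ≤ q) (k : ℕ) :
    ev hq 0 (ggeo F hq k) * (1 - PowerSeries.X ^ (q ^ (k + 1) - 1)) = 1 := by
  have hg : (1 - PowerSeries.C Polynomial.X * PowerSeries.X ^ (q ^ (k + 1)) : PowerSeries (Polynomial F)) ∈ goodSub F q := by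
    refine sub_mem (one_mem _) fun b => ?_
    rw [PowerSeries.coeff_C_mul_X_pow]
    split_ifs with h
    · subst h; simpa using le_qpow hq k
    · simp
  have h1 : ggeo F hq k * ⟨_, hg⟩ = 1 := Subtype.ext (geo_mul (F := F) (q ^ (k + 1)) (by positivity))
  have h2 := congrArg (ev hq 0) h1
  rw [map_mul, map_one] at h2
  have h3 : (⟨_, hg⟩ : goodSub F q) = 1 - (1 - ⟨_, hg⟩) := by ring
  rw [h3, map_sub, map_one, ev_mono hq 0 (1 - ⟨_, hg⟩) Polynomial.X (q ^ (k + 1)) (by simp)] at h2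
  have := Polynomial.reflect_monomial (R := F) (q ^ 0 * q ^ (k + 1)) 1
  rw [pow_one] at this
  rw [this, Polynomial.revAt_le (by rw [pow_zero, one_mul]; exact Nat.one_le_pow _ _ (by omega))] at h2
  simpa using h2

def vn (F : Type*) [Field F] (hq : 2 ≤ q) (k : ℕ) : PowerSeries F := ev hq 0 (gv F hq k)

lemma vn_eq (hq : 2 ≤ q) (k : ℕ) :
    vn F hq k = -(PowerSeries.X ^ (q ^ (k + 1)) * ev hq 0 (ggeo F hq k)) := by
  rw [vn, gv, map_neg, map_mul, map_pow, ev_X]; simp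

lemma X_dvd_vn (hq : 2 ≤ q) (k : ℕ) : PowerSeries.X ∣ vn F hq k := by
  rw [vn_eq, dvd_neg]
  exact (dvd_pow_self _ (by positivity)).mul_right _

lemma vn_spec (hq : 2 ≤ q) (k : ℕ) : (thg F - thg F ^ q ^ (k + 1))⁻¹ = OO F (vn F hq k) := by
  symm
  apply eq_inv_of_mul_eq_one_left
  obtain ⟨Q, hQ⟩ : ∃ Q, q ^ (k + 1) = Q + 1 := Nat.exists_eq_succ_of_ne_zero (by positivity)
  have h1 := congrArg (OO F) (ev_ggeo (F := F) hq k)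
  rw [vn_eq, hQ] at *
  rw [map_mul, map_sub, map_one, map_pow, Nat.add_sub_cancel] at h1
  rw [map_neg, map_mul, map_pow]
  have h2 : thg F ^ (Q + 1) * OO F PowerSeries.X ^ (Q + 1) = 1 := by rw [← mul_pow, thg_mul, one_pow]
  have h3 := thg_mul (F := F)
  set x := OO F PowerSeries.X
  set g := OO F (ev hq 0 (ggeo F hq k))
  linear_combination h1 + g * h2 - x ^ Q * g * h3

lemma ell_inv (hq : 2 ≤ q) (d : ℕ) :
    (∏ i ∈ Finset.Icc 1 d, (thg F - thg F ^ q ^ i))⁻¹ = OO F (∏ j ∈ Finset.range d, vn F hq (0 + j)) := by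
  induction d with
  | zero => simp
  | succ d ih =>
    rw [Finset.prod_Icc_succ_top (by omega), mul_inv, ih, Finset.prod_range_succ, map_mul, vn_spec hq, zero_add]

variable {α : Type*} (s : α → ℕ) (e : α → F)

lemma fac_num (hq : 2 ≤ q) (c : α) (d : ℕ) :
    HahnSeries.C (e c ^ d) / (∏ i ∈ Finset.Icc 1 d, (thg F - thg F ^ q ^ i)) ^ s c =
      OO F (fac s (fun c => PowerSeries.C (e c)) (vn F hq) 0 c d) := by
  rw [fac, map_mul, map_pow (OO F) _ (s c), ← ell_inv, div_eq_mul_inv, inv_pow, ← map_pow, HahnSeries.ofPowerSeries_C]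

lemma Li_hasSum (hs : ∀ c, 0 < s c) (hq : 2 ≤ q) {n : ℕ} (a : Fin n → α) :
    HasSum (fun f : {f : Fin n → ℕ // StrictAnti f} =>
      OO F (∏ i, fac s (fun c => PowerSeries.C (e c)) (vn F hq) 0 (a i) (f.1 i)))
      (OO F (ev hq 0 (fl s e hq (rl a)))) := by
  refine hasSum_ps (fun f : {f : Fin n → ℕ // StrictAnti f} => ∏ i, fac s (fun c => PowerSeries.C (e c)) (vn F hq) 0 (a i) (f.1 i))
    _ (fun D => (SAf n (2 * D)).subtype StrictAnti) (fun D => ?_) (fun D f hf => ?_)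
  · rw [Finset.sum_subtype_eq_sum_filter (f := fun f : Fin n → ℕ => ∏ i, fac s (fun c => PowerSeries.C (e c)) (vn F hq) 0 (a i) (f i)),
      Finset.filter_true_of_mem (fun f hf => ((mem_SAf _ _ _).1 hf).2), sum_SAf]
    have h1 := ev_dvd hq 0 _ D (fl_spec s e hs hq (2 * D) (rl a))
    rw [map_sub, map_Urec (ev hq 0) (gXl s e hq)
      (fun l k => (l.map (fun c => PowerSeries.C (e c))).prod * vn F hq k ^ (l.map s).sum) 0 (fun l k => by
        rw [gXl, map_mul, map_pow, ev_C, chl, wtl, map_list_prod, List.map_map]; rfl)] at h1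
    rw [← neg_sub, dvd_neg]
    exact h1
  · have : ∃ i, 2 * D ≤ f.1 i := by
      by_contra hc
      push Not at hc
      exact hf (by rw [Finset.mem_subtype, mem_SAf]; exact ⟨hc, f.2⟩)
    obtain ⟨i, hi⟩ := this
    refine Dvd.dvd.trans ?_ (Finset.dvd_prod_of_mem _ (Finset.mem_univ i))
    rw [fac]
    refine Dvd.dvd.mul_left (Dvd.dvd.trans ?_ (dvd_pow_self _ (hs _).ne')) _
    refine (pow_dvd_pow _ (show D ≤ f.1 i by omega)).trans ?_
    have := Finset.prod_dvd_prod_of_dvd (s := Finset.range (f.1 i)) (fun _ => (PowerSeries.X : PowerSeries F)) (fun j => vn F hq (0 + j))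
      (fun j _ => X_dvd_vn hq _)
    simpa using this

lemma pi_hasProd (hq : 2 ≤ q) :
    HasProd (fun i : ℕ => (1 - thg F ^ ((1 : ℤ) - (q : ℤ) ^ (i + 1))) ^ (-((q : ℤ) - 1)))
      (OO F (ev hq 0 (gG F hq)) ^ (q - 1)) := by
  have h1 : HasProd (fun i => OO F (ev hq 0 (ggeo F hq i))) (OO F (ev hq 0 (gG F hq))) := by
    refine hasProd_ps (fun i => ev hq 0 (ggeo F hq i)) _ (fun D => Finset.range (2 * D)) (fun D => ?_) (fun D i hi => ?_)
    · have := ev_dvd hq 0 _ D (gG_spec (F := F) hq (2 * D))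
      rw [map_sub, gP, map_prod] at this
      rw [← neg_sub, dvd_neg]
      exact this
    · have h2 := ev_ggeo (F := F) hq i
      have h3 : ev hq 0 (ggeo F hq i) - 1 = PowerSeries.X ^ (q ^ (i + 1) - 1) * ev hq 0 (ggeo F hq i) := by
        linear_combination h2
      rw [h3]
      refine (pow_dvd_pow _ ?_).mul_right _
      have h4 : 2 * D ≤ i := by simpa using hi
      have := Nat.lt_pow_self (show 1 < q by omega) (n := i + 1)
      omega
  have h2 : ∀ i : ℕ, (1 - thg F ^ ((1 : ℤ) - (q : ℤ) ^ (i + 1))) ^ (-((q : ℤ) - 1)) =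
      OO F (ev hq 0 (ggeo F hq i)) ^ (q - 1) := by
    intro i
    have h3 : (1 : ℤ) - (q : ℤ) ^ (i + 1) = -((q ^ (i + 1) - 1 : ℕ) : ℤ) := by
      rw [Nat.cast_sub (Nat.one_le_pow _ _ (by omega))]; push_cast; ring
    have h4 : -((q : ℤ) - 1) = -((q - 1 : ℕ) : ℤ) := by
      rw [Nat.cast_sub (by omega)]; push_cast; ring
    rw [h3, h4, thg_inv, inv_zpow, zpow_neg (OO F PowerSeries.X), inv_inv, zpow_natCast, zpow_neg, ← inv_zpow, zpow_natCast]
    congr 1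
    symm
    apply eq_inv_of_mul_eq_one_left
    rw [← map_pow, ← map_one (OO F), ← map_sub, ← map_mul, ev_ggeo]
  simp_rw [h2]
  have h5 : Filter.Tendsto _ _ _ := h1
  have h6 := h5.pow (q - 1)
  simp_rw [← Finset.prod_pow] at h6
  exact h6

/-- elements with a representation as a fraction of polynomials -/
lemma frac_induct (x : LaurentSeries F)
    (hx : x ∈ Subfield.closure ((Set.range fun x : F => (HahnSeries.C x : LaurentSeries F)) ∪ {thg F})) :
    ∃ n d : Polynomial F, d ≠ 0 ∧ OO F (d : PowerSeries F) * x = OO F (n : PowerSeries F) := by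
  induction hx using Subfield.closure_induction with
  | mem x hx =>
    rcases hx with ⟨c, rfl⟩ | hx
    · exact ⟨Polynomial.C c, 1, one_ne_zero, by simp [HahnSeries.ofPowerSeries_C]⟩
    · rw [Set.mem_singleton_iff] at hx
      subst hx
      exact ⟨1, Polynomial.X, Polynomial.X_ne_zero, by
        rw [Polynomial.coe_X, mul_comm, thg_mul]; simp⟩
  | one => exact ⟨1, 1, one_ne_zero, by simp⟩
  | add x y _ _ hx hy =>
    obtain ⟨n, d, hd, h⟩ := hx
    obtain ⟨n', d', hd', h'⟩ := hy
    refine ⟨n * d' + n' * d, d * d', mul_ne_zero hd hd', ?_⟩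
    simp only [Polynomial.coe_mul, Polynomial.coe_add, map_mul, map_add]
    linear_combination OO F d' * h + OO F d * h'
  | neg x _ hx =>
    obtain ⟨n, d, hd, h⟩ := hx
    refine ⟨-n, d, hd, ?_⟩
    rw [Polynomial.coe_neg, map_neg, ← h]; ring
  | inv x _ hx =>
    obtain ⟨n, d, hd, h⟩ := hx
    by_cases h0 : x = 0
    · exact ⟨0, 1, one_ne_zero, by simp [h0]⟩
    · have hd' : OO F (d : PowerSeries F) ≠ 0 := by
        rw [map_ne_zero_iff _ HahnSeries.ofPowerSeries_injective]
        simpa using hd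
      refine ⟨d, n, ?_, ?_⟩
      · rintro rfl
        rw [Polynomial.coe_zero, map_zero] at h
        exact (mul_ne_zero hd' h0) h
      · rw [← h]; field_simp
  | mul x y _ _ hx hy =>
    obtain ⟨n, d, hd, h⟩ := hx
    obtain ⟨n', d', hd', h'⟩ := hy
    refine ⟨n * n', d * d', mul_ne_zero hd hd', ?_⟩
    simp only [Polynomial.coe_mul, map_mul]
    rw [← h, ← h']; ring

lemma common_den {ι : Type*} [Fintype ι] (x : ι → LaurentSeries F)
    (hx : ∀ i, x i ∈ Subfield.closure ((Set.range fun x : F => (HahnSeries.C x : LaurentSeries F)) ∪ {thg F})) :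
    ∃ (D : LaurentSeries F) (n : ι → Polynomial F), D ≠ 0 ∧ ∀ i, D * x i = OO F (n i : PowerSeries F) := by
  choose n d hd h using fun i => frac_induct (x i) (hx i)
  refine ⟨∏ i, OO F (d i : PowerSeries F), fun i => n i * ∏ j ∈ Finset.univ.erase i, d j, ?_, fun i => ?_⟩
  · rw [Finset.prod_ne_zero_iff]
    intro i _
    rw [map_ne_zero_iff _ HahnSeries.ofPowerSeries_injective]
    simpa using hd i
  · rw [← Finset.mul_prod_erase _ _ (Finset.mem_univ i), Polynomial.coe_mul, map_mul, ← h,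
      ← Polynomial.coeToPowerSeries.ringHom_apply (φ := ∏ j ∈ Finset.univ.erase i, d j), map_prod, map_prod]
    simp only [Polynomial.coeToPowerSeries.ringHom_apply]
    ring
end numeric
end

section
section final
variable {Fq : Type} [Field Fq] [Fintype Fq]

lemma Rdeg_mem (N : ℕ) (hN : 0 < N) :
    0 < Rdeg Fq N ∧ ∀ x : Fb Fq, x ^ N = 1 → x ^ qc Fq ^ Rdeg Fq N = x := by
  refine Nat.sInf_mem (s := {r | 0 < r ∧ ∀ x : Fb Fq, x ^ N = 1 → x ^ qc Fq ^ r = x}) ?_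
  obtain ⟨p, hp⟩ := CharP.exists Fq
  obtain ⟨m, hprime, hcard⟩ := FiniteField.card Fq p
  have := Fact.mk hprime
  have : CharP (Fb Fq) p := charP_of_injective_algebraMap (algebraMap Fq (Fb Fq)).injective p
  have hfin : Finite {x : Fb Fq // x ^ N = 1} := by
    refine Set.Finite.subset (Polynomial.nthRoots N (1 : Fb Fq)).toFinset.finite_toSet fun x hx => ?_
    have hx' : x ^ N = 1 := hx
    simpa [Polynomial.mem_nthRoots hN] using hx'
  have hqc : qc Fq = p ^ (m : ℕ) := hcard
  have hinj : Function.Injective (fun x : Fb Fq => x ^ qc Fq) := by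
    rw [hqc]
    exact (iterateFrobenius (Fb Fq) p m).injective
  let g : {x : Fb Fq // x ^ N = 1} → {x : Fb Fq // x ^ N = 1} :=
    fun x => ⟨x.1 ^ qc Fq, by rw [← pow_mul, mul_comm, pow_mul, x.2, one_pow]⟩
  have hg : Function.Injective g := fun x y h => Subtype.ext (hinj (congrArg Subtype.val h))
  have hgit : ∀ r x, ((g^[r]) x).1 = x.1 ^ qc Fq ^ r := by
    intro r x
    induction r with
    | zero => simp
    | succ r ih =>
      rw [Function.iterate_succ_apply']
      show ((g^[r]) x).1 ^ qc Fq = _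
      rw [ih, ← pow_mul, pow_succ]
  let σ : Equiv.Perm {x : Fb Fq // x ^ N = 1} := Equiv.ofBijective g (Finite.injective_iff_bijective.1 hg)
  have hσ : ∀ r x, (σ ^ r) x = (g^[r]) x := by
    intro r x
    rw [Equiv.Perm.iterate_eq_pow σ r |>.symm]; rfl
  refine ⟨orderOf σ, orderOf_pos σ, fun x hx => ?_⟩
  rw [← hgit (orderOf σ) ⟨x, hx⟩, ← hσ, pow_orderOf_eq_one]; rfl

/-- the letters -/
def Let (Fq : Type) [Field Fq] [Fintype Fq] (N w : ℕ) : Type :=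
  {c : ℕ × Fb Fq // (0 < c.1 ∧ c.1 ≤ w) ∧ ¬ qc Fq ∣ c.1 ∧ c.2 ^ N = 1}

lemma Let_finite (N w : ℕ) (hN : 0 < N) : Finite (Let Fq N w) := by
  refine Set.Finite.subset ((Set.finite_Icc 0 w).prod (Polynomial.nthRoots N (1 : Fb Fq)).toFinset.finite_toSet) ?_
  intro c hc
  refine ⟨⟨Nat.zero_le _, hc.1.2⟩, ?_⟩
  simpa [Polynomial.mem_nthRoots hN] using hc.2.2

def lets {N w : ℕ} (A : SwIdx Fq N w) (i : Fin A.1.depth) : Let Fq N w :=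
  ⟨(A.1.s i, A.1.eps i), ⟨A.2.1.1 i, by
    have h := A.2.2.2.1
    refine le_of_le_of_eq ?_ h
    exact Finset.single_le_sum (f := A.1.s) (fun _ _ => Nat.zero_le _) (Finset.mem_univ i)⟩, A.2.2.2.2 i, A.2.1.2 i⟩

lemma rl_inj {α : Type*} {n m : ℕ} (a : Fin n → α) (b : Fin m → α) (h : rl a = rl b) :
    ∃ h : n = m, ∀ i, a i = b (Fin.cast h i) := by
  have h1 : List.ofFn a = List.ofFn b := List.reverse_injective h
  have h2 : n = m := by simpa using congrArg List.length h1
  subst h2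
  exact ⟨rfl, fun i => congrFun (List.ofFn_injective h1) i⟩

lemma lets_inj {N w : ℕ} : Function.Injective (fun A : SwIdx Fq N w => rl (lets A)) := by
  intro A B h
  obtain ⟨h1, h2⟩ := rl_inj _ _ h
  obtain ⟨⟨n, s, e⟩, hA⟩ := A
  obtain ⟨⟨n', s', e'⟩, hB⟩ := B
  simp only at h1
  subst h1
  have h3 : ∀ i, s i = s' i ∧ e i = e' i := fun i => by
    have := congrArg Subtype.val (h2 i)
    simpa [lets] using this
  have h4 : s = s' := funext fun i => (h3 i).1
  have h5 : e = e' := funext fun i => (h3 i).2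
  subst h4 h5
  rfl

lemma wtl_rl {α : Type*} (s : α → ℕ) {n : ℕ} (a : Fin n → α) : wtl s (rl a) = ∑ i, s (a i) := by
  rw [wtl, rl, List.map_reverse, List.sum_reverse, List.map_ofFn, List.sum_ofFn]; rfl
end final
end

/-- **Characters in a relation with the Carlitz period must be trivial** (part 1 of
Theorem `trans CMPL at roots of unity`): if `(q-1) ∣ w` and `a, a_{(𝔰,𝛆)} ∈ 𝔽̄_q(θ)`, not
all zero, satisfy `a·ϖ^{w/(q-1)} + Σ_{(𝔰,𝛆)} a_{(𝔰,𝛆)}·μ(𝛆)·Li(𝛆;𝔰) = 0`, then `a ≠ 0`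
and `a_{(𝔰,𝛆)} = 0` whenever `𝛆 ≠ (1,…,1)`. -/
theorem characters_in_period_relation_are_trivial
    (Fq : Type) [Field Fq] [Fintype Fq] (N w : ℕ) (hN : 0 < N) (hw : 0 < w)
    (hdvd : (qc Fq - 1) ∣ w)
    (μ : Fb Fq → Fb Fq)
    (hμ : ∀ x : Fb Fq, x ^ N = 1 → μ x ^ (qc Fq ^ Rdeg Fq N - 1) = x ^ Rdeg Fq N)
    (a : Kinf Fq) (b : SwIdx Fq N w → Kinf Fq)
    (ha : a ∈ Fbtheta Fq) (hb : ∀ A, b A ∈ Fbtheta Fq)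
    (hnz : a ≠ 0 ∨ ∃ A, b A ≠ 0)
    (hrel : a * piInf Fq ^ (w / (qc Fq - 1)) +
        ∑' A : SwIdx Fq N w, b A * cst Fq (∏ i, μ (A.1.eps i)) * Li Fq A.1 = 0) :
    a ≠ 0 ∧ ∀ A : SwIdx Fq N w, (∃ i, A.1.eps i ≠ 1) → b A = 0 := by
  obtain ⟨p, hp⟩ := CharP.exists Fq
  obtain ⟨m, hprime, hcard⟩ := FiniteField.card Fq p
  have := Fact.mk hprime
  have : CharP (Fb Fq) p := charP_of_injective_algebraMap (algebraMap Fq (Fb Fq)).injective p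
  have hqm : qc Fq = p ^ (m : ℕ) := hcard
  have hq : 2 ≤ qc Fq := Fintype.one_lt_card
  obtain ⟨hR, hfr⟩ := Rdeg_mem (Fq := Fq) N hN
  have hfinL := Let_finite (Fq := Fq) N w hN
  let instL : Fintype (Let Fq N w) := Fintype.ofFinite _
  let s : Let Fq N w → ℕ := fun c => c.1.1
  let e : Let Fq N w → Fb Fq := fun c => c.1.2
  have hs : ∀ c, 0 < s c := fun c => c.2.1.1
  have he : ∀ c, e c ≠ 0 := by
    intro c h
    have h1 : e c ^ N = 1 := c.2.2.2
    rw [h, zero_pow hN.ne'] at h1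
    exact zero_ne_one h1
  have hqs : ∀ c, ¬ qc Fq ∣ s c := fun c => c.2.2.1
  have hinj : ∀ c c', s c = s c' → e c = e c' → c = c' := fun c c' h1 h2 => Subtype.ext (Prod.ext h1 h2)
  have heR : ∀ c, e c ^ qc Fq ^ Rdeg Fq N = e c := fun c => hfr _ c.2.2.2
  -- the index type is finite
  have hmemT : ∀ A : SwIdx Fq N w, rl (lets A) ∈ TT s hs w := by
    intro A
    rw [mem_TT, wtl_rl]
    exact le_of_eq A.2.2.2.1
  have hfinS : Finite (SwIdx Fq N w) :=
    Finite.of_injective (fun A => (⟨rl (lets A), hmemT A⟩ : TT s hs w))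
      (fun A B h => lets_inj (congrArg Subtype.val h))
  let instS : Fintype (SwIdx Fq N w) := Fintype.ofFinite _
  -- the values
  have hLi : ∀ A : SwIdx Fq N w, Li Fq A.1 = OO (Fb Fq) (ev hq 0 (fl s e hq (rl (lets A)))) := by
    intro A
    rw [Li, ← (Li_hasSum s e hs hq (lets A)).tsum_eq]
    refine tsum_congr fun f => ?_
    rw [map_prod]
    exact Finset.prod_congr rfl fun i _ => fac_num s e hq (lets A i) (f.1 i)
  have hpi : piInf Fq ^ (w / (qc Fq - 1)) =
      (-theta Fq) ^ (qc Fq * (w / (qc Fq - 1))) * OO (Fb Fq) (ev hq 0 (gG (Fb Fq) hq ^ w)) := by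
    rw [piInf]
    have h1 : ∏' i : ℕ, (1 - theta Fq ^ ((1 : ℤ) - (qc Fq : ℤ) ^ (i + 1))) ^ (-((qc Fq : ℤ) - 1)) =
        OO (Fb Fq) (ev hq 0 (gG (Fb Fq) hq)) ^ (qc Fq - 1) := (pi_hasProd (F := Fb Fq) hq).tprod_eq
    rw [h1, mul_pow, ← pow_mul, ← pow_mul, Nat.mul_div_cancel' hdvd, map_pow, map_pow]
  have hth : theta Fq ∈ Fbtheta Fq := Subfield.subset_closure (Or.inr rfl)
  have hcs : ∀ x, cst Fq x ∈ Fbtheta Fq := fun x => Subfield.subset_closure (Or.inl ⟨x, rfl⟩)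
  have hμ0 : ∀ A : SwIdx Fq N w, cst Fq (∏ i, μ (A.1.eps i)) ≠ 0 := by
    intro A
    rw [map_ne_zero_iff _ (cst Fq).injective, Finset.prod_ne_zero_iff]
    intro i _ h0
    have h1 := hμ _ (A.2.1.2 i)
    have h2 : 1 < qc Fq ^ Rdeg Fq N := Nat.one_lt_pow hR.ne' (by omega)
    rw [h0, zero_pow (by omega)] at h1
    exact pow_ne_zero _ (he (lets A i)) h1.symm
  let x : Option (SwIdx Fq N w) → Kinf Fq := fun i => match i with
    | none => a * (-theta Fq) ^ (qc Fq * (w / (qc Fq - 1)))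
    | some A => b A * cst Fq (∏ i, μ (A.1.eps i))
  obtain ⟨D, n, hD, hn⟩ := common_den (F := Fb Fq) x (fun i => by
    match i with
    | none => exact mul_mem ha (pow_mem (neg_mem hth) _)
    | some A => exact mul_mem (hb A) (hcs _))
  have hx0 : x none = 0 ↔ a = 0 := by
    have h1 : (-theta Fq) ^ (qc Fq * (w / (qc Fq - 1))) ≠ 0 := pow_ne_zero _ (neg_ne_zero.2 thg_ne)
    exact ⟨fun h => (mul_eq_zero.1 h).resolve_right h1, fun h => by simp only [x, h, zero_mul]⟩
  have hxA : ∀ A, x (some A) = 0 ↔ b A = 0 := fun A =>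
    ⟨fun h => (mul_eq_zero.1 h).resolve_right (hμ0 A), fun h => by simp only [x, h, zero_mul]⟩
  have hn0 : ∀ i, n i = 0 ↔ x i = 0 := by
    intro i
    have h1 := hn i
    constructor
    · intro h
      rw [h, Polynomial.coe_zero, map_zero] at h1
      exact (mul_eq_zero.1 h1).resolve_left hD
    · intro h
      rw [h, mul_zero, ← map_zero (OO (Fb Fq))] at h1
      have := HahnSeries.ofPowerSeries_injective h1
      simpa using this.symm
  let L : SwIdx Fq N w → List (Let Fq N w) := fun A => rl (lets A)
  have hL : Function.Injective L := lets_inj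
  let d0 : Option (List (Let Fq N w)) → Polynomial (Fb Fq) := fun i => match i with
    | none => n none
    | some l => Function.extend L (fun A => n (some A)) 0 l
  have hd0L : ∀ A, d0 (some (L A)) = n (some A) := fun A => hL.extend_apply _ _ A
  have hd0n : ∀ l, (¬ ∃ A, L A = l) → d0 (some l) = 0 := fun l hl => Function.extend_apply' _ _ _ hl
  have hcore := core s e p m hqm hs he hq hqs hinj (Rdeg Fq N) hR heR w d0 (by
      intro i hi
      match i with
      | none => simp at hi
      | some l =>
        refine hd0n l ?_
        rintro ⟨A, rfl⟩
        exact hi (Finset.some_mem_insertNone.2 (hmemT A)))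
    (by
      intro h
      have h1 : ∀ i, n i = 0 := by
        intro i
        match i with
        | none => exact congrFun h none
        | some A => rw [← hd0L A, h]; rfl
      rcases hnz with h2 | ⟨A, h2⟩
      · exact h2 (hx0.1 ((hn0 none).1 (h1 none)))
      · exact h2 ((hxA A).1 ((hn0 (some A)).1 (h1 (some A)))))
    (by
      apply HahnSeries.ofPowerSeries_injective (Γ := ℤ)
      rw [tsum_fintype, hpi] at hrel
      rw [map_zero, Finset.sum_insertNone, map_add, map_sum]
      have h2 : ∑ l ∈ TT s hs w, HahnSeries.ofPowerSeries ℤ (Fb Fq) ((d0 (some l) : PowerSeries (Fb Fq)) * ev hq 0 (fam s e hq w (some l))) =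
          ∑ A, D * (b A * cst Fq (∏ i, μ (A.1.eps i)) * Li Fq A.1) := by
        have h3 : (Finset.univ.image L) ⊆ TT s hs w := by
          intro l hl
          obtain ⟨A, -, rfl⟩ := Finset.mem_image.1 hl
          exact hmemT A
        rw [← Finset.sum_subset h3 (fun l _ hl => by
          rw [hd0n l (by
            rintro ⟨A, rfl⟩
            exact hl (Finset.mem_image_of_mem _ (Finset.mem_univ A)))]
          simp), Finset.sum_image (fun A _ B _ h => hL h)]
        refine Finset.sum_congr rfl fun A _ => ?_
        rw [hd0L, map_mul, hLi A, ← mul_assoc]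
        congr 1
        exact (hn (some A)).symm
      rw [h2, ← Finset.mul_sum, map_mul]
      have h4 : HahnSeries.ofPowerSeries ℤ (Fb Fq) (d0 none : PowerSeries (Fb Fq)) =
        D * (a * (-theta Fq) ^ (qc Fq * (w / (qc Fq - 1)))) := (hn none).symm
      have h5 : fam s e hq w none = gG (Fb Fq) hq ^ w := rfl
      rw [h4, h5]
      linear_combination D * hrel)
  refine ⟨fun h => hcore.1 ((hn0 none).2 (hx0.2 h)), ?_⟩
  rintro A ⟨i, hi⟩
  refine (hxA A).1 ((hn0 (some A)).1 ?_)
  rw [← hd0L]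
  exact hcore.2 _ ⟨lets A i, by simp [L, rl], hi⟩

end ZHPC
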